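/- In the stationary ergodic environment setting, suppose the pair (a,V) satisfies the scaled hill condition (S), let β ≥ 0, and let G ∈ 𝒢 be quasiconvex (every sublevel set {p : G(p) ≤ c} is a, possibly empty, convex set). Then there exist a function ℋ(G) : ℝ → ℝ and an event Ω̂ with ℙ(Ω̂) = 1 such that: (a) ℋ(G) belongs to 𝒢, is continuous, coercive and quasiconvex, its range is [min_ℝ(G + β), +∞), and ℋ(G)^{-1}(min_ℝ(G + β)) = [θ₋, θ₊] for some θ₋ ≤ θ₊; (b) for every ω ∈ Ω̂, every θ ∈ ℝ and every globally Lipschitz continuous function u_θ on [0,∞)×ℝ that is a viscosity solution of ∂_t w = a(x,ω)∂²_{xx}w + G(∂_x w) + βV(x,ω) on (0,∞)×ℝ with u_θ(0,x) = θx for all x ∈ ℝ, one has lim_{t→∞} u_θ(t,0)/t = ℋ(G)(θ). -/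

import Mathlib

open Real Set MeasureTheory

noncomputable section

/-- The class 𝒢(α₀,α₁,γ): growth condition (G1) and local Lipschitz condition (G2). -/
def MemG (α₀ α₁ γ : ℝ) (G : ℝ → ℝ) : Prop :=
  (∀ p : ℝ, α₀ * |p| ^ γ - 1 / α₀ ≤ G p ∧ G p ≤ α₁ * (|p| ^ γ + 1)) ∧
  (∀ p q : ℝ, |G p - G q| ≤ α₁ * (|p| + |q| + 1) ^ (γ - 1) * |p - q|)

/-- The class 𝒢: union of the classes 𝒢(α₀,α₁,γ). -/
def MemGclass (G : ℝ → ℝ) : Prop :=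
  ∃ α₀ α₁ γ : ℝ, 0 < α₀ ∧ 0 < α₁ ∧ 1 < γ ∧ MemG α₀ α₁ γ G

/-- Condition (G4): strict monotonicity with rate η on both half-lines. -/
def StrictIncrRate (G : ℝ → ℝ) (η : ℝ) : Prop :=
  ∀ p₁ p₂ : ℝ, 0 ≤ p₁ → p₁ < p₂ →
    η * (p₂ - p₁) ≤ G p₂ - G p₁ ∧ η * (p₂ - p₁) ≤ G (-p₂) - G (-p₁)

/-- The class 𝒢_sqc: G ∈ 𝒢, G(0) = 0 and (G4) for some η > 0. -/
def MemGsqc (G : ℝ → ℝ) : Prop :=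
  MemGclass G ∧ G 0 = 0 ∧ ∃ η : ℝ, 0 < η ∧ StrictIncrRate G η

/-- G_+^{-1} : the inverse of the restriction of G to [0,∞). -/
def GplusInv (G : ℝ → ℝ) (y : ℝ) : ℝ := Function.invFunOn G (Set.Ici 0) y

/-- G_−^{-1} : the inverse of the restriction of G to (−∞,0]. -/
def GminusInv (G : ℝ → ℝ) (y : ℝ) : ℝ := Function.invFunOn G (Set.Iic 0) y

/-- Viscosity subsolution of a(x)u'' + G(u') + βV(x) = λ on ℝ. -/
def IsViscSubsol (a V G : ℝ → ℝ) (β lam : ℝ) (u : ℝ → ℝ) : Prop :=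
  ∀ x₀ : ℝ, ∀ φ : ℝ → ℝ, ContDiff ℝ 2 φ →
    IsLocalMax (fun x => u x - φ x) x₀ →
    lam ≤ a x₀ * deriv (deriv φ) x₀ + G (deriv φ x₀) + β * V x₀

/-- Viscosity supersolution of a(x)u'' + G(u') + βV(x) = λ on ℝ. -/
def IsViscSupersol (a V G : ℝ → ℝ) (β lam : ℝ) (u : ℝ → ℝ) : Prop :=
  ∀ x₀ : ℝ, ∀ φ : ℝ → ℝ, ContDiff ℝ 2 φ →
    IsLocalMin (fun x => u x - φ x) x₀ →
    a x₀ * deriv (deriv φ) x₀ + G (deriv φ x₀) + β * V x₀ ≤ lam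

/-- Continuous viscosity solution of a(x)u'' + G(u') + βV(x) = λ on ℝ. -/
def IsViscSol (a V G : ℝ → ℝ) (β lam : ℝ) (u : ℝ → ℝ) : Prop :=
  Continuous u ∧ IsViscSubsol a V G β lam u ∧ IsViscSupersol a V G β lam u

/-- The set 𝒮^λ_+ of Lipschitz viscosity solutions with
u'(x) ∈ [G_+^{-1}(λ−β), G_+^{-1}(λ)] for a.e. x ∈ ℝ. -/
def Splus (a V G : ℝ → ℝ) (β lam : ℝ) : Set (ℝ → ℝ) :=
  {u | (∃ K : NNReal, LipschitzWith K u) ∧ IsViscSol a V G β lam u ∧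
    ∀ᵐ x ∂(volume : Measure ℝ),
      deriv u x ∈ Set.Icc (GplusInv G (lam - β)) (GplusInv G lam)}

/-- The set 𝒮^λ_− of Lipschitz viscosity solutions with
u'(x) ∈ [G_−^{-1}(λ), G_−^{-1}(λ−β)] for a.e. x ∈ ℝ. -/
def Sminus (a V G : ℝ → ℝ) (β lam : ℝ) : Set (ℝ → ℝ) :=
  {u | (∃ K : NNReal, LipschitzWith K u) ∧ IsViscSol a V G β lam u ∧
    ∀ᵐ x ∂(volume : Measure ℝ),
      deriv u x ∈ Set.Icc (GminusInv G lam) (GminusInv G (lam - β))}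

/-- Viscosity solution, continuous on [0,∞)×ℝ, of
∂_t w = a(x) ∂²_xx w + G(∂_x w) + βV(x) on (0,∞)×ℝ. -/
def IsParabolicViscSol (a V G : ℝ → ℝ) (β : ℝ) (w : ℝ → ℝ → ℝ) : Prop :=
  ContinuousOn (fun p : ℝ × ℝ => w p.1 p.2) (Set.Ici 0 ×ˢ Set.univ) ∧
  (∀ t₀ x₀ : ℝ, 0 < t₀ → ∀ φ : ℝ × ℝ → ℝ, ContDiff ℝ 2 φ →
    IsLocalMax (fun p : ℝ × ℝ => w p.1 p.2 - φ p) (t₀, x₀) →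
    deriv (fun t => φ (t, x₀)) t₀ ≤
      a x₀ * deriv (deriv (fun x => φ (t₀, x))) x₀ +
        G (deriv (fun x => φ (t₀, x)) x₀) + β * V x₀) ∧
  (∀ t₀ x₀ : ℝ, 0 < t₀ → ∀ φ : ℝ × ℝ → ℝ, ContDiff ℝ 2 φ →
    IsLocalMin (fun p : ℝ × ℝ => w p.1 p.2 - φ p) (t₀, x₀) →
    a x₀ * deriv (deriv (fun x => φ (t₀, x))) x₀ +
      G (deriv (fun x => φ (t₀, x)) x₀) + β * V x₀ ≤
      deriv (fun t => φ (t, x₀)) t₀)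

lemma hasDerivAt_sq_max_zero (y : ℝ) :
    HasDerivAt (fun z : ℝ => (max z 0) ^ 2) (2 * max y 0) y := by
  rcases lt_trichotomy y 0 with h | h | h
  · rw [max_eq_right h.le, mul_zero]
    refine (hasDerivAt_const y (0 : ℝ)).congr_of_eventuallyEq ?_
    filter_upwards [eventually_lt_nhds h] with z hz
    simp [max_eq_right hz.le]
  · subst h
    rw [hasDerivAt_iff_isLittleO]
    simp only [max_self, mul_zero, sub_zero, smul_zero, ne_eq, OfNat.ofNat_ne_zero,
      not_false_eq_true, zero_pow]
    have h1 : (fun z : ℝ => (max z 0) ^ 2) =O[nhds 0] fun z : ℝ => z ^ 2 := by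
      refine Asymptotics.IsBigO.of_bound 1 (Filter.Eventually.of_forall fun z => ?_)
      rw [one_mul, Real.norm_of_nonneg (by positivity), Real.norm_of_nonneg (by positivity)]
      exact sq_le_sq.2 (by
        rw [abs_of_nonneg (le_max_right _ _)]; exact max_le (le_abs_self _) (abs_nonneg _))
    refine h1.trans_isLittleO ?_
    simpa using (Asymptotics.isLittleO_pow_id (𝕜 := ℝ) (n := 2) (by norm_num))
  · have : HasDerivAt (fun z : ℝ => z ^ 2) (2 * y) y := by simpa using hasDerivAt_pow 2 y
    rw [max_eq_left h.le]
    refine this.congr_of_eventuallyEq ?_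
    filter_upwards [eventually_gt_nhds h] with z hz
    simp [max_eq_left (le_of_lt hz)]

/-- Comparison on a left half-line for differentiable functions whose difference is bounded above
and contracts exponentially wherever it is positive. -/
lemma le_of_contracting {f₁ f₂ d₁ d₂ : ℝ → ℝ} {k B x₀ : ℝ} (hk : 0 < k)
    (h₁ : ∀ x ≤ x₀, HasDerivAt f₁ (d₁ x) x) (h₂ : ∀ x ≤ x₀, HasDerivAt f₂ (d₂ x) x)
    (hB : ∀ x ≤ x₀, f₁ x - f₂ x ≤ B)
    (h : ∀ x ≤ x₀, f₂ x < f₁ x → d₁ x - d₂ x ≤ -k * (f₁ x - f₂ x)) : f₁ x₀ ≤ f₂ x₀ := by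
  set ψ : ℝ → ℝ := fun x => (max (f₁ x - f₂ x) 0) ^ 2 * exp (2 * k * x) with hψ
  have hd : ∀ x ≤ x₀, HasDerivAt ψ
      (2 * max (f₁ x - f₂ x) 0 * (d₁ x - d₂ x) * exp (2 * k * x) +
        (max (f₁ x - f₂ x) 0) ^ 2 * (exp (2 * k * x) * (2 * k))) x := by
    intro x hx
    have e : HasDerivAt (fun x => exp (2 * k * x)) (exp (2 * k * x) * (2 * k)) x := by
      have := ((hasDerivAt_id x).const_mul (2 * k)).exp
      simpa using this
    have s := (hasDerivAt_sq_max_zero (f₁ x - f₂ x)).comp x ((h₁ x hx).sub (h₂ x hx))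
    exact s.mul e
  have hanti : AntitoneOn ψ (Iic x₀) := by
    refine antitoneOn_of_deriv_nonpos (convex_Iic x₀)
      (fun x hx => (hd x hx).continuousAt.continuousWithinAt) ?_ ?_
    · intro x hx
      exact (hd x (interior_subset (s := Iic x₀) hx)).differentiableAt.differentiableWithinAt
    · intro x hx
      have hx : x ≤ x₀ := interior_subset (s := Iic x₀) hx
      rw [(hd x hx).deriv]
      rcases le_or_gt (f₁ x) (f₂ x) with h' | h'
      · rw [max_eq_right (by linarith)]; simp
      · rw [max_eq_left (by linarith)]
        have h3 := h x hx h'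
        have h4 : 0 < f₁ x - f₂ x := by linarith
        have : 2 * (f₁ x - f₂ x) * (d₁ x - d₂ x) + (f₁ x - f₂ x) ^ 2 * (2 * k) ≤ 0 := by nlinarith
        nlinarith [exp_pos (2 * k * x)]
  have hle : ∀ x ≤ x₀, ψ x₀ ≤ (max B 0) ^ 2 * exp (2 * k * x) := by
    intro x hx
    refine (hanti hx (le_refl x₀) hx).trans ?_
    simp only [hψ]
    gcongr
    exact hB x hx
  have hlim : Filter.Tendsto (fun x => (max B 0) ^ 2 * exp (2 * k * x)) Filter.atBot (nhds 0) := by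
    have : Filter.Tendsto (fun x => 2 * k * x) Filter.atBot Filter.atBot :=
      Filter.tendsto_id.const_mul_atBot (by positivity)
    simpa using (tendsto_exp_atBot.comp this).const_mul ((max B 0) ^ 2)
  have h0 : ψ x₀ ≤ 0 := ge_of_tendsto hlim
    ((Filter.eventually_le_atBot x₀).mono hle)
  by_contra! hc
  have : 0 < ψ x₀ := by
    simp only [hψ]
    rw [max_eq_left (by linarith)]
    have : 0 < f₁ x₀ - f₂ x₀ := by linarith
    positivity
  linarith

/-- Lower bound on the derivative of a bounded solution of `A f' + g(f) = r`, uniform in how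
degenerate `A` is. -/
lemma neg_le_deriv_of_ode {A r f d g : ℝ → ℝ} {η κ L B C : ℝ} (hη : 0 < η) (hκ : 0 < κ)
    (hA : ∀ x, 0 < A x) (hAκ : ∀ x y, |√(A x) - √(A y)| ≤ κ * |x - y|)
    (hr : ∀ x y, |r x - r y| ≤ L * |x - y|)
    (hg : ∀ p q, p ≤ q → η * (q - p) ≤ g q - g p) (hgc : Continuous g)
    (hf : ∀ x, HasDerivAt f (d x) x) (hode : ∀ x, A x * d x + g (f x) = r x)
    (hB : ∀ x, |g (f x) - r x| ≤ B) (hC₀ : 0 < C)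
    (hC₁ : 2 * (L + 1) ≤ η * C) (hC₂ : B ≤ C * (η / (4 * κ)) ^ 2) (x₀ : ℝ) : -C ≤ d x₀ := by
  by_contra! hlt
  have hfc : Continuous f := continuous_iff_continuousAt.2 fun x => (hf x).continuousAt
  have hrc : Continuous r := by
    refine (LipschitzWith.of_dist_le_mul (K := (max L 0).toNNReal) fun x y => ?_).continuous
    rw [Real.dist_eq, Real.dist_eq, Real.coe_toNNReal _ (le_max_right _ _)]
    exact (hr x y).trans (by gcongr; exact le_max_left _ _)
  have hsc : Continuous fun x => √(A x) := by
    refine (LipschitzWith.of_dist_le_mul (K := κ.toNNReal) fun x y => ?_).continuous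
    rw [Real.dist_eq, Real.dist_eq, Real.coe_toNNReal _ hκ.le]
    exact hAκ x y
  have hAs : ∀ x, A x = √(A x) ^ 2 := fun x => (Real.sq_sqrt (hA x).le).symm
  have hAc : Continuous A := by
    rw [funext hAs]; exact hsc.pow 2
  set E : ℝ → ℝ := fun x => g (f x) - r x - C * A x - |x - x₀| with hE
  have hEc : Continuous E := by fun_prop
  have hE0 : 0 < E x₀ := by
    have := hode x₀
    simp only [hE, sub_self, abs_zero]
    nlinarith [hA x₀]
  obtain ⟨x₁, hx₁⟩ : ∃ x₁, ∀ x, E x ≤ E x₁ := by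
    refine hEc.exists_forall_ge' x₀ ?_
    have : ∀ᶠ x in Filter.cocompact ℝ, x ∉ Metric.closedBall x₀ B :=
      (isCompact_closedBall x₀ B).compl_mem_cocompact
    filter_upwards [this] with x hx
    rw [Metric.mem_closedBall, Real.dist_eq, not_le] at hx
    have h1 := (abs_le.1 (hB x)).2
    simp only [hE] at hE0 ⊢
    nlinarith [hA x]
  have hpos : 0 < E x₁ := hE0.trans_le (hx₁ x₀)
  have hD : C * A x₁ < g (f x₁) - r x₁ := by
    simp only [hE] at hpos
    linarith [abs_nonneg (x₁ - x₀)]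
  have hsmall : √(A x₁) ≤ η / (4 * κ) := by
    have h1 := (abs_le.1 (hB x₁)).2
    have : A x₁ < (η / (4 * κ)) ^ 2 := by nlinarith
    refine (Real.sqrt_le_sqrt this.le).trans ?_
    rw [Real.sqrt_sq (by positivity)]
  have hd1 : d x₁ < -C := by
    have := hode x₁
    nlinarith [hA x₁]
  have key : ∀ x < x₁, η * (f x - f x₁) ≤
      (L + 1 + C * κ * (√(A x) + √(A x₁))) * (x₁ - x) := by
    intro x hx
    have hEx := hx₁ x
    simp only [hE] at hEx
    have t1 := (abs_le.1 (hr x x₁)).2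
    have t2 : |x - x₀| - |x₁ - x₀| ≤ x₁ - x := by
      have := abs_sub_abs_le_abs_sub (x - x₀) (x₁ - x₀)
      rw [show x - x₀ - (x₁ - x₀) = -(x₁ - x) by ring, abs_neg, abs_of_pos (sub_pos.2 hx)] at this
      exact this
    have t3 : A x - A x₁ ≤ κ * (√(A x) + √(A x₁)) * (x₁ - x) := by
      have h3 := (abs_le.1 (hAκ x x₁)).2
      rw [abs_sub_comm, abs_of_pos (sub_pos.2 hx)] at h3
      have : A x - A x₁ = (√(A x) - √(A x₁)) * (√(A x) + √(A x₁)) := by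
        nlinarith [hAs x, hAs x₁]
      rw [this]
      nlinarith [Real.sqrt_nonneg (A x), Real.sqrt_nonneg (A x₁)]
    rw [abs_sub_comm x x₁, abs_of_pos (sub_pos.2 hx)] at t1
    have hb : g (f x) - g (f x₁) ≤
        (L + 1 + C * κ * (√(A x) + √(A x₁))) * (x₁ - x) := by
      nlinarith
    rcases le_total (f x₁) (f x) with h | h
    · linarith [hg _ _ h]
    · have hL : 0 ≤ L * (x₁ - x) := by
        have := (abs_nonneg _).trans (hr x x₁)
        rwa [abs_sub_comm x x₁, abs_of_pos (sub_pos.2 hx)] at this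
      have : 0 ≤ C * κ * (√(A x) + √(A x₁)) * (x₁ - x) := by
        have := sub_pos.2 hx
        positivity
      nlinarith
  have hslope : Filter.Tendsto (slope f x₁) (nhdsWithin x₁ (Iio x₁)) (nhds (d x₁)) :=
    (hasDerivWithinAt_iff_tendsto_slope' (by simp)).1 (hf x₁).hasDerivWithinAt
  have hK : Filter.Tendsto (fun x => -(L + 1 + C * κ * (√(A x) + √(A x₁))))
      (nhdsWithin x₁ (Iio x₁)) (nhds (-(L + 1 + C * κ * (√(A x₁) + √(A x₁))))) := by
    have : Continuous fun x => -(L + 1 + C * κ * (√(A x) + √(A x₁))) := by fun_prop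
    exact this.continuousAt.tendsto.mono_left nhdsWithin_le_nhds
  have hfin : -(L + 1 + C * κ * (√(A x₁) + √(A x₁))) ≤ η * d x₁ := by
    refine le_of_tendsto_of_tendsto hK (hslope.const_mul η) ?_
    filter_upwards [self_mem_nhdsWithin] with x hx
    have hx : x < x₁ := hx
    have := key x hx
    rw [slope_def_field, mul_div_assoc', le_div_iff_of_neg (by linarith)]
    nlinarith
  have : C * κ * (√(A x₁) + √(A x₁)) ≤ C * η / 2 := by
    have h5 : κ * √(A x₁) ≤ η / 4 := by
      have := mul_le_mul_of_nonneg_left hsmall hκ.le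
      rwa [show κ * (η / (4 * κ)) = η / 4 by field_simp] at this
    nlinarith
  nlinarith

lemma abs_deriv_le_of_ode {A r f d g : ℝ → ℝ} {η κ L B C : ℝ} (hη : 0 < η) (hκ : 0 < κ)
    (hA : ∀ x, 0 < A x) (hAκ : ∀ x y, |√(A x) - √(A y)| ≤ κ * |x - y|)
    (hr : ∀ x y, |r x - r y| ≤ L * |x - y|)
    (hg : ∀ p q, p ≤ q → η * (q - p) ≤ g q - g p) (hgc : Continuous g)
    (hf : ∀ x, HasDerivAt f (d x) x) (hode : ∀ x, A x * d x + g (f x) = r x)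
    (hB : ∀ x, |g (f x) - r x| ≤ B) (hC₀ : 0 < C)
    (hC₁ : 2 * (L + 1) ≤ η * C) (hC₂ : B ≤ C * (η / (4 * κ)) ^ 2) (x₀ : ℝ) : |d x₀| ≤ C := by
  rw [abs_le]
  refine ⟨neg_le_deriv_of_ode hη hκ hA hAκ hr hg hgc hf hode hB hC₀ hC₁ hC₂ x₀, ?_⟩
  have := neg_le_deriv_of_ode (A := A) (r := fun x => -r x) (f := fun x => -f x)
    (d := fun x => -d x) (g := fun p => -g (-p)) (L := L) (B := B) (C := C) hη hκ hA hAκ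
    (fun x y => by
      rw [show -r x - -r y = -(r x - r y) by ring, abs_neg]; exact hr x y)
    (fun p q h => by have := hg (-q) (-p) (by linarith); linarith)
    (by fun_prop) (fun x => (hf x).neg)
    (fun x => by have := hode x; simp only [neg_neg]; linarith)
    (fun x => by
      simp only [neg_neg]
      rw [show -g (f x) - -r x = -(g (f x) - r x) by ring, abs_neg]; exact hB x)
    hC₀ hC₁ hC₂ x₀
  linarith

lemma integrableOn_exp_mul_bdd {k b : ℝ} (hk : 0 < k) {ψ : ℝ → ℝ} (hψ : Measurable ψ) {B : ℝ}
    (hB : ∀ u, |ψ u| ≤ B) : IntegrableOn (fun u => exp (k * u) * ψ u) (Iic b) := by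
  refine (integrableOn_exp_mul_Iic hk b).mul_bdd (c := B) hψ.aestronglyMeasurable
    (Filter.Eventually.of_forall hB)

/-- Exponentially weighted average of an observable over the past of a flow. -/
def pastAverage {Ω : Type*} (τ : ℝ → Ω → Ω) (k : ℝ) (Ψ : Ω → ℝ) (ω : Ω) : ℝ :=
  ∫ u in Iic (0 : ℝ), exp (k * u) * Ψ (τ u ω)

section
variable {Ω : Type*} [MeasurableSpace Ω] {τ : ℝ → Ω → Ω}

lemma measurable_flow_left (hτ : Measurable fun p : ℝ × Ω => τ p.1 p.2) (ω : Ω) :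
    Measurable fun x => τ x ω := hτ.comp (measurable_id.prodMk measurable_const)

lemma measurable_pastAverage (hτ : Measurable fun p : ℝ × Ω => τ p.1 p.2) {Ψ : Ω → ℝ} (k : ℝ)
    (hΨ : Measurable Ψ) : Measurable (pastAverage τ k Ψ) := by
  have h : Measurable (Function.uncurry fun (ω : Ω) (u : ℝ) => exp (k * u) * Ψ (τ u ω)) := by
    refine Measurable.mul (by fun_prop) (hΨ.comp ?_)
    exact hτ.comp (measurable_snd.prodMk measurable_fst)
  exact (h.stronglyMeasurable.integral_prod_right (ν := volume.restrict (Iic (0:ℝ)))).measurable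

lemma abs_pastAverage_sub_le (hτ : Measurable fun p : ℝ × Ω => τ p.1 p.2) {Ψ₁ Ψ₂ : Ω → ℝ}
    {k B₁ B₂ D : ℝ} (hk : 0 < k) (h₁ : Measurable Ψ₁) (h₂ : Measurable Ψ₂)
    (hB₁ : ∀ ω, |Ψ₁ ω| ≤ B₁) (hB₂ : ∀ ω, |Ψ₂ ω| ≤ B₂) (hD : ∀ ω, |Ψ₁ ω - Ψ₂ ω| ≤ D) (ω : Ω) :
    |pastAverage τ k Ψ₁ ω - pastAverage τ k Ψ₂ ω| ≤ D / k := by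
  have hm := measurable_flow_left hτ ω
  have i₁ := integrableOn_exp_mul_bdd (b := 0) hk (h₁.comp hm) (fun u => hB₁ _)
  have i₂ := integrableOn_exp_mul_bdd (b := 0) hk (h₂.comp hm) (fun u => hB₂ _)
  have e : pastAverage τ k Ψ₁ ω - pastAverage τ k Ψ₂ ω = _ := (integral_sub i₁ i₂).symm
  rw [e]
  have hle : ‖∫ u in Iic (0:ℝ), (exp (k * u) * (Ψ₁ ∘ fun x => τ x ω) u -
      exp (k * u) * (Ψ₂ ∘ fun x => τ x ω) u)‖ ≤ ∫ u in Iic (0:ℝ), exp (k * u) * D := by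
    refine norm_integral_le_of_norm_le ((integrableOn_exp_mul_Iic hk 0).mul_const D)
      (Filter.Eventually.of_forall fun u => ?_)
    rw [← mul_sub, norm_mul, Real.norm_of_nonneg (exp_pos _).le]
    gcongr
    exact hD _
  refine hle.trans_eq ?_
  rw [integral_mul_const, integral_exp_mul_Iic hk]
  simp
  ring

lemma hasDerivAt_pastAverage (hτ : Measurable fun p : ℝ × Ω => τ p.1 p.2)
    (hτ_add : ∀ x y : ℝ, ∀ ω, τ (x + y) ω = τ x (τ y ω)) {Ψ : Ω → ℝ}
    {k B : ℝ} (hk : 0 < k) (hΨ : Measurable Ψ) (hB : ∀ ω, |Ψ ω| ≤ B) (ω : Ω) :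
    Continuous (fun x => pastAverage τ k Ψ (τ x ω)) ∧
    ((Continuous fun x => Ψ (τ x ω)) → ∀ x, HasDerivAt (fun x => pastAverage τ k Ψ (τ x ω))
      (Ψ (τ x ω) - k * pastAverage τ k Ψ (τ x ω)) x) := by
  set ψ : ℝ → ℝ := fun u => Ψ (τ u ω) with hψ
  have hψm : Measurable ψ := hΨ.comp (measurable_flow_left hτ ω)
  have hint : ∀ b, IntegrableOn (fun u => exp (k * u) * ψ u) (Iic b) := fun b =>
    integrableOn_exp_mul_bdd hk hψm (fun u => hB _)
  have hii : ∀ a b, IntervalIntegrable (fun u => exp (k * u) * ψ u) volume a b := fun a b =>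
    ⟨(hint b).mono_set Ioc_subset_Iic_self, (hint a).mono_set Ioc_subset_Iic_self⟩
  have heq : (fun x => pastAverage τ k Ψ (τ x ω)) = fun x =>
      exp (-k * x) * ((∫ u in Iic (0:ℝ), exp (k * u) * ψ u) +
        ∫ u in (0:ℝ)..x, exp (k * u) * ψ u) := by
    funext x
    rw [← intervalIntegral.integral_Iic_sub_Iic (hint 0) (hint x), add_sub_cancel]
    have hp : (fun u => u + x) ⁻¹' Iic x = Iic 0 := by ext u; simp
    rw [← (measurePreserving_add_right volume x).setIntegral_preimage_emb
      (measurableEmbedding_addRight x) (fun u => exp (k * u) * ψ u) (Iic x), hp,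
      ← integral_const_mul]
    unfold pastAverage
    congr 1
    funext u
    simp only [hψ]
    rw [hτ_add, ← mul_assoc, ← exp_add]
    congr 2
    ring
  have he : ∀ x, HasDerivAt (fun x => exp (-k * x)) (exp (-k * x) * (-k)) x := fun x => by
    simpa using ((hasDerivAt_id x).const_mul (-k)).exp
  rw [heq]
  constructor
  · refine Continuous.mul (by fun_prop) (continuous_const.add ?_)
    exact intervalIntegral.continuous_primitive (fun a b => hii a b) 0
  · intro hc x
    have hi : HasDerivAt (fun x => ∫ u in (0:ℝ)..x, exp (k * u) * ψ u) (exp (k * x) * ψ x) x := by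
      have hc' : Continuous fun u => exp (k * u) * ψ u := by fun_prop
      exact intervalIntegral.integral_hasDerivAt_right (hii 0 x)
        (hc'.stronglyMeasurableAtFilter _ _) hc'.continuousAt
    have := (he x).mul (hi.const_add (∫ u in Iic (0:ℝ), exp (k * u) * ψ u))
    refine this.congr_deriv ?_
    have : exp (-k * x) * exp (k * x) = 1 := by rw [← exp_add]; simp
    have e2 := congrFun heq x
    linear_combination (ψ x) * this + k * e2

/-- Bounded stationary solution of a dissipative scalar equation driven by a flow. -/
theorem exists_flow_solution (hτ : Measurable fun p : ℝ × Ω => τ p.1 p.2)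
    (hτ_add : ∀ x y : ℝ, ∀ ω, τ (x + y) ω = τ x (τ y ω))
    {A r : Ω → ℝ} {g : ℝ → ℝ} {δ η Λ R : ℝ} (hδ : 0 < δ) (hη : 0 < η)
    (hAm : Measurable A) (hrm : Measurable r) (hAδ : ∀ ω, δ ≤ A ω) (hA2 : ∀ ω, A ω ≤ 2)
    (hrR : ∀ ω, |r ω| ≤ R) (hAc : ∀ ω, Continuous fun x => A (τ x ω))
    (hrc : ∀ ω, Continuous fun x => r (τ x ω))
    (hgη : ∀ p q, p ≤ q → η * (q - p) ≤ g q - g p)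
    (hgΛ : ∀ p q, p ≤ q → g q - g p ≤ Λ * (q - p)) :
    ∃ f : Ω → ℝ, Measurable f ∧ (∃ B, ∀ ω, |f ω| ≤ B) ∧
      ∀ ω x, HasDerivAt (fun x => f (τ x ω))
        ((r (τ x ω) - g (f (τ x ω))) / A (τ x ω)) x := by
  have hgabs : ∀ p q, |g p - g q| ≤ Λ * |p - q| := by
    intro p q
    rcases le_total p q with h | h
    · have h1 := hgη p q h
      have h2 := hgΛ p q h
      rw [abs_sub_comm, abs_sub_comm p q, abs_of_nonneg (sub_nonneg.2 h), abs_of_nonneg]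
      · exact h2
      · nlinarith
    · have h1 := hgη q p h
      have h2 := hgΛ q p h
      rw [abs_of_nonneg (sub_nonneg.2 h), abs_of_nonneg]
      · exact h2
      · nlinarith
  have hηΛ : η ≤ Λ := by
    have h1 := hgη 0 1 zero_le_one
    have h2 := hgΛ 0 1 zero_le_one
    linarith
  have hΛ : 0 < Λ := hη.trans_le hηΛ
  have hgc : Continuous g := by
    refine (LipschitzWith.of_dist_le_mul (K := Λ.toNNReal) fun x y => ?_).continuous
    rw [Real.dist_eq, Real.dist_eq, Real.coe_toNNReal _ hΛ.le]
    exact hgabs x y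
  have hApos : ∀ ω, 0 < A ω := fun ω => hδ.trans_le (hAδ ω)
  rcases isEmpty_or_nonempty Ω with hΩ | ⟨⟨ω₀⟩⟩
  · exact ⟨fun _ => 0, measurable_const, ⟨0, fun ω => (IsEmpty.false ω).elim⟩,
      fun ω => (IsEmpty.false ω).elim⟩
  have hδ2 : δ ≤ 2 := (hAδ ω₀).trans (hA2 ω₀)
  set k : ℝ := Λ / δ with hk
  have hkpos : 0 < k := by positivity
  have hkη : η / 2 ≤ k := by
    rw [hk, div_le_div_iff₀ (by norm_num) hδ]; nlinarith
  set Ψ : (Ω → ℝ) → Ω → ℝ := fun f ω => k * f ω + (r ω - g (f ω)) / A ω with hΨ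
  have hΨm : ∀ f, Measurable f → Measurable (Ψ f) := fun f hf =>
    (hf.const_mul k).add ((hrm.sub (hgc.measurable.comp hf)).div hAm)
  have hone : ∀ ω p q, p ≤ q →
      0 ≤ (k * q + (r ω - g q) / A ω) - (k * p + (r ω - g p) / A ω) ∧
      (k * q + (r ω - g q) / A ω) - (k * p + (r ω - g p) / A ω) ≤ (k - η / 2) * (q - p) := by
    intro ω p q hpq
    have e : (k * q + (r ω - g q) / A ω) - (k * p + (r ω - g p) / A ω)
        = k * (q - p) - (g q - g p) / A ω := by ring
    have hqp := sub_nonneg.2 hpq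
    rw [e]
    constructor
    · have : (g q - g p) / A ω ≤ k * (q - p) := by
        rw [hk, div_mul_eq_mul_div]
        exact div_le_div₀ (by positivity) (hgΛ p q hpq) hδ (hAδ ω)
      linarith
    · have : η / 2 * (q - p) ≤ (g q - g p) / A ω := by
        rw [le_div_iff₀ (hApos ω)]
        have := hgη p q hpq
        have h3 : η / 2 * (q - p) * A ω ≤ η / 2 * (q - p) * 2 := by
          gcongr
          exact hA2 ω
        linarith
      linarith
  have hΨlip : ∀ (f h : Ω → ℝ) ω, |Ψ f ω - Ψ h ω| ≤ (k - η / 2) * |f ω - h ω| := by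
    intro f h ω
    rcases le_total (f ω) (h ω) with hle | hle
    · obtain ⟨h1, h2⟩ := hone ω _ _ hle
      rw [abs_sub_comm, abs_sub_comm (f ω), abs_of_nonneg (sub_nonneg.2 hle), abs_of_nonneg h1]
      exact h2
    · obtain ⟨h1, h2⟩ := hone ω _ _ hle
      rw [abs_of_nonneg (sub_nonneg.2 hle), abs_of_nonneg h1]
      exact h2
  have hΨ0 : ∀ ω, |Ψ (fun _ => 0) ω| ≤ (R + |g 0|) / δ := by
    intro ω
    simp only [hΨ, mul_zero, zero_add, abs_div, abs_of_pos (hApos ω)]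
    have : |r ω - g 0| ≤ R + |g 0| := (abs_sub _ _).trans (by gcongr; exact hrR ω)
    have h0 : 0 ≤ |r ω - g 0| := abs_nonneg _
    exact div_le_div₀ (by linarith) this hδ (hAδ ω)
  have hΨB : ∀ f B, (∀ ω, |f ω| ≤ B) → ∀ ω, |Ψ f ω| ≤ (R + |g 0|) / δ + (k - η / 2) * B := by
    intro f B hB ω
    have h1 := hΨlip f (fun _ => 0) ω
    have h2 := hΨ0 ω
    have h3 : |Ψ f ω| ≤ |Ψ f ω - Ψ (fun _ => 0) ω| + |Ψ (fun _ => 0) ω| := by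
      have := abs_add_le (Ψ f ω - Ψ (fun _ => 0) ω) (Ψ (fun _ => 0) ω)
      rwa [sub_add_cancel] at this
    rw [sub_zero] at h1
    have h4 : (k - η / 2) * |f ω| ≤ (k - η / 2) * B :=
      mul_le_mul_of_nonneg_left (hB ω) (by linarith)
    linarith
  set q : ℝ := (k - η / 2) / k with hq
  have hq0 : 0 ≤ q := div_nonneg (by linarith) hkpos.le
  have hq1 : q < 1 := by rw [hq, div_lt_one hkpos]; linarith
  set T : (Ω → ℝ) → Ω → ℝ := fun f => pastAverage τ k (Ψ f) with hT
  have hTlip : ∀ (f h : Ω → ℝ) (B₁ B₂ D : ℝ), Measurable f → Measurable h →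
      (∀ ω, |f ω| ≤ B₁) → (∀ ω, |h ω| ≤ B₂) → (∀ ω, |f ω - h ω| ≤ D) →
      ∀ ω, |T f ω - T h ω| ≤ q * D := by
    intro f h B₁ B₂ D hf hh h1 h2 hD ω
    have := abs_pastAverage_sub_le hτ hkpos (hΨm f hf) (hΨm h hh) (hΨB f B₁ h1) (hΨB h B₂ h2)
      (D := (k - η / 2) * D) (fun ω => (hΨlip f h ω).trans
        (mul_le_mul_of_nonneg_left (hD ω) (by linarith))) ω
    refine this.trans_eq ?_
    rw [hq]; ring
  have hTbd : ∀ f B, Measurable f → (∀ ω, |f ω| ≤ B) →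
      ∀ ω, |T f ω| ≤ ((R + |g 0|) / δ + (k - η / 2) * B) / k := by
    intro f B hf hB ω
    have := abs_pastAverage_sub_le (B₂ := 0) hτ hkpos (hΨm f hf)
      (measurable_const (a := (0 : ℝ))) (hΨB f B hB) (by simp)
      (D := (R + |g 0|) / δ + (k - η / 2) * B) (fun ω => by simpa using hΨB f B hB ω) ω
    simpa [pastAverage, hT] using this
  have hTm : ∀ f, Measurable f → Measurable (T f) := fun f hf =>
    measurable_pastAverage hτ k (hΨm f hf)
  set F : ℕ → Ω → ℝ := fun n => T^[n] (fun _ => 0) with hF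
  have hFs : ∀ n, F (n + 1) = T (F n) := fun n => Function.iterate_succ_apply' T n _
  have hFm : ∀ n, Measurable (F n) := by
    intro n
    induction n with
    | zero => exact measurable_const
    | succ n ih => rw [hFs]; exact hTm _ ih
  have hFb : ∀ n, ∃ B, ∀ ω, |F n ω| ≤ B := by
    intro n
    induction n with
    | zero => exact ⟨0, fun ω => by simp [hF]⟩
    | succ n ih =>
      obtain ⟨B, hB⟩ := ih
      rw [hFs]
      exact ⟨_, hTbd _ B (hFm n) hB⟩
  obtain ⟨D, hD⟩ := hFb 1
  have hgeo : ∀ n ω, dist (F n ω) (F (n + 1) ω) ≤ D * q ^ n := by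
    intro n
    induction n with
    | zero =>
      intro ω
      rw [dist_comm, Real.dist_eq]
      simpa [hF] using hD ω
    | succ n ih =>
      intro ω
      obtain ⟨B₁, h1⟩ := hFb n
      obtain ⟨B₂, h2⟩ := hFb (n + 1)
      rw [Real.dist_eq, hFs n, hFs (n + 1), pow_succ]
      refine (hTlip (F n) (F (n + 1)) B₁ B₂ _ (hFm _) (hFm _) h1 h2 (fun ω => ?_) ω).trans_eq
        (by ring : q * (D * q ^ n) = _)
      rw [← Real.dist_eq]
      exact ih ω
  have hex : ∀ ω, ∃ y, Filter.Tendsto (fun n => F n ω) Filter.atTop (nhds y) := fun ω =>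
    cauchySeq_tendsto_of_complete (cauchySeq_of_le_geometric q D hq1 fun n => hgeo n ω)
  choose f hf using hex
  have hfm : Measurable f :=
    measurable_of_tendsto_metrizable hFm (tendsto_pi_nhds.2 hf)
  have hdist : ∀ n ω, |f ω - F n ω| ≤ D * q ^ n / (1 - q) := fun n ω => by
    rw [← Real.dist_eq, dist_comm]
    exact dist_le_of_le_geometric_of_tendsto q D hq1 (fun n => hgeo n ω) (hf ω) n
  have hfb : ∀ ω, |f ω| ≤ D * q ^ 0 / (1 - q) := fun ω => by
    simpa [hF] using hdist 0 ω
  have hfix : T f = f := by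
    funext ω
    have hlim : Filter.Tendsto (fun n => F (n + 1) ω) Filter.atTop (nhds (T f ω)) := by
      rw [tendsto_iff_dist_tendsto_zero]
      have hz : Filter.Tendsto (fun n : ℕ => q * (D * q ^ n / (1 - q))) Filter.atTop (nhds 0) := by
        have := ((tendsto_pow_atTop_nhds_zero_of_lt_one hq0 hq1).const_mul (q * D / (1 - q)))
        rw [mul_zero] at this
        refine this.congr fun n => by ring
      refine squeeze_zero (fun _ => dist_nonneg) (fun n => ?_) hz
      obtain ⟨B₁, h1⟩ := hFb n
      rw [dist_comm, Real.dist_eq, hFs]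
      exact hTlip f (F n) _ B₁ _ hfm (hFm n) hfb h1 (hdist n) ω
    exact tendsto_nhds_unique hlim ((Filter.tendsto_add_atTop_iff_nat 1).2 (hf ω))
  refine ⟨f, hfm, ⟨_, hfb⟩, fun ω x => ?_⟩
  obtain ⟨hc, hd⟩ := hasDerivAt_pastAverage hτ hτ_add hkpos (hΨm f hfm) (hΨB f _ hfb) ω
  have hTf : pastAverage τ k (Ψ f) = f := hfix
  rw [hTf] at hc hd
  have hΨc : Continuous fun x => Ψ f (τ x ω) := by
    refine (hc.const_mul k).add (((hrc ω).sub (hgc.comp hc)).div (hAc ω) fun x => ?_)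
    exact (hApos _).ne'
  refine (hd hΨc x).congr_deriv ?_
  simp only [hΨ]
  ring
end

lemma abs_sqrt_add_sub_sqrt_add_le {x y δ : ℝ} (hx : 0 ≤ x) (hy : 0 ≤ y) (hδ : 0 ≤ δ) :
    |√(x + δ) - √(y + δ)| ≤ |√x - √y| := by
  wlog h : y ≤ x generalizing x y
  · rw [abs_sub_comm, abs_sub_comm √x]
    exact this hy hx (le_of_not_ge h)
  have h1 : √y ≤ √x := Real.sqrt_le_sqrt h
  have h2 : √(y + δ) ≤ √(x + δ) := Real.sqrt_le_sqrt (by linarith)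
  rw [abs_of_nonneg (sub_nonneg.2 h1), abs_of_nonneg (sub_nonneg.2 h2)]
  have h3 : √y ≤ √(y + δ) := Real.sqrt_le_sqrt (by linarith)
  have h4 : √(x + δ) ≤ √(y + δ) + (√x - √y) := by
    refine Real.sqrt_le_iff.2 ⟨by linarith [Real.sqrt_nonneg (y + δ)], ?_⟩
    nlinarith [Real.sq_sqrt hx, Real.sq_sqrt hy, Real.sq_sqrt (add_nonneg hy hδ)]
  linarith

/-- Bound on the derivative of correctors, independent of the ellipticity. -/
def derivBound (κ L η B : ℝ) : ℝ := 2 * (L + 1) / η + B * (4 * κ / η) ^ 2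

section
variable {Ω : Type*} [MeasurableSpace Ω] {τ : ℝ → Ω → Ω}

/-- Stationary correctors above a minimum point `p₀` of the Hamiltonian. -/
theorem exists_corrector (hτ : Measurable fun p : ℝ × Ω => τ p.1 p.2)
    (hτ_zero : ∀ ω, τ 0 ω = ω)
    (hτ_add : ∀ x y : ℝ, ∀ ω, τ (x + y) ω = τ x (τ y ω))
    {a r : Ω → ℝ} {G : ℝ → ℝ} {p₀ κ L η δ lam : ℝ} (hκ : 0 < κ) (hL : 0 ≤ L) (hη : 0 < η)
    (hδ : 0 < δ) (hδ1 : δ ≤ 1) (ham : Measurable a) (hrm : Measurable r)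
    (ha : ∀ ω, a ω ∈ Icc (0 : ℝ) 1)
    (haκ : ∀ ω x y, |√(a (τ x ω)) - √(a (τ y ω))| ≤ κ * |x - y|)
    (hr : ∀ ω, r ω ∈ Icc (G p₀) lam)
    (hrL : ∀ ω x y, |r (τ x ω) - r (τ y ω)| ≤ L * |x - y|)
    (hmono : MonotoneOn G (Ici p₀))
    (hlip : ∀ P, ∃ Λ, ∀ p ∈ Icc p₀ P, ∀ q ∈ Icc p₀ P, |G p - G q| ≤ Λ * |p - q|)
    (hcoer : ∃ P, p₀ ≤ P ∧ lam ≤ G P) :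
    ∃ f : Ω → ℝ, Measurable f ∧ (∀ ω, p₀ ≤ f ω) ∧ (∀ ω, G (f ω) + η * (f ω - p₀) ≤ lam) ∧
      ∀ ω x, ∃ d, HasDerivAt (fun x => f (τ x ω)) d x ∧
        (a (τ x ω) + δ) * d + (G (f (τ x ω)) + η * (f (τ x ω) - p₀)) = r (τ x ω) ∧
        |d| ≤ derivBound κ L η (lam - G p₀) := by
  obtain ⟨P, hP₀, hP⟩ := hcoer
  obtain ⟨Λ, hΛ⟩ := hlip P
  set c : ℝ → ℝ := fun p => max p₀ (min p P) with hc
  have hcm : ∀ p, c p ∈ Icc p₀ P := fun p => ⟨le_max_left _ _, max_le hP₀ (min_le_right _ _)⟩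
  have hcmono : ∀ p q, p ≤ q → c p ≤ c q := fun p q h => by simp only [hc]; gcongr
  have hcid : ∀ p ∈ Icc p₀ P, c p = p := fun p h => by
    simp only [hc]; rw [min_eq_left h.2, max_eq_right h.1]
  have hclip : ∀ p q, p ≤ q → c q - c p ≤ q - p := by
    intro p q h
    have : c q ≤ c p + (q - p) := by
      simp only [hc]
      refine max_le (by linarith [le_max_left p₀ (min p P)]) ?_
      have h1 : min q P ≤ min p P + (q - p) := by
        rcases min_choice p P with h' | h' <;> rw [h']
        · linarith [min_le_left q P]
        · linarith [min_le_right q P]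
      linarith [le_max_right p₀ (min p P)]
    linarith
  set g : ℝ → ℝ := fun p => G (c p) + η * (p - p₀) with hg
  have hgη : ∀ p q, p ≤ q → η * (q - p) ≤ g q - g p := by
    intro p q h
    have := hmono (hcm p).1 (hcm q).1 (hcmono p q h)
    simp only [hg]; linarith
  have hgΛ : ∀ p q, p ≤ q → g q - g p ≤ (max Λ 0 + η) * (q - p) := by
    intro p q h
    have h1 := (le_abs_self _).trans (hΛ _ (hcm q) _ (hcm p))
    rw [abs_of_nonneg (sub_nonneg.2 (hcmono p q h))] at h1
    have h2 : Λ * (c q - c p) ≤ max Λ 0 * (q - p) :=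
      mul_le_mul (le_max_left _ _) (hclip p q h) (sub_nonneg.2 (hcmono p q h)) (le_max_right _ _)
    simp only [hg]; linarith
  have hgc : Continuous g := by
    refine (LipschitzWith.of_dist_le_mul (K := (max Λ 0 + η).toNNReal) fun x y => ?_).continuous
    rw [Real.dist_eq, Real.dist_eq, Real.coe_toNNReal _ (by positivity)]
    rcases le_total x y with h | h
    · rw [abs_sub_comm, abs_sub_comm x, abs_of_nonneg (sub_nonneg.2 h), abs_of_nonneg]
      · exact hgΛ x y h
      · nlinarith [hgη x y h]
    · rw [abs_of_nonneg (sub_nonneg.2 h), abs_of_nonneg]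
      · exact hgΛ y x h
      · nlinarith [hgη y x h]
  have hsc : ∀ ω, Continuous fun x => √(a (τ x ω)) := fun ω => by
    refine (LipschitzWith.of_dist_le_mul (K := κ.toNNReal) fun x y => ?_).continuous
    rw [Real.dist_eq, Real.dist_eq, Real.coe_toNNReal _ hκ.le]
    exact haκ ω x y
  have hac : ∀ ω, Continuous fun x => a (τ x ω) + δ := fun ω => by
    have : (fun x => a (τ x ω) + δ) = fun x => √(a (τ x ω)) ^ 2 + δ := by
      funext x; rw [Real.sq_sqrt (ha _).1]
    rw [this]
    exact ((hsc ω).pow 2).add continuous_const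
  have hrc : ∀ ω, Continuous fun x => r (τ x ω) := fun ω => by
    refine (LipschitzWith.of_dist_le_mul (K := L.toNNReal) fun x y => ?_).continuous
    rw [Real.dist_eq, Real.dist_eq, Real.coe_toNNReal _ hL]
    exact hrL ω x y
  obtain ⟨f, hfm, ⟨B, hB⟩, hfd⟩ := exists_flow_solution (A := fun ω => a ω + δ) (r := r) (g := g)
    (R := max |G p₀| |lam|) hτ hτ_add hδ hη (ham.add_const δ) hrm
    (fun ω => by linarith [(ha ω).1]) (fun ω => by linarith [(ha ω).2])
    (fun ω => abs_le_max_abs_abs (hr ω).1 (hr ω).2)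
    hac hrc hgη hgΛ
  have hApos : ∀ ω, 0 < a ω + δ := fun ω => by linarith [(ha ω).1]
  have hode : ∀ ω x, (a (τ x ω) + δ) * ((r (τ x ω) - g (f (τ x ω))) / (a (τ x ω) + δ)) +
      g (f (τ x ω)) = r (τ x ω) := fun ω x => by
    rw [mul_div_cancel₀ _ (hApos _).ne']; ring
  have hgp : g p₀ = G p₀ := by simp [hg, hcid p₀ ⟨le_rfl, hP₀⟩]
  have hlow : ∀ ω, p₀ ≤ f ω := by
    intro ω
    rw [← hτ_zero ω]
    refine le_of_contracting (f₁ := fun _ => p₀) (f₂ := fun x => f (τ x ω)) (d₁ := fun _ => 0)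
      (B := p₀ + B) (half_pos hη) (fun x _ => hasDerivAt_const x p₀) (fun x _ => hfd ω x)
      (fun x _ => by have := (abs_le.1 (hB (τ x ω))).1; linarith) (fun x _ h => ?_)
    have h1 := hgη _ _ h.le
    have h2 := (hr (τ x ω)).1
    have : η / 2 * (p₀ - f (τ x ω)) ≤ (r (τ x ω) - g (f (τ x ω))) / (a (τ x ω) + δ) := by
      rw [le_div_iff₀ (hApos _)]
      have h4 : η / 2 * (p₀ - f (τ x ω)) * (a (τ x ω) + δ) ≤ η / 2 * (p₀ - f (τ x ω)) * 2 := by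
        have := (ha (τ x ω)).2
        have := sub_pos.2 h
        gcongr
        linarith
      linarith
    linarith
  have hup : ∀ Q, lam ≤ g Q → ∀ ω, f ω ≤ Q := by
    intro Q hgm ω
    rw [← hτ_zero ω]
    refine le_of_contracting (f₂ := fun _ => Q) (f₁ := fun x => f (τ x ω)) (d₂ := fun _ => 0)
      (B := B - Q) (half_pos hη) (fun x _ => hfd ω x) (fun x _ => hasDerivAt_const x _)
      (fun x _ => by have := (abs_le.1 (hB (τ x ω))).2; linarith) (fun x _ h => ?_)
    have h1 := hgη _ _ h.le
    have h2 := (hr (τ x ω)).2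
    have : (r (τ x ω) - g (f (τ x ω))) / (a (τ x ω) + δ) ≤ -(η / 2) * (f (τ x ω) - Q) := by
      rw [div_le_iff₀ (hApos _)]
      have h4 : η / 2 * (f (τ x ω) - Q) * (a (τ x ω) + δ) ≤
          η / 2 * (f (τ x ω) - Q) * 2 := by
        have := (ha (τ x ω)).2
        have := sub_pos.2 h
        gcongr
        linarith
      linarith
    linarith
  have hgP : lam ≤ g P := by
    simp only [hg]; rw [hcid P ⟨hP₀, le_rfl⟩]; nlinarith
  have hgf : ∀ ω, g (f ω) = G (f ω) + η * (f ω - p₀) := fun ω => by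
    simp only [hg]; rw [hcid _ ⟨hlow ω, hup P hgP ω⟩]
  have hglam : ∀ ω, g (f ω) ≤ lam := by
    intro ω
    have hmem : lam ∈ Icc (g p₀) (g P) := ⟨by rw [hgp]; exact (hr ω).1.trans (hr ω).2, hgP⟩
    obtain ⟨Q, -, hQ⟩ := intermediate_value_Icc hP₀ hgc.continuousOn hmem
    have h1 := hup Q hQ.ge ω
    nlinarith [hgη _ _ h1]
  refine ⟨f, hfm, hlow, fun ω => (hgf ω) ▸ hglam ω, fun ω x => ⟨_, hfd ω x, ?_, ?_⟩⟩
  · rw [← hgf]; exact hode ω x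
  · have hlam : 0 ≤ lam - G p₀ := by linarith [(hr ω).1, (hr ω).2]
    refine abs_deriv_le_of_ode (A := fun x => a (τ x ω) + δ) (r := fun x => r (τ x ω)) (L := L)
      (f := fun x => f (τ x ω)) (d := fun x => (r (τ x ω) - g (f (τ x ω))) / (a (τ x ω) + δ))
      (B := lam - G p₀) hη hκ (fun x => hApos _)
      (fun x y => (abs_sqrt_add_sub_sqrt_add_le (ha _).1 (ha _).1 hδ.le).trans (haκ ω x y))
      (hrL ω) hgη hgc (hfd ω) (hode ω) (fun x => ?_) ?_ ?_ ?_ x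
    · have h1 := hgη _ _ (hlow (τ x ω))
      have h2 := hglam (τ x ω)
      have h3 := hr (τ x ω)
      have h4 : 0 ≤ η * (f (τ x ω) - p₀) := mul_nonneg hη.le (sub_nonneg.2 (hlow _))
      rw [abs_le]
      constructor <;> linarith [h3.1, h3.2]
    · unfold derivBound; positivity
    · unfold derivBound
      have : η * (2 * (L + 1) / η) = 2 * (L + 1) := by field_simp
      have : 0 ≤ η * ((lam - G p₀) * (4 * κ / η) ^ 2) := by positivity
      linarith
    · unfold derivBound
      have : (lam - G p₀) * (4 * κ / η) ^ 2 * (η / (4 * κ)) ^ 2 = lam - G p₀ := by field_simp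
      have : 0 ≤ 2 * (L + 1) / η * (η / (4 * κ)) ^ 2 := by positivity
      linarith
end

/-- Running maximum of the Birkhoff sums of `f` over the first `n` steps (and `0`). -/
def birkhoffMax {Ω : Type*} (T : Ω → Ω) (f : Ω → ℝ) : ℕ → Ω → ℝ
  | 0 => fun _ => 0
  | n + 1 => fun ω => max 0 (f ω + birkhoffMax T f n (T ω))

section
variable {Ω : Type*} [MeasurableSpace Ω] {P : Measure Ω} [IsProbabilityMeasure P]

lemma integrable_of_abs_le {f : Ω → ℝ} {B : ℝ} (hf : Measurable f) (hB : ∀ ω, |f ω| ≤ B) :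
    Integrable f P :=
  (integrable_const B).mono' hf.aestronglyMeasurable (Filter.Eventually.of_forall hB)

/-- Maximal ergodic inequality for bounded observables. -/
lemma integral_nonneg_of_exists_birkhoffSum_pos {T : Ω → Ω} (hT : MeasurePreserving T P P)
    {f : Ω → ℝ} {B : ℝ} (hf : Measurable f) (hB : ∀ ω, |f ω| ≤ B)
    (hpos : ∀ᵐ ω ∂P, ∃ n, 0 < birkhoffSum T f n ω) : 0 ≤ ∫ ω, f ω ∂P := by
  set M := birkhoffMax T f with hM
  have hMm : ∀ n, Measurable (M n) := by
    intro n
    induction n with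
    | zero => exact measurable_const
    | succ n ih => exact measurable_const.max (hf.add (ih.comp hT.measurable))
  have hM0 : ∀ n ω, 0 ≤ M n ω := by
    intro n ω
    cases n with
    | zero => exact le_rfl
    | succ n => exact le_max_left _ _
  have hMB : ∀ n, ∃ C, ∀ ω, |M n ω| ≤ C := by
    intro n
    induction n with
    | zero => exact ⟨0, fun ω => by simp [hM, birkhoffMax]⟩
    | succ n ih =>
      obtain ⟨C, hC⟩ := ih
      refine ⟨B + C, fun ω => ?_⟩
      have h1 := (abs_le.1 (hB ω)).2
      have h2 := (abs_le.1 (hC (T ω))).2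
      have h3 := (abs_nonneg _).trans (hB ω)
      have h4 := (abs_nonneg _).trans (hC ω)
      rw [abs_of_nonneg (hM0 _ _)]
      exact max_le (by linarith) (by simp only [hM] at h2; linarith)
  have hMs : ∀ n ω, M n ω ≤ M (n + 1) ω := by
    intro n
    induction n with
    | zero => intro ω; exact hM0 1 ω
    | succ n ih =>
      intro ω
      change max 0 (f ω + M n (T ω)) ≤ max 0 (f ω + M (n + 1) (T ω))
      gcongr
      exact ih _
  have hMmono : ∀ ω, Monotone fun n => M n ω := fun ω => monotone_nat_of_le_succ fun n => hMs n ω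
  have hSM : ∀ n ω, birkhoffSum T f n ω ≤ M n ω := by
    intro n
    induction n with
    | zero => intro ω; simp [hM, birkhoffMax]
    | succ n ih =>
      intro ω
      rw [birkhoffSum_succ']
      exact (add_le_add_right (ih (T ω)) _).trans (le_max_right _ _)
  have hstep : ∀ n, 0 ≤ ∫ ω, {ω | 0 < M n ω}.indicator f ω ∂P := by
    intro n
    cases n with
    | zero => simp [hM, birkhoffMax]
    | succ n =>
      obtain ⟨C, hC⟩ := hMB (n + 1)
      have hms : MeasurableSet {ω | 0 < M (n + 1) ω} := measurableSet_lt measurable_const (hMm _)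
      have i1 : Integrable (M (n + 1)) P := integrable_of_abs_le (hMm _) hC
      have i2 : Integrable (fun ω => M (n + 1) (T ω)) P :=
        integrable_of_abs_le (show Measurable fun ω => M (n + 1) (T ω) from
          (hMm (n + 1)).comp hT.measurable) fun ω => hC (T ω)
      have i3 : Integrable ({ω | 0 < M (n + 1) ω}.indicator f) P :=
        (integrable_of_abs_le hf hB).indicator hms
      have e : ∫ ω, (M (n + 1) ω - M (n + 1) (T ω)) ∂P = 0 := by
        rw [integral_sub i1 i2, ← integral_map hT.measurable.aemeasurable
          (by rw [hT.map_eq]; exact (hMm _).aestronglyMeasurable), hT.map_eq, sub_self]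
      refine e.ge.trans (integral_mono (i1.sub i2) i3 fun ω => ?_)
      by_cases h : 0 < M (n + 1) ω
      · rw [indicator_of_mem (show ω ∈ {ω | 0 < M (n + 1) ω} from h)]
        have h1 : M (n + 1) ω = f ω + M n (T ω) := by
          have h2 : M (n + 1) ω = max 0 (f ω + M n (T ω)) := rfl
          rw [h2] at h ⊢
          rcases lt_max_iff.1 h with h | h
          · exact absurd h (lt_irrefl _)
          · exact max_eq_right h.le
        have := hMs n (T ω)
        simp only
        linarith
      · rw [indicator_of_notMem (show ω ∉ {ω | 0 < M (n + 1) ω} from h)]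
        have := hM0 (n + 1) (T ω)
        simp only
        linarith
  have hlim : Filter.Tendsto (fun n => ∫ ω, {ω | 0 < M n ω}.indicator f ω ∂P) Filter.atTop
      (nhds (∫ ω, f ω ∂P)) := by
    refine tendsto_integral_of_dominated_convergence (fun _ => B)
      (fun n => (hf.indicator (measurableSet_lt measurable_const (hMm _))).aestronglyMeasurable)
      (integrable_const B) (fun n => Filter.Eventually.of_forall fun ω => ?_) ?_
    · exact (norm_indicator_le_norm_self _ _).trans (hB ω)
    · filter_upwards [hpos] with ω ⟨k, hk⟩
      refine tendsto_const_nhds.congr' ?_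
      filter_upwards [Filter.eventually_ge_atTop k] with n hn
      rw [indicator_of_mem]
      exact hk.trans_le ((hSM k ω).trans (hMmono ω hn))
  exact ge_of_tendsto' hlim hstep

variable {τ : ℝ → Ω → Ω}

lemma intervalIntegrable_flow (hτ : Measurable fun p : ℝ × Ω => τ p.1 p.2) {f : Ω → ℝ} {B : ℝ}
    (hf : Measurable f) (hB : ∀ ω, |f ω| ≤ B) (ω : Ω) (x y : ℝ) :
    IntervalIntegrable (fun s => f (τ s ω)) volume x y :=
  (intervalIntegrable_const (c := B)).mono_fun
    (hf.comp (measurable_flow_left hτ ω)).aestronglyMeasurable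
    (Filter.Eventually.of_forall fun _ => (hB _).trans (le_abs_self _))

lemma limsup_le_limsup_of_tendsto_sub {u v : ℕ → ℝ} {B : ℝ} (hu : ∀ n, |u n| ≤ B)
    (hv : ∀ n, |v n| ≤ B) (h : Filter.Tendsto (fun n => u n - v n) Filter.atTop (nhds 0)) :
    Filter.limsup u Filter.atTop ≤ Filter.limsup v Filter.atTop := by
  have hvb : Filter.IsBoundedUnder (· ≤ ·) Filter.atTop v :=
    Filter.isBoundedUnder_of ⟨B, fun n => (abs_le.1 (hv n)).2⟩
  have huc : Filter.IsCoboundedUnder (· ≤ ·) Filter.atTop u :=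
    (Filter.isBoundedUnder_of ⟨-B, fun n => (abs_le.1 (hu n)).1⟩ :
      Filter.IsBoundedUnder (· ≥ ·) Filter.atTop u).isCoboundedUnder_le
  refine le_of_forall_pos_le_add fun e he => ?_
  refine Filter.limsup_le_of_le huc ?_
  have h1 := Filter.eventually_lt_of_limsup_lt
    (show Filter.limsup v Filter.atTop < Filter.limsup v Filter.atTop + e / 2 by linarith) hvb
  filter_upwards [h1, h.eventually_lt_const (half_pos he)] with n h2 h3
  linarith

lemma eventually_integral_flow_le (hτ : Measurable fun p : ℝ × Ω => τ p.1 p.2)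
    (hτ_add : ∀ x y : ℝ, ∀ ω, τ (x + y) ω = τ x (τ y ω))
    (hτ_mp : ∀ x : ℝ, MeasurePreserving (τ x) P P)
    (hτ_erg : ∀ g : Ω → ℝ, Measurable g →
      (∀ x : ℝ, ∀ᵐ ω ∂P, g (τ x ω) = g ω) → ∃ c : ℝ, ∀ᵐ ω ∂P, g ω = c)
    {f : Ω → ℝ} {B : ℝ} (hf : Measurable f) (hB : ∀ ω, |f ω| ≤ B) :
    ∀ᵐ ω ∂P, ∀ e > 0, ∀ᶠ n : ℕ in Filter.atTop,
      ∫ s in (0:ℝ)..n, f (τ s ω) ≤ ((∫ ω, f ω ∂P) + e) * n := by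
  set Φ : ℝ → Ω → ℝ := fun x ω => ∫ s in (0:ℝ)..x, f (τ s ω) with hΦ
  have hii := fun ω x y => intervalIntegrable_flow hτ hf hB ω x y
  have hshift : ∀ x y ω, Φ x (τ y ω) = Φ (x + y) ω - Φ y ω := by
    intro x y ω
    simp only [hΦ]
    rw [intervalIntegral.integral_interval_sub_left (hii _ _ _) (hii _ _ _)]
    have := intervalIntegral.integral_comp_add_right (a := 0) (b := x) (fun s => f (τ s ω)) y
    rw [zero_add] at this
    rw [← this]
    congr 1
    funext s
    rw [hτ_add]
  have hΦB : ∀ x y ω, |Φ x ω - Φ y ω| ≤ B * |x - y| := by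
    intro x y ω
    simp only [hΦ]
    rw [intervalIntegral.integral_interval_sub_left (hii _ _ _) (hii _ _ _)]
    exact intervalIntegral.norm_integral_le_of_norm_le_const (f := fun s => f (τ s ω))
      fun s _ => hB _
  have hΦ0 : ∀ ω, Φ 0 ω = 0 := fun ω => intervalIntegral.integral_same
  have hΦm : ∀ x : ℝ, 0 ≤ x → Measurable (Φ x) := by
    intro x hx
    have h : Measurable (Function.uncurry fun (ω : Ω) (u : ℝ) => f (τ u ω)) :=
      hf.comp (hτ.comp (measurable_snd.prodMk measurable_fst))
    have := (h.stronglyMeasurable.integral_prod_right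
      (ν := volume.restrict (Ioc (0:ℝ) x))).measurable
    have e : Φ x = fun ω => ∫ s in Ioc (0:ℝ) x, f (τ s ω) := by
      funext ω
      exact intervalIntegral.integral_of_le hx
    rw [e]
    exact this
  have hB0 : ∀ ω : Ω, 0 ≤ B := fun ω => (abs_nonneg _).trans (hB ω)
  set u : Ω → ℕ → ℝ := fun ω n => Φ n ω / n with hu
  have huB : ∀ ω n, |u ω n| ≤ B := by
    intro ω n
    have := hΦB n 0 ω
    rw [hΦ0, sub_zero, sub_zero, Nat.abs_cast] at this
    simp only [hu]
    rw [abs_div, Nat.abs_cast]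
    exact div_le_of_le_mul₀ (Nat.cast_nonneg n) (hB0 ω) this
  set gs : Ω → ℝ := fun ω => Filter.limsup (u ω) Filter.atTop with hgs
  have hgm : Measurable gs := Measurable.limsup fun n => (hΦm n (Nat.cast_nonneg n)).div_const _
  have hle : ∀ y ω, Filter.Tendsto (fun n => u (τ y ω) n - u ω n) Filter.atTop (nhds 0) := by
    intro y ω
    refine squeeze_zero_norm (a := fun n : ℕ => (2 * (B * |y|)) / n) (fun n => ?_)
      (tendsto_const_div_atTop_nhds_zero_nat _)
    simp only [hu, hshift]
    rw [← sub_div, Real.norm_eq_abs, abs_div, Nat.abs_cast]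
    gcongr
    have h1 := hΦB (n + y) n ω
    have h2 := hΦB y 0 ω
    rw [hΦ0, sub_zero, sub_zero] at h2
    rw [add_sub_cancel_left] at h1
    rw [abs_le] at h1 h2 ⊢
    constructor <;> linarith [h1.1, h1.2, h2.1, h2.2]
  have hinv : ∀ y ω, gs (τ y ω) = gs ω := fun y ω =>
    le_antisymm (limsup_le_limsup_of_tendsto_sub (huB _) (huB _) (hle y ω))
      (limsup_le_limsup_of_tendsto_sub (huB _) (huB _) (by simpa using (hle y ω).neg))
  obtain ⟨c, hc⟩ := hτ_erg gs hgm fun x => Filter.Eventually.of_forall fun ω => hinv x ω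
  have hbirk : ∀ (b : ℝ) (n : ℕ) ω,
      birkhoffSum (τ 1) (fun ω => Φ 1 ω - b) n ω = Φ n ω - b * n := by
    intro b n
    induction n with
    | zero => intro ω; simp [hΦ0]
    | succ n ih =>
      intro ω
      rw [birkhoffSum_succ', ih, hshift]
      push_cast
      ring
  have hmean : ∫ ω, Φ 1 ω ∂P = ∫ ω, f ω ∂P := by
    have h1 : ∀ ω, Φ 1 ω = ∫ s in Ioc (0:ℝ) 1, f (τ s ω) := fun ω =>
      intervalIntegral.integral_of_le zero_le_one
    simp_rw [h1]
    rw [integral_integral_swap]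
    · have h2 : ∀ s, ∫ ω, f (τ s ω) ∂P = ∫ ω, f ω ∂P := fun s => by
        rw [← integral_map (hτ_mp s).measurable.aemeasurable
          (by rw [(hτ_mp s).map_eq]; exact hf.aestronglyMeasurable), (hτ_mp s).map_eq]
      simp_rw [h2]
      simp
    · refine (integrable_const B).mono' ?_ (Filter.Eventually.of_forall fun p => hB _)
      exact (hf.comp (hτ.comp (measurable_snd.prodMk measurable_fst))).aestronglyMeasurable
  have hcm : c ≤ ∫ ω, f ω ∂P := by
    by_contra! hlt
    obtain ⟨b, hb1, hb2⟩ := exists_between hlt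
    have hpos : ∀ᵐ ω ∂P, ∃ n, 0 < birkhoffSum (τ 1) (fun ω => Φ 1 ω - b) n ω := by
      filter_upwards [hc] with ω hω
      have h1 : b < Filter.limsup (u ω) Filter.atTop := by rw [← hω] at hb2; exact hb2
      have h2 : ∃ᶠ n in Filter.atTop, b < u ω n := by
        refine Filter.frequently_lt_of_lt_limsup ?_ h1
        exact (Filter.isBoundedUnder_of ⟨-B, fun n => (abs_le.1 (huB ω n)).1⟩ :
          Filter.IsBoundedUnder (· ≥ ·) Filter.atTop (u ω)).isCoboundedUnder_le
      obtain ⟨n, hn, hn1⟩ := (h2.and_eventually (Filter.eventually_ge_atTop 1)).exists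
      refine ⟨n, ?_⟩
      rw [hbirk]
      have : (0:ℝ) < n := by exact_mod_cast hn1
      rw [lt_div_iff₀ this] at hn
      linarith
    have hbd : ∀ ω, |Φ 1 ω - b| ≤ B + |b| := fun ω => by
      have := hΦB 1 0 ω
      rw [hΦ0] at this
      simp only [sub_zero, abs_one, mul_one] at this
      exact (abs_sub _ _).trans (by gcongr)
    have := integral_nonneg_of_exists_birkhoffSum_pos (hτ_mp 1)
      ((hΦm 1 zero_le_one).sub_const b) hbd hpos
    rw [integral_sub (integrable_of_abs_le (B := B) (hΦm 1 zero_le_one) fun ω => by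
      simpa [hΦ0] using hΦB 1 0 ω) (integrable_const b), hmean] at this
    simp at this
    linarith
  filter_upwards [hc] with ω hω e he
  have h1 : Filter.limsup (u ω) Filter.atTop < (∫ ω, f ω ∂P) + e := by
    change gs ω < _
    rw [hω]; linarith
  have h2 := Filter.eventually_lt_of_limsup_lt h1
    (Filter.isBoundedUnder_of ⟨B, fun n => (abs_le.1 (huB ω n)).2⟩)
  filter_upwards [h2, Filter.eventually_ge_atTop 1] with n hn hn1
  have : (0:ℝ) < n := by exact_mod_cast hn1
  exact ((div_lt_iff₀ this).1 hn).le

/-- Ergodic theorem for bounded observables along an ergodic flow. -/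
theorem eventually_abs_integral_flow_sub_le (hτ : Measurable fun p : ℝ × Ω => τ p.1 p.2)
    (hτ_add : ∀ x y : ℝ, ∀ ω, τ (x + y) ω = τ x (τ y ω))
    (hτ_mp : ∀ x : ℝ, MeasurePreserving (τ x) P P)
    (hτ_erg : ∀ g : Ω → ℝ, Measurable g →
      (∀ x : ℝ, ∀ᵐ ω ∂P, g (τ x ω) = g ω) → ∃ c : ℝ, ∀ᵐ ω ∂P, g ω = c)
    {f : Ω → ℝ} {B : ℝ} (hf : Measurable f) (hB : ∀ ω, |f ω| ≤ B) :
    ∀ᵐ ω ∂P, ∀ e > 0, ∀ᶠ x : ℝ in Filter.atTop,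
      |(∫ s in (0:ℝ)..x, f (τ s ω)) - (∫ ω, f ω ∂P) * x| ≤ e * x := by
  have h1 := eventually_integral_flow_le hτ hτ_add hτ_mp hτ_erg hf hB
  have h2 := eventually_integral_flow_le hτ hτ_add hτ_mp hτ_erg (f := fun ω => -f ω)
    hf.neg (B := B) (fun ω => by rw [abs_neg]; exact hB ω)
  filter_upwards [h1, h2] with ω h1 h2 e he
  set m := ∫ ω, f ω ∂P with hm
  have hB0 : 0 ≤ B := (abs_nonneg _).trans (hB ω)
  have hfl := tendsto_nat_floor_atTop (α := ℝ)
  filter_upwards [hfl.eventually (h1 (e / 2) (half_pos he)),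
    hfl.eventually (h2 (e / 2) (half_pos he)), Filter.eventually_ge_atTop 0,
    Filter.eventually_ge_atTop (2 * (B + |m| + e) / e)] with x a1 a2 hx hxl
  simp only [intervalIntegral.integral_neg, integral_neg] at a2
  rw [← hm] at a2
  have f1 := Nat.floor_le hx
  have f2 := (Nat.lt_floor_add_one x).le
  have hd : |(∫ s in (0:ℝ)..x, f (τ s ω)) - ∫ s in (0:ℝ)..(⌊x⌋₊ : ℝ), f (τ s ω)| ≤ B := by
    rw [intervalIntegral.integral_interval_sub_left (intervalIntegrable_flow hτ hf hB ω _ _)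
      (intervalIntegrable_flow hτ hf hB ω _ _)]
    refine (intervalIntegral.norm_integral_le_of_norm_le_const (f := fun s => f (τ s ω))
      fun s _ => hB _).trans ?_
    rw [abs_of_nonneg (by linarith)]
    nlinarith
  rw [div_le_iff₀ he] at hxl
  have hmm : |m * (x - (⌊x⌋₊ : ℝ))| ≤ |m| := by
    rw [abs_mul, abs_of_nonneg (sub_nonneg.2 f1)]
    nlinarith [abs_nonneg m]
  rw [abs_le] at hd hmm ⊢
  constructor <;> nlinarith [hd.1, hd.2, hmm.1, hmm.2]
end

/-- `f` is the slope of a supersolution of `a f' + H(x, f) ≤ lam`, in the sense of one-sided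
derivatives. -/
def IsSuperSlope (a : ℝ → ℝ) (H : ℝ → ℝ → ℝ) (lam : ℝ) (f : ℝ → ℝ) : Prop :=
  ∀ x, (∃ d, HasDerivWithinAt f d (Iic x) x ∧ a x * d + H x (f x) ≤ lam) ∧
    ∃ d, HasDerivWithinAt f d (Ici x) x ∧ a x * d + H x (f x) ≤ lam

/-- Viscosity subsolution on `(0, ∞) × ℝ` of `∂ₜu = a ∂ₓₓu + H(x, ∂ₓu)`. -/
def IsParabolicSubsol (a : ℝ → ℝ) (H : ℝ → ℝ → ℝ) (u : ℝ → ℝ → ℝ) : Prop :=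
  ∀ t₀ x₀ : ℝ, 0 < t₀ → ∀ φ : ℝ × ℝ → ℝ, ContDiff ℝ 2 φ →
    IsLocalMax (fun p : ℝ × ℝ => u p.1 p.2 - φ p) (t₀, x₀) →
    deriv (fun t => φ (t, x₀)) t₀ ≤
      a x₀ * deriv (deriv (fun x => φ (t₀, x))) x₀ + H x₀ (deriv (fun x => φ (t₀, x)) x₀)

/-- The primitive of `f` lies above the line of slope `θ`, up to a sublinear error. -/
def DominatesLine (θ : ℝ) (f : ℝ → ℝ) : Prop :=
  ∀ μ > 0, ∃ C, ∀ x, θ * x - ∫ s in (0:ℝ)..x, f s ≤ μ * |x| + C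

lemma IsSuperSlope.continuous {a : ℝ → ℝ} {H : ℝ → ℝ → ℝ} {lam : ℝ} {f : ℝ → ℝ}
    (h : IsSuperSlope a H lam f) : Continuous f := by
  refine continuous_iff_continuousAt.2 fun x => ?_
  obtain ⟨⟨d, hd, -⟩, d', hd', -⟩ := h x
  exact continuousAt_iff_continuous_left_right.2 ⟨hd.continuousWithinAt, hd'.continuousWithinAt⟩

lemma HasDerivWithinAt.eventually_le_of_lt {f : ℝ → ℝ} {d D x : ℝ}
    (h : HasDerivWithinAt f d (Ici x) x) (hD : d < D) :
    ∀ᶠ y in nhds x, x ≤ y → f y ≤ f x + D * (y - x) := by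
  have h1 := h.limsup_slope_le hD
  rw [Ici_sdiff_left, eventually_nhdsWithin_iff] at h1
  filter_upwards [h1] with y hy hxy
  rcases hxy.eq_or_lt with rfl | hlt
  · simp
  · have := hy hlt
    rw [slope_def_field, div_lt_iff₀ (sub_pos.2 hlt)] at this
    linarith

lemma HasDerivWithinAt.eventually_ge_of_lt {f : ℝ → ℝ} {d D x : ℝ}
    (h : HasDerivWithinAt f d (Iic x) x) (hD : d < D) :
    ∀ᶠ y in nhds x, y ≤ x → f x + D * (y - x) ≤ f y := by
  have h1 := h.limsup_slope_le hD
  rw [Iic_sdiff_right, eventually_nhdsWithin_iff] at h1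
  filter_upwards [h1] with y hy hxy
  rcases hxy.eq_or_lt with rfl | hlt
  · simp
  · have := hy hlt
    rw [slope_def_field, div_lt_iff_of_neg (sub_neg.2 hlt)] at this
    linarith

/-- If the slope `f` has one-sided derivatives below `D` at `x`, its primitive is touched from
above at `x` by a parabola of curvature `D`. -/
lemma eventually_primitive_le {f : ℝ → ℝ} (hf : Continuous f) {x D : ℝ}
    (h1 : ∀ᶠ y in nhds x, x ≤ y → f y ≤ f x + D * (y - x))
    (h2 : ∀ᶠ y in nhds x, y ≤ x → f x + D * (y - x) ≤ f y) :
    ∀ᶠ y in nhds x, ∫ s in (0:ℝ)..y, f s ≤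
      (∫ s in (0:ℝ)..x, f s) + f x * (y - x) + D / 2 * (y - x) ^ 2 := by
  obtain ⟨r, hr, hball⟩ := Metric.eventually_nhds_iff.1 (h1.and h2)
  set g : ℝ → ℝ := fun y => (∫ s in (0:ℝ)..y, f s) - (f x * (y - x) + D / 2 * (y - x) ^ 2) with hg
  have hgd : ∀ y, HasDerivAt g (f y - (f x + D * (y - x))) y := by
    intro y
    have e1 := intervalIntegral.integral_hasDerivAt_right (hf.intervalIntegrable 0 y)
      (hf.stronglyMeasurableAtFilter _ _) hf.continuousAt
    have e2 : HasDerivAt (fun y : ℝ => y - x) 1 y := (hasDerivAt_id y).sub_const x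
    refine (e1.sub ((e2.const_mul (f x)).add ((e2.pow 2).const_mul (D / 2)))).congr_deriv ?_
    simp
    ring
  have hgc : Continuous g := continuous_iff_continuousAt.2 fun y => (hgd y).continuousAt
  refine Metric.eventually_nhds_iff.2 ⟨r, hr, fun y hy => ?_⟩
  have key : g y ≤ g x := by
    rw [Real.dist_eq, abs_lt] at hy
    rcases le_total x y with hxy | hxy
    · refine (antitoneOn_of_deriv_nonpos (convex_Icc x y) hgc.continuousOn
        (fun z _ => (hgd z).differentiableAt.differentiableWithinAt) fun z hz => ?_)
        (left_mem_Icc.2 hxy) (right_mem_Icc.2 hxy) hxy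
      rw [interior_Icc] at hz
      rw [(hgd z).deriv]
      have := (hball (y := z) (by
        rw [Real.dist_eq, abs_lt]; constructor <;> linarith [hz.1, hz.2, hy.1, hy.2])).1 hz.1.le
      linarith
    · refine (monotoneOn_of_deriv_nonneg (convex_Icc y x) hgc.continuousOn
        (fun z _ => (hgd z).differentiableAt.differentiableWithinAt) fun z hz => ?_)
        (left_mem_Icc.2 hxy) (right_mem_Icc.2 hxy) hxy
      rw [interior_Icc] at hz
      rw [(hgd z).deriv]
      have := (hball (y := z) (by
        rw [Real.dist_eq, abs_lt]; constructor <;> linarith [hz.1, hz.2, hy.1, hy.2])).2 hz.2.le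
      linarith
  simp only [hg, sub_self] at key
  linarith

/-- Testing a subsolution against a quadratic polynomial. -/
lemma IsParabolicSubsol.quadratic {a : ℝ → ℝ} {H : ℝ → ℝ → ℝ} {u : ℝ → ℝ → ℝ}
    (hu : IsParabolicSubsol a H u) {t₀ x₀ A b D E ρ : ℝ} (ht : 0 < t₀)
    (hmax : IsLocalMax (fun p : ℝ × ℝ => u p.1 p.2 -
      (A + b * (p.2 - x₀) + D / 2 * (p.2 - x₀) ^ 2 + E * p.1 + ρ * p.1 ^ 2)) (t₀, x₀)) :
    E + 2 * ρ * t₀ ≤ a x₀ * D + H x₀ b := by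
  have h := hu t₀ x₀ ht
    (fun p => A + b * (p.2 - x₀) + D / 2 * (p.2 - x₀) ^ 2 + E * p.1 + ρ * p.1 ^ 2)
    (by fun_prop) hmax
  have e1 : deriv (fun t : ℝ => A + b * (x₀ - x₀) + D / 2 * (x₀ - x₀) ^ 2 + E * t + ρ * t ^ 2) t₀
      = E + 2 * ρ * t₀ := by
    have := (((hasDerivAt_id t₀).const_mul E).const_add
      (A + b * (x₀ - x₀) + D / 2 * (x₀ - x₀) ^ 2)).add (((hasDerivAt_id t₀).pow 2).const_mul ρ)
    refine (this.congr_deriv ?_).deriv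
    simp; ring
  have e2 : deriv (fun x : ℝ => A + b * (x - x₀) + D / 2 * (x - x₀) ^ 2 + E * t₀ + ρ * t₀ ^ 2)
      = fun x => b + D * (x - x₀) := by
    funext x
    have h0 : HasDerivAt (fun y : ℝ => y - x₀) 1 x := (hasDerivAt_id x).sub_const x₀
    have := ((((h0.const_mul b).const_add A).add ((h0.pow 2).const_mul (D / 2))).add_const
      (E * t₀)).add_const (ρ * t₀ ^ 2)
    refine (this.congr_deriv ?_).deriv
    simp; ring
  have e3 : deriv (fun x : ℝ => b + D * (x - x₀)) x₀ = D := by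
    have h0 : HasDerivAt (fun y : ℝ => y - x₀) 1 x₀ := (hasDerivAt_id x₀).sub_const x₀
    rw [((h0.const_mul D).const_add b).deriv, mul_one]
  simp only at h
  rw [e1, e2, e3] at h
  simpa using h

/-- Comparison of a parabolic subsolution with linear initial datum against a stationary
supersolution whose slope dominates the line. -/
theorem le_of_isSuperSlope {a : ℝ → ℝ} {H : ℝ → ℝ → ℝ} {lam θ K R : ℝ} {f : ℝ → ℝ}
    {u : ℝ → ℝ → ℝ} (ha : ∀ x, a x ∈ Icc (0:ℝ) 1)
    (hH : ∀ R, ∃ Λ, 0 ≤ Λ ∧ ∀ x p q, |p| ≤ R → |q| ≤ R → |H x p - H x q| ≤ Λ * |p - q|)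
    (huc : ContinuousOn (fun p : ℝ × ℝ => u p.1 p.2) (Ici 0 ×ˢ univ))
    (hu0 : ∀ x, u 0 x = θ * x) (huK : ∀ t x, 0 ≤ t → u t x ≤ θ * x + K * t)
    (hu : IsParabolicSubsol a H u) (hf : IsSuperSlope a H lam f) (hfR : ∀ x, |f x| ≤ R)
    (hline : DominatesLine θ f) {σ : ℝ} (hσ : 0 < σ) :
    ∃ C, ∀ t, 0 ≤ t → u t 0 ≤ C + (lam + σ) * t := by
  obtain ⟨Λ, hΛ0, hΛ⟩ := hH (R + 1)
  obtain ⟨μ, hμ, hμ1, hμσ⟩ : ∃ μ > 0, 2 * μ ≤ 1 ∧ 2 * μ * (1 + Λ) ≤ σ / 2 := by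
    refine ⟨min (1 / 2) (σ / (4 * (1 + Λ))), by positivity, ?_, ?_⟩
    · linarith [min_le_left (1 / 2) (σ / (4 * (1 + Λ)))]
    · have := min_le_right (1 / 2) (σ / (4 * (1 + Λ)))
      rw [le_div_iff₀ (by positivity)] at this
      linarith
  obtain ⟨C₀, hC₀⟩ := hline μ hμ
  obtain ⟨C, hC0, hC⟩ : ∃ C, 0 ≤ C ∧ ∀ x, θ * x - ∫ s in (0:ℝ)..x, f s ≤ μ * |x| + C :=
    ⟨max C₀ 0, le_max_right _ _, fun x => (hC₀ x).trans (by gcongr; exact le_max_left _ _)⟩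
  set w : ℝ → ℝ := fun x => ∫ s in (0:ℝ)..x, f s with hw
  have hfc := hf.continuous
  have hwc : Continuous w :=
    intervalIntegral.continuous_primitive (fun _ _ => hfc.intervalIntegrable _ _) 0
  have hψ : ∀ x : ℝ, |x| ≤ √(1 + x ^ 2) ∧ 1 ≤ √(1 + x ^ 2) := fun x => by
    refine ⟨Real.abs_le_sqrt (by linarith), ?_⟩
    rw [Real.one_le_sqrt]; nlinarith
  have main : ∀ ρ > 0, ∀ t, 0 ≤ t → u t 0 ≤ C + 2 * μ + (lam + σ) * t + ρ * t ^ 2 := by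
    intro ρ hρ t ht
    set Ψ : ℝ × ℝ → ℝ := fun p => u p.1 p.2 - w p.2 - 2 * μ * √(1 + p.2 ^ 2) - (lam + σ) * p.1
      - ρ * p.1 ^ 2 with hΨ
    have hΨc : ContinuousOn Ψ (Ici 0 ×ˢ univ) := by
      have : Continuous fun p : ℝ × ℝ => w p.2 := hwc.comp continuous_snd
      exact (((huc.sub this.continuousOn).sub (by fun_prop)).sub (by fun_prop)).sub (by fun_prop)
    have hΨb : ∀ s x, 0 ≤ s → Ψ (s, x) ≤ C - μ * |x| + (K - lam - σ) * s - ρ * s ^ 2 := by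
      intro s x hs
      have h1 := huK s x hs
      have h2 := hC x
      have h3 := mul_le_mul_of_nonneg_left (hψ x).1 hμ.le
      simp only [hΨ]
      simp only [hw] at h2 ⊢
      linarith
    set k := K - lam - σ with hk
    set T := t + (|k| + C + 2 + 1) / ρ + (|k| + C + 2 + 1) with hT
    set X := (C + 2 + k ^ 2 / ρ) / μ with hX
    have hT0 : 0 ≤ T := by positivity
    have hX0 : 0 ≤ X := by positivity
    obtain ⟨⟨t₁, x₁⟩, hm1, hmax⟩ := (isCompact_Icc.prod isCompact_Icc).exists_isMaxOn
      (s := Icc 0 T ×ˢ Icc (-X) X) ⟨(0, 0), ⟨⟨le_rfl, hT0⟩, by simpa using hX0⟩⟩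
      (hΨc.mono (prod_mono Icc_subset_Ici_self (subset_univ _)))
    have h00 : Ψ (0, 0) = - (2 * μ) := by simp [hΨ, hu0, hw]
    have hge : -(2 * μ) ≤ Ψ (t₁, x₁) := by
      rw [← h00]
      exact hmax (a := (0, 0)) ⟨⟨le_rfl, hT0⟩, by simpa using hX0⟩
    have hglob : ∀ s x, 0 ≤ s → Ψ (s, x) ≤ Ψ (t₁, x₁) := by
      intro s x hs
      by_cases hbox : s ≤ T ∧ |x| ≤ X
      · exact hmax (a := (s, x)) ⟨⟨hs, hbox.1⟩, abs_le.1 hbox.2⟩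
      · refine le_trans ?_ hge
        refine (hΨb s x hs).trans ?_
        have hks : k * s ≤ |k| * s := mul_le_mul_of_nonneg_right (le_abs_self k) hs
        rw [not_and_or, not_le, not_le] at hbox
        rcases hbox with h | h
        · have h1 : |k| + C + 2 + 1 ≤ ρ * s := by
            have : (|k| + C + 2 + 1) / ρ ≤ s := by
              have : 0 ≤ |k| + C + 2 + 1 := by positivity
              linarith
            rw [div_le_iff₀ hρ] at this
            linarith
          have h2 : 1 ≤ s := by
            have : 0 ≤ (|k| + C + 2 + 1) / ρ := by positivity
            have := abs_nonneg k
            linarith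
          have h3 := abs_nonneg x
          nlinarith [mul_le_mul_of_nonneg_right h1 hs, mul_nonneg hμ.le h3]
        · have h1 : C + 2 + k ^ 2 / ρ ≤ μ * |x| := by
            rw [hX, div_lt_iff₀ hμ] at h
            linarith
          have h2 : k * s ≤ k ^ 2 / ρ + ρ * s ^ 2 := by
            have : k ^ 2 / ρ + ρ * s ^ 2 - k * s =
                ((k - ρ * s / 2) ^ 2 + 3 / 4 * (ρ * s) ^ 2) / ρ := by
              field_simp; ring
            have : 0 ≤ k ^ 2 / ρ + ρ * s ^ 2 - k * s := by rw [this]; positivity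
            linarith
          linarith
    have ht1 : 0 ≤ t₁ := hm1.1.1
    rcases ht1.eq_or_lt with h0 | hpos
    · have h1 := hglob t 0 ht
      rw [← h0] at h1
      have h2 := hΨb 0 x₁ le_rfl
      have h3 := mul_nonneg hμ.le (abs_nonneg x₁)
      simp [hΨ, hw] at h1 h2
      linarith
    · exfalso
      obtain ⟨⟨dl, hdl, hdl'⟩, dr, hdr, hdr'⟩ := hf x₁
      set D := max dl dr + σ / 4 with hD
      have hDl : dl < D := by linarith [le_max_left dl dr]
      have hDr : dr < D := by linarith [le_max_right dl dr]
      have hmaxd : a x₁ * max dl dr + H x₁ (f x₁) ≤ lam := by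
        rcases max_choice dl dr with h | h <;> rw [h] <;> assumption
      have hpar := eventually_primitive_le hfc (hdr.eventually_le_of_lt hDr)
        (hdl.eventually_ge_of_lt hDl)
      set S := √(1 + x₁ ^ 2) with hS
      have hS1 : 1 ≤ S := (hψ x₁).2
      have hSx : |x₁| ≤ S := (hψ x₁).1
      have hS2 : S ^ 2 = 1 + x₁ ^ 2 := Real.sq_sqrt (by positivity)
      have hS0 : 0 < S := by linarith
      have hsq : ∀ x : ℝ, √(1 + x ^ 2) ≤ S + x₁ / S * (x - x₁) + 1 / S / 2 * (x - x₁) ^ 2 := by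
        intro x
        have h1 : √(1 + x ^ 2) ^ 2 = 1 + x ^ 2 := Real.sq_sqrt (by positivity)
        have h2 : S + x₁ / S * (x - x₁) + 1 / S / 2 * (x - x₁) ^ 2 - √(1 + x ^ 2)
            = (√(1 + x ^ 2) - S) ^ 2 / (2 * S) := by
          field_simp
          linear_combination hS2 - h1
        have : 0 ≤ (√(1 + x ^ 2) - S) ^ 2 / (2 * S) := by positivity
        linarith
      have hloc : IsLocalMax (fun p : ℝ × ℝ => u p.1 p.2 -
          ((w x₁ + 2 * μ * S) + (f x₁ + 2 * μ * (x₁ / S)) * (p.2 - x₁)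
            + (D + 2 * μ * (1 / S)) / 2 * (p.2 - x₁) ^ 2 + (lam + σ) * p.1 + ρ * p.1 ^ 2))
          (t₁, x₁) := by
        have hev := (eventually_gt_nhds hpos).prod_nhds hpar
        filter_upwards [hev] with ⟨s, x⟩ hp
        have h1 := hglob s x (le_of_lt hp.1)
        have h2 := hp.2
        have h3 := mul_le_mul_of_nonneg_left (hsq x) hμ.le
        simp only [hΨ] at h1
        simp only [sub_self]
        simp only [hw] at h1 h2 ⊢
        linarith
      have htest := hu.quadratic hpos hloc
      have hax := ha x₁
      have hb : |2 * μ * (x₁ / S)| ≤ 2 * μ := by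
        rw [abs_mul, abs_of_pos (by positivity : 0 < 2 * μ), abs_div, abs_of_pos hS0]
        exact mul_le_of_le_one_right (by positivity) ((div_le_one hS0).2 hSx)
      have hHd := hΛ x₁ (f x₁ + 2 * μ * (x₁ / S)) (f x₁)
        ((abs_add_le _ _).trans (by linarith [hfR x₁])) (by linarith [hfR x₁])
      rw [add_sub_cancel_left] at hHd
      have hHd' := (abs_le.1 hHd).2
      have hΛb := mul_le_mul_of_nonneg_left hb hΛ0
      have hS1' : 1 / S ≤ 1 := (div_le_one hS0).2 hS1
      have h5 : a x₁ * (2 * μ * (1 / S)) ≤ 2 * μ := by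
        have : 2 * μ * (1 / S) ≤ 2 * μ := mul_le_of_le_one_right (by positivity) hS1'
        exact (mul_le_of_le_one_left (by positivity) hax.2).trans this
      have h6 : a x₁ * (σ / 4) ≤ σ / 4 := mul_le_of_le_one_left (by positivity) hax.2
      have h7 : 0 < ρ * t₁ := mul_pos hρ hpos
      rw [hD] at htest
      linarith
  refine ⟨C + 2 * μ, fun t ht => ?_⟩
  refine le_of_forall_pos_le_add fun e he => ?_
  have := main (e / (t ^ 2 + 1)) (by positivity) t ht
  have h2 : e / (t ^ 2 + 1) * t ^ 2 ≤ e := by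
    rw [div_mul_eq_mul_div, div_le_iff₀ (by positivity)]
    nlinarith
  linarith

/-- `f` has one-sided derivatives `d` at `x`, on either side, with `Q x (f x) d`. -/
def SlopeAt (Q : ℝ → ℝ → ℝ → Prop) (f : ℝ → ℝ) (x : ℝ) : Prop :=
  (∃ d, HasDerivWithinAt f d (Iic x) x ∧ Q x (f x) d) ∧
    ∃ d, HasDerivWithinAt f d (Ici x) x ∧ Q x (f x) d

lemma HasDerivAt.slopeAt {Q : ℝ → ℝ → ℝ → Prop} {f : ℝ → ℝ} {x d : ℝ} (h : HasDerivAt f d x)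
    (hQ : Q x (f x) d) : SlopeAt Q f x :=
  ⟨⟨d, h.hasDerivWithinAt, hQ⟩, d, h.hasDerivWithinAt, hQ⟩

/-- The function equal to `f₁` up to `c` and to `f₂` afterwards. -/
def glueAt (c : ℝ) (f₁ f₂ : ℝ → ℝ) (x : ℝ) : ℝ := if x ≤ c then f₁ x else f₂ x

lemma glueAt_of_le {c x : ℝ} {f₁ f₂ : ℝ → ℝ} (h : x ≤ c) : glueAt c f₁ f₂ x = f₁ x := if_pos h

lemma glueAt_of_ge {c x : ℝ} {f₁ f₂ : ℝ → ℝ} (hc : f₁ c = f₂ c) (h : c ≤ x) :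
    glueAt c f₁ f₂ x = f₂ x := by
  rcases h.eq_or_lt with rfl | h
  · rw [glueAt_of_le le_rfl, hc]
  · exact if_neg (not_le.2 h)

lemma slopeAt_glueAt {Q : ℝ → ℝ → ℝ → Prop} {c : ℝ} {f₁ f₂ : ℝ → ℝ} (hc : f₁ c = f₂ c) {x : ℝ}
    (h₁ : x ≤ c → SlopeAt Q f₁ x) (h₂ : c ≤ x → SlopeAt Q f₂ x) :
    SlopeAt Q (glueAt c f₁ f₂) x := by
  have left : x ≤ c → ∃ d, HasDerivWithinAt (glueAt c f₁ f₂) d (Iic x) x ∧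
      Q x (glueAt c f₁ f₂ x) d := by
    intro hx
    obtain ⟨d, hd, hQ⟩ := (h₁ hx).1
    refine ⟨d, hd.congr (fun y hy => glueAt_of_le (le_trans hy hx)) (glueAt_of_le hx), ?_⟩
    rwa [glueAt_of_le hx]
  have right : c ≤ x → ∃ d, HasDerivWithinAt (glueAt c f₁ f₂) d (Ici x) x ∧
      Q x (glueAt c f₁ f₂ x) d := by
    intro hx
    obtain ⟨d, hd, hQ⟩ := (h₂ hx).2
    refine ⟨d, hd.congr (fun y hy => glueAt_of_ge hc (le_trans hx hy)) (glueAt_of_ge hc hx), ?_⟩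
    rwa [glueAt_of_ge hc hx]
  rcases lt_trichotomy x c with hlt | rfl | hlt
  · refine ⟨left hlt.le, ?_⟩
    obtain ⟨d, hd, hQ⟩ := (h₁ hlt.le).2
    refine ⟨d, hd.congr_of_eventuallyEq ?_ (glueAt_of_le hlt.le), by rwa [glueAt_of_le hlt.le]⟩
    filter_upwards [nhdsWithin_le_nhds (eventually_lt_nhds hlt)] with y hy
    exact glueAt_of_le (le_of_lt hy)
  · exact ⟨left le_rfl, right le_rfl⟩
  · refine ⟨?_, right hlt.le⟩
    obtain ⟨d, hd, hQ⟩ := (h₂ hlt.le).1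
    refine ⟨d, hd.congr_of_eventuallyEq ?_ (glueAt_of_ge hc hlt.le),
      by rwa [glueAt_of_ge hc hlt.le]⟩
    filter_upwards [nhdsWithin_le_nhds (eventually_gt_nhds hlt)] with y hy
    exact glueAt_of_ge hc (le_of_lt hy)

/-- `f` is the slope of a subsolution of `a f' + H(x, f) ≥ lam`. -/
def IsSubSlope (a : ℝ → ℝ) (H : ℝ → ℝ → ℝ) (lam : ℝ) (f : ℝ → ℝ) : Prop :=
  ∀ x, SlopeAt (fun x p d => lam ≤ a x * d + H x p) f x

/-- Viscosity supersolution on `(0, ∞) × ℝ` of `∂ₜu = a ∂ₓₓu + H(x, ∂ₓu)`. -/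
def IsParabolicSupersol (a : ℝ → ℝ) (H : ℝ → ℝ → ℝ) (u : ℝ → ℝ → ℝ) : Prop :=
  ∀ t₀ x₀ : ℝ, 0 < t₀ → ∀ φ : ℝ × ℝ → ℝ, ContDiff ℝ 2 φ →
    IsLocalMin (fun p : ℝ × ℝ => u p.1 p.2 - φ p) (t₀, x₀) →
    a x₀ * deriv (deriv (fun x => φ (t₀, x))) x₀ + H x₀ (deriv (fun x => φ (t₀, x)) x₀) ≤
      deriv (fun t => φ (t, x₀)) t₀

lemma IsParabolicSupersol.neg {a : ℝ → ℝ} {H : ℝ → ℝ → ℝ} {u : ℝ → ℝ → ℝ}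
    (hu : IsParabolicSupersol a H u) :
    IsParabolicSubsol a (fun x p => -H x (-p)) (fun t x => -u t x) := by
  intro t₀ x₀ ht φ hφ hmax
  have h := hu t₀ x₀ ht (fun p => -φ p) hφ.neg (by
    refine (hmax.neg).congr (Filter.Eventually.of_forall fun p => ?_)
    simp only
    ring)
  have e1 : deriv (fun t => -φ (t, x₀)) t₀ = -deriv (fun t => φ (t, x₀)) t₀ := deriv.fun_neg
  have e2 : deriv (fun x => -φ (t₀, x)) = fun x => -deriv (fun x => φ (t₀, x)) x := by
    funext x; exact deriv.fun_neg
  have e3 : deriv (fun x => -deriv (fun x => φ (t₀, x)) x) x₀ =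
    -deriv (deriv (fun x => φ (t₀, x))) x₀ := deriv.fun_neg
  rw [e1, e2, e3] at h
  linarith

/-- Comparison of a parabolic supersolution with linear initial datum against a stationary
subsolution whose slope is dominated by the line. -/
theorem ge_of_isSubSlope {a : ℝ → ℝ} {H : ℝ → ℝ → ℝ} {lam θ K R : ℝ} {f : ℝ → ℝ}
    {u : ℝ → ℝ → ℝ} (ha : ∀ x, a x ∈ Icc (0:ℝ) 1)
    (hH : ∀ R, ∃ Λ, 0 ≤ Λ ∧ ∀ x p q, |p| ≤ R → |q| ≤ R → |H x p - H x q| ≤ Λ * |p - q|)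
    (huc : ContinuousOn (fun p : ℝ × ℝ => u p.1 p.2) (Ici 0 ×ˢ univ))
    (hu0 : ∀ x, u 0 x = θ * x) (huK : ∀ t x, 0 ≤ t → θ * x - K * t ≤ u t x)
    (hu : IsParabolicSupersol a H u) (hf : IsSubSlope a H lam f) (hfR : ∀ x, |f x| ≤ R)
    (hline : DominatesLine (-θ) fun x => -f x) {σ : ℝ} (hσ : 0 < σ) :
    ∃ C, ∀ t, 0 ≤ t → (lam - σ) * t - C ≤ u t 0 := by
  have hsup : IsSuperSlope a (fun x p => -H x (-p)) (-lam) fun x => -f x := by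
    intro x
    obtain ⟨⟨d, hd, hQ⟩, d', hd', hQ'⟩ := hf x
    refine ⟨⟨-d, hd.fun_neg, ?_⟩, -d', hd'.fun_neg, ?_⟩ <;> simp only [neg_neg] <;> linarith
  obtain ⟨C, hC⟩ := le_of_isSuperSlope (u := fun t x => -u t x) (θ := -θ) (K := K) (R := R) ha
    (fun R => by
      obtain ⟨Λ, h0, hΛ⟩ := hH R
      refine ⟨Λ, h0, fun x p q hp hq => ?_⟩
      have := hΛ x (-p) (-q) (by rwa [abs_neg]) (by rwa [abs_neg])
      rw [show -H x (-p) - -H x (-q) = -(H x (-p) - H x (-q)) by ring, abs_neg]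
      rwa [show -p - -q = -(p - q) by ring, abs_neg] at this)
    huc.neg (fun x => by rw [hu0]; ring) (fun t x ht => by linarith [huK t x ht]) hu.neg hsup
    (fun x => by rw [abs_neg]; exact hfR x) hline hσ
  exact ⟨C, fun t ht => by linarith [hC t ht]⟩

/-- One-sided version of `DominatesLine`, on `[0, ∞)`. -/
def HalfDominates (θ : ℝ) (f : ℝ → ℝ) : Prop :=
  ∀ μ > 0, ∃ C, ∀ x, 0 ≤ x → θ * x - ∫ s in (0:ℝ)..x, f s ≤ μ * x + C

lemma integral_zero_neg (f : ℝ → ℝ) (x : ℝ) :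
    ∫ s in (0:ℝ)..x, -f (-s) = ∫ s in (0:ℝ)..(-x), f s := by
  rw [intervalIntegral.integral_neg, intervalIntegral.integral_comp_neg (fun s => f s), neg_zero,
    intervalIntegral.integral_symm, neg_neg]

lemma HalfDominates.dominatesLine {θ : ℝ} {f : ℝ → ℝ} (h₁ : HalfDominates θ f)
    (h₂ : HalfDominates (-θ) fun x => -f (-x)) : DominatesLine θ f := by
  intro μ hμ
  obtain ⟨C₁, hC₁⟩ := h₁ μ hμ
  obtain ⟨C₂, hC₂⟩ := h₂ μ hμ
  refine ⟨max C₁ C₂, fun x => ?_⟩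
  rcases le_total 0 x with hx | hx
  · rw [abs_of_nonneg hx]
    exact (hC₁ x hx).trans (by gcongr; exact le_max_left _ _)
  · rw [abs_of_nonpos hx]
    have := hC₂ (-x) (neg_nonneg.2 hx)
    rw [integral_zero_neg, neg_neg] at this
    refine le_trans ?_ (this.trans (by gcongr; exact le_max_right _ _))
    linarith

/-- `f` has asymptotic mean `m` at `+∞`. -/
def HasMean (f : ℝ → ℝ) (m : ℝ) : Prop :=
  ∀ e > 0, ∀ᶠ x : ℝ in Filter.atTop, |(∫ s in (0:ℝ)..x, f s) - m * x| ≤ e * x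

lemma HasMean.neg {f : ℝ → ℝ} {m : ℝ} (h : HasMean f m) : HasMean (fun x => -f x) (-m) := by
  intro e he
  filter_upwards [h e he] with x hx
  rw [intervalIntegral.integral_neg, show -(∫ s in (0:ℝ)..x, f s) - -m * x =
    -((∫ s in (0:ℝ)..x, f s) - m * x) by ring, abs_neg]
  exact hx

lemma HasMean.add_const {f : ℝ → ℝ} {m : ℝ} (h : HasMean f m) (hf : Continuous f) (s : ℝ) :
    HasMean (fun x => f x + s) (m + s) := by
  intro e he
  filter_upwards [h e he] with x hx
  rw [intervalIntegral.integral_add (hf.intervalIntegrable _ _) intervalIntegrable_const,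
    intervalIntegral.integral_const, smul_eq_mul]
  convert hx using 2
  ring

lemma HasMean.halfDominates {f : ℝ → ℝ} {m θ R : ℝ} (h : HasMean f m) (hf : ∀ x, |f x| ≤ R)
    (hθ : θ ≤ m) : HalfDominates θ f := by
  intro μ hμ
  obtain ⟨X, hX⟩ := Filter.eventually_atTop.1 (h μ hμ)
  refine ⟨(|θ| + R) * |X|, fun x hx => ?_⟩
  have hR : 0 ≤ R := (abs_nonneg _).trans (hf 0)
  rcases le_total X x with hXx | hXx
  · have h1 := (abs_le.1 (hX x hXx)).1
    have h2 := mul_le_mul_of_nonneg_right hθ hx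
    have : 0 ≤ (|θ| + R) * |X| := by positivity
    linarith
  · have h1 := intervalIntegral.norm_integral_le_of_norm_le_const (a := 0) (b := x) (f := f)
      fun s _ => hf s
    rw [Real.norm_eq_abs, sub_zero, abs_of_nonneg hx] at h1
    have h2 := (abs_le.1 h1).1
    have h3 := mul_le_mul_of_nonneg_right (le_abs_self θ) hx
    have h4 : (|θ| + R) * x ≤ (|θ| + R) * |X| := by
      gcongr
      exact hXx.trans (le_abs_self X)
    have : 0 ≤ μ * x := by positivity
    linarith

lemma HalfDominates.congr_of_ge {f g : ℝ → ℝ} {θ c : ℝ} (hf : Continuous f) (hg : Continuous g)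
    (h : HalfDominates θ f) (hfg : ∀ x, c ≤ x → g x = f x) : HalfDominates θ g := by
  set k : ℝ → ℝ := fun x => ∫ s in (0:ℝ)..x, (f s - g s) with hk
  have hkc : Continuous k := intervalIntegral.continuous_primitive
    (fun _ _ => (hf.sub hg).intervalIntegrable _ _) 0
  obtain ⟨B, hB⟩ := (isCompact_Icc (a := (0:ℝ)) (b := |c|)).bddAbove_image hkc.continuousOn
  have hbd : ∀ x, 0 ≤ x → k x ≤ B := by
    intro x hx
    rcases le_total x |c| with hxc | hxc
    · exact hB ⟨x, ⟨hx, hxc⟩, rfl⟩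
    · have h1 : k x = k |c| := by
        rw [← sub_eq_zero, hk]
        simp only
        have hfg' : Continuous fun s => f s - g s := hf.sub hg
        rw [intervalIntegral.integral_interval_sub_left (hfg'.intervalIntegrable _ _)
          (hfg'.intervalIntegrable _ _)]
        rw [intervalIntegral.integral_congr (g := fun _ => 0)]
        · simp
        · intro s hs
          rw [uIcc_of_le hxc] at hs
          simp [hfg s ((le_abs_self c).trans hs.1)]
      rw [h1]
      exact hB ⟨|c|, ⟨abs_nonneg c, le_rfl⟩, rfl⟩
  intro μ hμ
  obtain ⟨C, hC⟩ := h μ hμ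
  refine ⟨C + B, fun x hx => ?_⟩
  have h1 := hC x hx
  have h2 := hbd x hx
  simp only [hk] at h2
  rw [intervalIntegral.integral_sub (hf.intervalIntegrable _ _) (hg.intervalIntegrable _ _)] at h2
  linarith

/-- A locally Lipschitz coercive Hamiltonian, decreasing before `p₀` and increasing after. -/
structure IsQuasiconvexHamiltonian (G : ℝ → ℝ) (p₀ : ℝ) : Prop where
  anti : AntitoneOn G (Iic p₀)
  mono : MonotoneOn G (Ici p₀)
  lip : ∀ R, ∃ Λ, 0 ≤ Λ ∧ ∀ p q, |p| ≤ R → |q| ≤ R → |G p - G q| ≤ Λ * |p - q|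
  top : Filter.Tendsto G Filter.atTop Filter.atTop
  bot : Filter.Tendsto G Filter.atBot Filter.atTop

namespace IsQuasiconvexHamiltonian
variable {G : ℝ → ℝ} {p₀ : ℝ} (hG : IsQuasiconvexHamiltonian G p₀)
include hG

lemma le (p : ℝ) : G p₀ ≤ G p := by
  rcases le_total p p₀ with h | h
  · exact hG.anti h self_mem_Iic h
  · exact hG.mono self_mem_Ici h h

lemma reflect : IsQuasiconvexHamiltonian (fun p => G (-p)) (-p₀) where
  anti := fun p hp q hq h => hG.mono (by simp at *; linarith) (by simp at *; linarith) (by simpa)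
  mono := fun p hp q hq h => hG.anti (by simp at *; linarith) (by simp at *; linarith) (by simpa)
  lip := fun R => by
    obtain ⟨Λ, h0, h⟩ := hG.lip R
    refine ⟨Λ, h0, fun p q hp hq => ?_⟩
    have := h (-p) (-q) (by rwa [abs_neg]) (by rwa [abs_neg])
    rwa [show -p - -q = -(p - q) by ring, abs_neg] at this
  top := hG.bot.comp Filter.tendsto_neg_atTop_atBot
  bot := hG.top.comp Filter.tendsto_neg_atBot_atTop

lemma exists_ge (c : ℝ) : ∃ P, p₀ ≤ P ∧ c ≤ G P :=
  ((Filter.eventually_ge_atTop p₀).and (hG.top.eventually_ge_atTop c)).exists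

lemma exists_abs_le (c : ℝ) : ∃ B, ∀ p, G p ≤ c → |p| ≤ B := by
  obtain ⟨P, hP⟩ := Filter.eventually_atTop.1 (hG.top.eventually_gt_atTop c)
  obtain ⟨Q, hQ⟩ := Filter.eventually_atBot.1 (hG.bot.eventually_gt_atTop c)
  refine ⟨max P (-Q), fun p hp => abs_le.2 ⟨?_, ?_⟩⟩
  · by_contra! h
    exact absurd hp (not_le.2 (hQ p (by linarith [le_max_right P (-Q)])))
  · by_contra! h
    exact absurd hp (not_le.2 (hP p (by linarith [le_max_left P (-Q)])))

lemma exists_lip_Icc (P : ℝ) :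
    ∃ Λ, ∀ p ∈ Icc p₀ P, ∀ q ∈ Icc p₀ P, |G p - G q| ≤ Λ * |p - q| := by
  obtain ⟨Λ, -, h⟩ := hG.lip (max |p₀| |P|)
  exact ⟨Λ, fun p hp q hq => h p q (abs_le_max_abs_abs hp.1 hp.2) (abs_le_max_abs_abs hq.1 hq.2)⟩

end IsQuasiconvexHamiltonian

/-- Diffusion coefficient and potential along one realization of the environment. -/
structure IsEnvironment (a V : ℝ → ℝ) (κ : ℝ) : Prop where
  a_mem : ∀ x, a x ∈ Icc (0:ℝ) 1
  V_mem : ∀ x, V x ∈ Icc (0:ℝ) 1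
  a_lip : ∀ x y, |√(a x) - √(a y)| ≤ κ * |x - y|
  V_lip : ∀ x y, |V x - V y| ≤ κ * |x - y|

lemma IsEnvironment.reflect {a V : ℝ → ℝ} {κ : ℝ} (h : IsEnvironment a V κ) :
    IsEnvironment (fun x => a (-x)) (fun x => V (-x)) κ where
  a_mem := fun x => h.a_mem _
  V_mem := fun x => h.V_mem _
  a_lip := fun x y => by
    have := h.a_lip (-x) (-y)
    rwa [show -x - -y = -(x - y) by ring, abs_neg] at this
  V_lip := fun x y => by
    have := h.V_lip (-x) (-y)
    rwa [show -x - -y = -(x - y) by ring, abs_neg] at this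

lemma IsEnvironment.continuous_a {a V : ℝ → ℝ} {κ : ℝ} (h : IsEnvironment a V κ) (hκ : 0 ≤ κ) :
    Continuous a := by
  have h1 : Continuous fun x => √(a x) :=
    (LipschitzWith.of_dist_le_mul (K := κ.toNNReal) fun x y => by
      rw [Real.dist_eq, Real.dist_eq, Real.coe_toNNReal _ hκ]; exact h.a_lip x y).continuous
  have h2 : a = fun x => √(a x) ^ 2 := by
    funext x; rw [Real.sq_sqrt (h.a_mem x).1]
  rw [h2]
  exact h1.pow 2

lemma IsEnvironment.continuous_V {a V : ℝ → ℝ} {κ : ℝ} (h : IsEnvironment a V κ) (hκ : 0 ≤ κ) :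
    Continuous V :=
  (LipschitzWith.of_dist_le_mul (K := κ.toNNReal) fun x y => by
      rw [Real.dist_eq, Real.dist_eq, Real.coe_toNNReal _ hκ]; exact h.V_lip x y).continuous

/-- `f` is the slope of an approximate corrector at level `lam`. -/
def IsCorrector (a V G : ℝ → ℝ) (β p₀ κ η δ lam : ℝ) (f : ℝ → ℝ) : Prop :=
  ∀ x, ∃ d, HasDerivAt f d x ∧ (a x + δ) * d + (G (f x) + η * |f x - p₀|) = lam - β * V x ∧
    |d| ≤ derivBound κ (β * κ + 1) η (lam - G p₀)

namespace IsCorrector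
variable {a V G : ℝ → ℝ} {β p₀ κ η δ lam : ℝ} {f : ℝ → ℝ}

lemma reflect (hf : IsCorrector a V G β p₀ κ η δ lam f) :
    IsCorrector (fun x => a (-x)) (fun x => V (-x)) (fun p => G (-p)) β (-p₀) κ η δ lam
      fun x => -f (-x) := by
  intro x
  obtain ⟨d, hd, he, hb⟩ := hf (-x)
  refine ⟨d, ?_, ?_, ?_⟩
  · have h1 : HasDerivAt (fun x : ℝ => -x) (-1) x := hasDerivAt_neg x
    have := (HasDerivAt.scomp (g₁ := f) x hd h1).fun_neg
    simpa [Function.comp_def] using this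
  · simp only [neg_neg]
    rw [← he, show -f (-x) - -p₀ = -(f (-x) - p₀) by ring, abs_neg]
  · simpa using hb

lemma continuous (hf : IsCorrector a V G β p₀ κ η δ lam f) : Continuous f :=
  continuous_iff_continuousAt.2 fun x => by
    obtain ⟨d, hd, -⟩ := hf x
    exact hd.continuousAt

/-- Replacing a corrector that is attached at `+∞` by one that starts from the minimum point at
the origin and keeps the same asymptotic slope. -/
lemma exists_transition (hf : IsCorrector a V G β p₀ κ η δ lam f)
    (hG : IsQuasiconvexHamiltonian G p₀) (hE : IsEnvironment a V κ) (hκ : 0 < κ) (hβ : 0 ≤ β)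
    (hη : 0 < η) (hδ : 0 < δ) (hδ1 : δ ≤ 1) (hlam : G p₀ + β ≤ lam) (hp : ∀ x, p₀ ≤ f x)
    {R θ : ℝ} (hfR : ∀ x, |f x| ≤ R) (hθ : HalfDominates θ f) :
    ∃ g : ℝ → ℝ, g 0 = p₀ ∧ (∀ x, p₀ ≤ g x ∧ g x ≤ f x) ∧ HalfDominates θ g ∧
      ∀ x, 0 ≤ x → SlopeAt (fun x p d => a x * d + (G p + β * V x) ≤
        lam + δ * derivBound κ (β * κ + 1) η (lam - G p₀)) g x := by
  set r : ℝ → ℝ := fun x => min (lam - β * V x) (G p₀ + max x 0) with hr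
  have hVc := hE.continuous_V hκ.le
  obtain ⟨g, -, hg0, hgl, hgd⟩ := exists_corrector (Ω := ℝ) (τ := fun x y => x + y) (G := G)
    (a := a) (r := r) (p₀ := p₀) (κ := κ) (L := β * κ + 1) (η := η) (δ := δ) (lam := lam)
    (by fun_prop) (fun x => zero_add x) (fun x y z => add_assoc x y z) hκ (by positivity) hη hδ hδ1
    (hE.continuous_a hκ.le).measurable (by fun_prop) hE.a_mem
    (fun ω x y => by
      have := hE.a_lip (x + ω) (y + ω)
      rwa [add_sub_add_right_eq_sub] at this)
    (fun x => ⟨le_min (by nlinarith [(hE.V_mem x).2]) (by linarith [le_max_right x 0]),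
      (min_le_left _ _).trans (by nlinarith [(hE.V_mem x).1])⟩)
    (fun ω x y => by
      have h1 := hE.V_lip (x + ω) (y + ω)
      rw [add_sub_add_right_eq_sub] at h1
      have h2 := abs_min_sub_min_le_max (lam - β * V (x + ω)) (G p₀ + max (x + ω) 0)
        (lam - β * V (y + ω)) (G p₀ + max (y + ω) 0)
      refine h2.trans (max_le ?_ ?_)
      · rw [show lam - β * V (x + ω) - (lam - β * V (y + ω)) = -(β * (V (x + ω) - V (y + ω))) by
          ring, abs_neg, abs_mul, abs_of_nonneg hβ]
        nlinarith [abs_nonneg (x - y)]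
      · rw [add_sub_add_left_eq_sub]
        have h3 := abs_max_sub_max_le_abs (x + ω) (y + ω) 0
        rw [add_sub_add_right_eq_sub] at h3
        nlinarith [abs_nonneg (x - y), mul_nonneg (mul_nonneg hβ hκ.le) (abs_nonneg (x - y))])
    hG.mono hG.exists_lip_Icc (hG.exists_ge lam)
  replace hgd : ∀ x, ∃ d, HasDerivAt g d x ∧ (a x + δ) * d + (G (g x) + η * (g x - p₀)) = r x ∧
      |d| ≤ derivBound κ (β * κ + 1) η (lam - G p₀) := fun x => by simpa using hgd 0 x
  choose dg hdg heg hbg using hgd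
  choose df hdf hef hbf using hf
  have hef' : ∀ x, (a x + δ) * df x + (G (f x) + η * (f x - p₀)) = lam - β * V x := fun x => by
    rw [← hef x, abs_of_nonneg (sub_nonneg.2 (hp x))]
  have hdecay : ∀ x d e, (a x + δ) * d ≤ -(η * e) → 0 ≤ e → d ≤ -(η / 2) * e := by
    intro x d e h he
    have h1 := hE.a_mem x
    have h2 : 0 < a x + δ := by linarith [h1.1]
    have h3 : (a x + δ) * (η * e) ≤ 2 * (η * e) :=
      mul_le_mul_of_nonneg_right (by linarith [h1.2]) (by positivity)
    by_contra! hlt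
    have := mul_lt_mul_of_pos_left hlt h2
    nlinarith
  obtain ⟨B, hB⟩ := hG.exists_abs_le lam
  have hgf : ∀ x, g x ≤ f x := by
    intro x
    refine le_of_contracting (f₁ := g) (f₂ := f) (d₁ := dg) (d₂ := df) (k := η / 2)
      (B := B - p₀) (by positivity) (fun y _ => hdg y)
      (fun y _ => hdf y) ?_ ?_
    · intro y _
      have h1 := hB (g y) (by nlinarith [hgl y, mul_nonneg hη.le (sub_nonneg.2 (hg0 y))])
      linarith [(abs_le.1 h1).2, hp y]
    · intro y _ hlt
      refine hdecay y _ _ ?_ (sub_nonneg.2 hlt.le)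
      have h1 := hG.mono (hp y) (hg0 y) hlt.le
      have h2 : r y ≤ lam - β * V y := min_le_left _ _
      nlinarith [heg y, hef' y]
  have hg00 : g 0 = p₀ := by
    refine le_antisymm ?_ (hg0 0)
    refine le_of_contracting (f₁ := g) (f₂ := fun _ => p₀) (d₁ := dg) (d₂ := fun _ => 0)
      (k := η / 2) (B := R - p₀) (by positivity) (fun y _ => hdg y)
      (fun y _ => hasDerivAt_const y p₀) ?_ ?_
    · intro y _
      linarith [hgf y, (abs_le.1 (hfR y)).2]
    · intro y hy hlt
      refine hdecay y _ _ ?_ (sub_nonneg.2 hlt.le)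
      have h2 : r y ≤ G p₀ := (min_le_right _ _).trans (by rw [max_eq_right hy, add_zero])
      nlinarith [heg y, hG.le (g y)]
  have hgc : Continuous g := continuous_iff_continuousAt.2 fun x => (hdg x).continuousAt
  have hfc : Continuous f := continuous_iff_continuousAt.2 fun x => (hdf x).continuousAt
  refine ⟨g, hg00, fun x => ⟨hg0 x, hgf x⟩, ?_, fun x hx => ?_⟩
  · set X := lam - G p₀ with hX
    have hX0 : 0 ≤ X := by linarith
    set W : ℝ → ℝ := fun x => ∫ s in (0:ℝ)..x, (f s - g s) with hW
    have hWd : ∀ x, HasDerivAt W (f x - g x) x := fun x =>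
      intervalIntegral.integral_hasDerivAt_right ((hfc.sub hgc).intervalIntegrable 0 x)
        ((hfc.sub hgc).stronglyMeasurableAtFilter _ _) (hfc.sub hgc).continuousAt
    have hWc : Continuous W := continuous_iff_continuousAt.2 fun x => (hWd x).continuousAt
    have hWmono : Monotone W := monotone_of_hasDerivAt_nonneg hWd fun x => sub_nonneg.2 (hgf x)
    have hWb : ∀ x, 0 ≤ x → W x ≤ 2 / η * (f X - g X) + W X := by
      intro x hx
      have hpos : 0 ≤ 2 / η * (f X - g X) := by
        have := sub_nonneg.2 (hgf X); positivity
      rcases le_total x X with hxX | hxX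
      · linarith [hWmono hxX]
      · set Z : ℝ → ℝ := fun x => f x - g x + η / 2 * W x with hZ
        have hZd : ∀ x, HasDerivAt Z (df x - dg x + η / 2 * (f x - g x)) x := fun x =>
          ((hdf x).sub (hdg x)).add ((hWd x).const_mul _)
        have hZ1 : Z x ≤ Z X := by
          refine (antitoneOn_of_deriv_nonpos (convex_Icc X x)
            (fun z _ => (hZd z).continuousAt.continuousWithinAt)
            (fun z _ => (hZd z).differentiableAt.differentiableWithinAt) fun z hz => ?_)
            (left_mem_Icc.2 hxX) (right_mem_Icc.2 hxX) hxX
          rw [interior_Icc] at hz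
          rw [(hZd z).deriv]
          have h1 : r z = lam - β * V z := by
            refine min_eq_left ?_
            have := mul_nonneg hβ (hE.V_mem z).1
            linarith [le_max_left z 0, hz.1]
          have h2 := hG.mono (hg0 z) (hp z) (hgf z)
          have h3 := hdecay z (df z - dg z) (f z - g z)
            (by nlinarith [heg z, hef' z]) (sub_nonneg.2 (hgf z))
          linarith
        have h4 := hgf x
        simp only [hZ] at hZ1
        have h5 : η / 2 * W x ≤ f X - g X + η / 2 * W X := by linarith
        have h6 := mul_le_mul_of_nonneg_left h5 (by positivity : 0 ≤ 2 / η)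
        calc W x = 2 / η * (η / 2 * W x) := by field_simp
          _ ≤ _ := h6
          _ = _ := by field_simp
    intro μ hμ
    obtain ⟨C, hC⟩ := hθ μ hμ
    refine ⟨C + (2 / η * (f X - g X) + W X), fun x hx => ?_⟩
    have h1 := hC x hx
    have h2 := hWb x hx
    have h3 : W x = (∫ s in (0:ℝ)..x, f s) - ∫ s in (0:ℝ)..x, g s :=
      intervalIntegral.integral_sub (hfc.intervalIntegrable _ _) (hgc.intervalIntegrable _ _)
    linarith
  · refine (hdg x).slopeAt ?_
    have h1 : r x ≤ lam - β * V x := min_le_left _ _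
    have h2 := mul_nonneg hη.le (sub_nonneg.2 (hg0 x))
    have h3 := mul_le_mul_of_nonneg_left ((neg_abs_le _).trans' (neg_le_neg (hbg x))) hδ.le
    nlinarith [heg x]

end IsCorrector

lemma SlopeAt.reflect {Q Q' : ℝ → ℝ → ℝ → Prop} {f : ℝ → ℝ} {x : ℝ} (h : SlopeAt Q f (-x))
    (hQ : ∀ p d, Q (-x) p d → Q' x (-p) d) : SlopeAt Q' (fun x => -f (-x)) x := by
  obtain ⟨⟨d, hd, hq⟩, d', hd', hq'⟩ := h
  refine ⟨⟨d', ?_, hQ _ _ hq'⟩, d, ?_, hQ _ _ hq⟩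
  · have := (HasDerivWithinAt.scomp (g₁ := f) x hd' (hasDerivAt_neg x).hasDerivWithinAt
      (s := Iic x) fun y hy => by simpa using hy).fun_neg
    simpa [Function.comp_def] using this
  · have := (HasDerivWithinAt.scomp (g₁ := f) x hd (hasDerivAt_neg x).hasDerivWithinAt
      (s := Ici x) fun y hy => by simpa using hy).fun_neg
    simpa [Function.comp_def] using this

/-- Viscosity solution of `∂ₜu = a ∂ₓₓu + H(x, ∂ₓu)` with initial datum `θ x`, at distance at most
`K t` from it. -/
structure IsLinearDatumSol (a : ℝ → ℝ) (H : ℝ → ℝ → ℝ) (θ K : ℝ) (u : ℝ → ℝ → ℝ) : Prop where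
  cont : ContinuousOn (fun p : ℝ × ℝ => u p.1 p.2) (Ici 0 ×ˢ univ)
  init : ∀ x, u 0 x = θ * x
  le : ∀ t x, 0 ≤ t → u t x ≤ θ * x + K * t
  ge : ∀ t x, 0 ≤ t → θ * x - K * t ≤ u t x
  sub : IsParabolicSubsol a H u
  super : IsParabolicSupersol a H u

lemma IsQuasiconvexHamiltonian.lip_add {G : ℝ → ℝ} {p₀ : ℝ} (hG : IsQuasiconvexHamiltonian G p₀)
    (v : ℝ → ℝ) (R : ℝ) : ∃ Λ, 0 ≤ Λ ∧ ∀ x p q, |p| ≤ R → |q| ≤ R →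
      |(G p + v x) - (G q + v x)| ≤ Λ * |p - q| := by
  obtain ⟨Λ, h0, h⟩ := hG.lip R
  exact ⟨Λ, h0, fun x p q hp hq => by rw [add_sub_add_right_eq_sub]; exact h p q hp hq⟩

section
variable {a V G : ℝ → ℝ} {β p₀ κ η δ lam θ K R m₁ m₂ σ : ℝ} {f₁ f₂ : ℝ → ℝ} {u : ℝ → ℝ → ℝ}

/-- Upper growth rate for slopes between the two correctors at level `lam`. -/
lemma IsLinearDatumSol.le_level (hu : IsLinearDatumSol a (fun x p => G p + β * V x) θ K u)
    (hG : IsQuasiconvexHamiltonian G p₀) (hE : IsEnvironment a V κ) (hκ : 0 < κ) (hβ : 0 ≤ β)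
    (hη : 0 < η) (hδ : 0 < δ) (hδ1 : δ ≤ 1) (hlam : G p₀ + β ≤ lam)
    (hf₁ : IsCorrector a V G β p₀ κ η δ lam f₁) (hf₂ : IsCorrector a V G β p₀ κ η δ lam f₂)
    (hp₁ : ∀ x, f₁ x ≤ p₀) (hp₂ : ∀ x, p₀ ≤ f₂ x) (hR₁ : ∀ x, |f₁ x| ≤ R) (hR₂ : ∀ x, |f₂ x| ≤ R)
    (hm₁ : HasMean (fun x => f₁ (-x)) m₁) (hm₂ : HasMean f₂ m₂) (h₁ : m₁ ≤ θ) (h₂ : θ ≤ m₂)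
    (hσ : 0 < σ) :
    ∃ C, ∀ t, 0 ≤ t →
      u t 0 ≤ C + (lam + δ * derivBound κ (β * κ + 1) η (lam - G p₀) + σ) * t := by
  obtain ⟨g, hg0, hgf, hgθ, hg⟩ := hf₂.exists_transition hG hE hκ hβ hη hδ hδ1 hlam hp₂ hR₂
    (hm₂.halfDominates hR₂ h₂)
  have hR₁' : ∀ x, |-f₁ (-x)| ≤ R := fun x => by rw [abs_neg]; exact hR₁ _
  obtain ⟨k, hk0, hkf, hkθ, hk⟩ := hf₁.reflect.exists_transition hG.reflect hE.reflect hκ hβ hη hδ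
    hδ1 (by rwa [neg_neg]) (fun x => neg_le_neg (hp₁ _)) hR₁'
    (hm₁.neg.halfDominates hR₁' (neg_le_neg h₁))
  simp only [neg_neg] at hk
  have hc : (fun x => -k (-x)) 0 = g 0 := by simp [hk0, hg0]
  have hs : IsSuperSlope a (fun x p => G p + β * V x)
      (lam + δ * derivBound κ (β * κ + 1) η (lam - G p₀)) (glueAt 0 (fun x => -k (-x)) g) := by
    intro x
    refine slopeAt_glueAt (Q := fun x p d => a x * d + (G p + β * V x) ≤
      lam + δ * derivBound κ (β * κ + 1) η (lam - G p₀)) hc (fun hx => ?_) (hg x)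
    refine (hk (-x) (neg_nonneg.2 hx)).reflect fun p d h => ?_
    simpa using h
  have hp₀R : |p₀| ≤ R := by
    have h1 := abs_le.1 (hR₁ 0)
    have h2 := abs_le.1 (hR₂ 0)
    exact abs_le.2 ⟨by linarith [hp₂ 0, hp₁ 0], by linarith [hp₂ 0]⟩
  have hgR : ∀ x, |g x| ≤ R := fun x =>
    (abs_le_max_abs_abs (hgf x).1 (hgf x).2).trans (max_le hp₀R (hR₂ x))
  have hkR : ∀ x, |k x| ≤ R := fun x =>
    (abs_le_max_abs_abs (hkf x).1 (hkf x).2).trans (max_le (by rwa [abs_neg]) (hR₁' x))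
  refine le_of_isSuperSlope (R := R) hE.a_mem (hG.lip_add _) hu.cont hu.init hu.le hu.sub hs
    (fun x => ?_) (HalfDominates.dominatesLine ?_ ?_) hσ
  · rcases le_total x 0 with hx | hx
    · rw [glueAt_of_le hx, abs_neg]; exact hkR _
    · rw [glueAt_of_ge hc hx]; exact hgR x
  · intro μ hμ
    obtain ⟨C, hC⟩ := hgθ μ hμ
    refine ⟨C, fun x hx => ?_⟩
    rw [intervalIntegral.integral_congr (g := g)]
    · exact hC x hx
    · intro y hy
      rw [uIcc_of_le hx] at hy
      exact glueAt_of_ge hc hy.1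
  · intro μ hμ
    obtain ⟨C, hC⟩ := hkθ μ hμ
    refine ⟨C, fun x hx => ?_⟩
    rw [intervalIntegral.integral_congr (g := k)]
    · exact hC x hx
    · intro y hy
      rw [uIcc_of_le hx] at hy
      simp only
      rw [glueAt_of_le (neg_nonpos.2 hy.1), neg_neg, neg_neg]

/-- Lower growth rate from a corrector at level `lam`, translated so that its mean is `θ`. -/
lemma IsLinearDatumSol.ge_level (hu : IsLinearDatumSol a (fun x p => G p + β * V x) θ K u)
    (hG : IsQuasiconvexHamiltonian G p₀) (hE : IsEnvironment a V κ) (hη : 0 ≤ η) (hδ : 0 ≤ δ)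
    (hf : IsCorrector a V G β p₀ κ η δ lam f₁) (hp₀R : |p₀| ≤ R) (hR : ∀ x, |f₁ x| ≤ R)
    (hm : HasMean f₁ m₁) (hm' : HasMean (fun x => f₁ (-x)) m₁)
    (hθ : ∀ x, G (f₁ x) ≤ G (f₁ x + (θ - m₁))) (hσ : 0 < σ) :
    ∃ C, ∀ t, 0 ≤ t →
      (lam - (δ * derivBound κ (β * κ + 1) η (lam - G p₀) + η * (2 * R)) - σ) * t - C ≤ u t 0 := by
  have hR' : ∀ x, |f₁ x + (θ - m₁)| ≤ R + |θ - m₁| :=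
    fun x => (abs_add_le _ _).trans (by gcongr; exact hR x)
  refine ge_of_isSubSlope (f := fun x => f₁ x + (θ - m₁)) (R := R + |θ - m₁|) hE.a_mem
    (hG.lip_add _) hu.cont hu.init hu.ge hu.super (fun x => ?_) hR' ?_ hσ
  · obtain ⟨d, hd, he, hb⟩ := hf x
    refine (hd.add_const _).slopeAt ?_
    have h2 := mul_le_mul_of_nonneg_left ((le_abs_self d).trans hb) hδ
    have h3 : η * |f₁ x - p₀| ≤ η * (2 * R) := by
      gcongr
      exact (abs_sub _ _).trans (by linarith [hR x])
    linarith [hθ x]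
  · have hc := hf.continuous
    refine HalfDominates.dominatesLine ?_ ?_
    · refine (hm.add_const hc (θ - m₁)).neg.halfDominates (R := R + |θ - m₁|) (fun x => ?_)
        (by linarith)
      rw [abs_neg]; exact hR' x
    · simp only [neg_neg]
      exact (hm'.add_const (hc.comp continuous_neg) (θ - m₁)).halfDominates (fun x => hR' _)
        (by simp)

/-- Lower growth rate for slopes between the two correctors, obtained by connecting the upper
corrector on the left to the lower one on the right above a hill of the potential. -/
lemma IsLinearDatumSol.ge_hill (hu : IsLinearDatumSol a (fun x p => G p + β * V x) θ K u)
    (hG : IsQuasiconvexHamiltonian G p₀) (hE : IsEnvironment a V κ) (hκ : 0 < κ) (hβ : 0 ≤ β)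
    (hη : 0 ≤ η) (hδ : 0 ≤ δ)
    (hf₁ : IsCorrector a V G β p₀ κ η δ lam f₁) (hf₂ : IsCorrector a V G β p₀ κ η δ lam f₂)
    (hp₁ : ∀ x, f₁ x ≤ p₀) (hp₂ : ∀ x, p₀ ≤ f₂ x) (hR₁ : ∀ x, |f₁ x| ≤ R) (hR₂ : ∀ x, |f₂ x| ≤ R)
    (hm₁ : HasMean f₁ m₁) (hm₂ : HasMean (fun x => f₂ (-x)) m₂) (h₁ : m₁ ≤ θ) (h₂ : θ ≤ m₂)
    {ℓ₁ ℓ₂ δ₀ ε h lam' : ℝ} (hℓ : ℓ₁ < ℓ₂) (hδ₀ : 0 < δ₀) (hε : 0 < ε)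
    (hhill : 2 * R ≤ ε * ∫ x in ℓ₁..ℓ₂, 1 / max (a x) δ₀) (hV : ∀ x ∈ Icc ℓ₁ ℓ₂, h ≤ V x)
    (hlam₁ : lam' ≤ lam - (δ * derivBound κ (β * κ + 1) η (lam - G p₀) + η * (2 * R)))
    (hlam₂ : lam' ≤ G p₀ + β * h - ε) (hσ : 0 < σ) :
    ∃ C, ∀ t, 0 ≤ t → (lam' - σ) * t - C ≤ u t 0 := by
  have hp₀R : |p₀| ≤ R := by
    have h1 := abs_le.1 (hR₁ 0)
    have h2 := abs_le.1 (hR₂ 0)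
    exact abs_le.2 ⟨by linarith [hp₂ 0, hp₁ 0], by linarith [hp₂ 0]⟩
  have hsub : ∀ f, IsCorrector a V G β p₀ κ η δ lam f → (∀ x, |f x| ≤ R) → ∀ x,
      SlopeAt (fun x p d => lam' ≤ a x * d + (G p + β * V x)) f x := by
    intro f hf hR x
    obtain ⟨d, hd, he, hb⟩ := hf x
    refine hd.slopeAt ?_
    have h2 := mul_le_mul_of_nonneg_left ((le_abs_self d).trans hb) hδ
    have h3 : η * |f x - p₀| ≤ η * (2 * R) := by
      gcongr
      exact (abs_sub _ _).trans (by linarith [hR x])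
    linarith
  have hcont : Continuous fun x => 1 / max (a x) δ₀ :=
    continuous_const.div ((hE.continuous_a hκ.le).max continuous_const)
      fun x => (lt_max_of_lt_right hδ₀).ne'
  set g : ℝ → ℝ := fun x => f₂ ℓ₁ - ε * ∫ s in ℓ₁..x, 1 / max (a s) δ₀ with hg
  have hgd : ∀ x, HasDerivAt g (-(ε * (1 / max (a x) δ₀))) x := fun x =>
    ((intervalIntegral.integral_hasDerivAt_right (hcont.intervalIntegrable _ _)
      (hcont.stronglyMeasurableAtFilter _ _) hcont.continuousAt).const_mul ε).const_sub _
  have hgc : Continuous g := continuous_iff_continuousAt.2 fun x => (hgd x).continuousAt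
  have hgs : ∀ x ∈ Icc ℓ₁ ℓ₂, SlopeAt (fun x p d => lam' ≤ a x * d + (G p + β * V x)) g x := by
    intro x hx
    refine (hgd x).slopeAt ?_
    have h1 : a x * (1 / max (a x) δ₀) ≤ 1 := by
      rw [mul_one_div, div_le_one (lt_max_of_lt_right hδ₀)]
      exact le_max_left _ _
    have h2 := mul_le_mul_of_nonneg_left h1 hε.le
    have h3 := mul_le_mul_of_nonneg_left (hV x hx) hβ
    nlinarith [hG.le (g x)]
  have hf₁c := hf₁.continuous
  have hf₂c := hf₂.continuous
  obtain ⟨c, hc, hgfc⟩ : ∃ c ∈ Icc ℓ₁ ℓ₂, g c = f₁ c := by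
    have e₁ : 0 ≤ g ℓ₁ - f₁ ℓ₁ := by
      simp only [hg, intervalIntegral.integral_same]
      linarith [hp₂ ℓ₁, hp₁ ℓ₁]
    have e₂ : g ℓ₂ - f₁ ℓ₂ ≤ 0 := by
      simp only [hg]
      linarith [(abs_le.1 (hR₂ ℓ₁)).2, (abs_le.1 (hR₁ ℓ₂)).1]
    obtain ⟨c, hc, h0⟩ := intermediate_value_Icc' hℓ.le (f := fun x => g x - f₁ x)
      (hgc.sub hf₁c).continuousOn ⟨e₂, e₁⟩
    exact ⟨c, hc, sub_eq_zero.1 h0⟩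
  have hc1 : f₂ ℓ₁ = g ℓ₁ := by simp [hg]
  have hc2 : glueAt ℓ₁ f₂ g c = f₁ c := by rw [glueAt_of_ge hc1 hc.1, hgfc]
  have hs : IsSubSlope a (fun x p => G p + β * V x) lam' (glueAt c (glueAt ℓ₁ f₂ g) f₁) := by
    intro x
    refine slopeAt_glueAt hc2 (fun hx => ?_) fun _ => hsub f₁ hf₁ hR₁ x
    exact slopeAt_glueAt hc1 (fun _ => hsub f₂ hf₂ hR₂ x) fun hx' => hgs x ⟨hx', hx.trans hc.2⟩
  set F := glueAt c (glueAt ℓ₁ f₂ g) f₁ with hF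
  have hFc : Continuous F := continuous_iff_continuousAt.2 fun x => by
    obtain ⟨⟨d, hd, -⟩, d', hd', -⟩ := hs x
    exact continuousAt_iff_continuous_left_right.2
      ⟨hd.continuousWithinAt, hd'.continuousWithinAt⟩
  obtain ⟨B, hB⟩ := (isCompact_Icc (a := ℓ₁) (b := ℓ₂)).exists_bound_of_continuousOn
    hFc.continuousOn
  have hFl : ∀ x, x ≤ ℓ₁ → F x = f₂ x := fun x hx => by
    rw [hF, glueAt_of_le (hx.trans hc.1), glueAt_of_le hx]
  have hFr : ∀ x, c ≤ x → F x = f₁ x := fun x hx => glueAt_of_ge hc2 hx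
  have hFB : ∀ x, |F x| ≤ max B R := by
    intro x
    rcases le_total x ℓ₁ with hx | hx
    · rw [hFl x hx]; exact (hR₂ x).trans (le_max_right _ _)
    · rcases le_total x ℓ₂ with hx' | hx'
      · exact (hB x ⟨hx, hx'⟩).trans (le_max_left _ _)
      · rw [hFr x (hc.2.trans hx')]; exact (hR₁ x).trans (le_max_right _ _)
  refine ge_of_isSubSlope (f := F) (R := max B R) hE.a_mem
    (hG.lip_add _) hu.cont hu.init hu.ge hu.super hs hFB (HalfDominates.dominatesLine ?_ ?_) hσ
  · refine HalfDominates.congr_of_ge (f := fun x => -f₁ x) (c := c) hf₁c.neg hFc.neg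
      (hm₁.neg.halfDominates (R := R) (fun x => ?_) (neg_le_neg h₁)) fun x hx => ?_
    · rw [abs_neg]; exact hR₁ x
    · rw [hFr x hx]
  · simp only [neg_neg]
    refine HalfDominates.congr_of_ge (f := fun x => f₂ (-x)) (c := -ℓ₁)
      (hf₂c.comp continuous_neg) (hFc.comp continuous_neg)
      (hm₂.halfDominates (fun x => hR₂ _) h₂) fun x hx => ?_
    exact hFl _ (by linarith)
end

lemma MemG.continuous {α₀ α₁ γ : ℝ} {G : ℝ → ℝ} (hγ : 1 < γ) (hG : MemG α₀ α₁ γ G) :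
    Continuous G := by
  refine continuous_iff_continuousAt.2 fun p => ?_
  have hc : Continuous fun q => α₁ * (|q| + |p| + 1) ^ (γ - 1) * |q - p| := by
    have : Continuous fun q : ℝ => (|q| + |p| + 1) ^ (γ - 1) :=
      (by fun_prop : Continuous fun q : ℝ => |q| + |p| + 1).rpow_const
        fun q => Or.inr (by linarith)
    fun_prop
  have h0 := hc.tendsto p
  rw [sub_self, abs_zero, mul_zero] at h0
  exact tendsto_iff_dist_tendsto_zero.2
    (squeeze_zero (fun _ => dist_nonneg) (fun q => hG.2 q p) h0)

lemma tendsto_atTop_of_rpow_le {α₀ γ : ℝ} {G : ℝ → ℝ} {l : Filter ℝ} (hα : 0 < α₀) (hγ : 1 < γ)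
    (h : ∀ p, α₀ * |p| ^ γ - 1 / α₀ ≤ G p) (hl : Filter.Tendsto (fun p : ℝ => |p|) l Filter.atTop) :
    Filter.Tendsto G l Filter.atTop := by
  refine Filter.tendsto_atTop_mono h ?_
  simp_rw [sub_eq_add_neg]
  exact Filter.tendsto_atTop_add_const_right _ _
    (((tendsto_rpow_atTop (by linarith)).comp hl).const_mul_atTop hα)

lemma MemG.exists_isQuasiconvexHamiltonian {α₀ α₁ γ : ℝ} {G : ℝ → ℝ} (hα₀ : 0 < α₀)
    (hα₁ : 0 < α₁) (hγ : 1 < γ) (hG : MemG α₀ α₁ γ G)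
    (hqc : ∀ c : ℝ, Convex ℝ {p : ℝ | G p ≤ c}) : ∃ p₀, IsQuasiconvexHamiltonian G p₀ := by
  have htop := tendsto_atTop_of_rpow_le hα₀ hγ (fun p => (hG.1 p).1)
    Filter.tendsto_abs_atTop_atTop
  have hbot := tendsto_atTop_of_rpow_le hα₀ hγ (fun p => (hG.1 p).1)
    Filter.tendsto_abs_atBot_atTop
  obtain ⟨p₀, hp₀⟩ := (hG.continuous hγ).exists_forall_le (by
    rw [cocompact_eq_atBot_atTop]; exact hbot.sup htop)
  have hoc : ∀ p q r, p ≤ q → q ≤ r → ∀ c, G p ≤ c → G r ≤ c → G q ≤ c :=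
    fun p q r h1 h2 c hp hr => (convex_iff_ordConnected.1 (hqc c)).out hp hr ⟨h1, h2⟩
  refine ⟨p₀, ⟨fun p hp q hq h => hoc p q p₀ h hq _ le_rfl (hp₀ _),
    fun p hp q hq h => hoc p₀ p q hp h _ (hp₀ _) le_rfl, fun R => ?_, htop, hbot⟩⟩
  refine ⟨α₁ * (|R| + |R| + 1) ^ (γ - 1), by positivity, fun p q hp hq => (hG.2 p q).trans ?_⟩
  have hp' := hp.trans (le_abs_self R)
  have hq' := hq.trans (le_abs_self R)
  refine mul_le_mul_of_nonneg_right (mul_le_mul_of_nonneg_left ?_ hα₁.le) (abs_nonneg _)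
  exact rpow_le_rpow (by positivity) (by linarith) (by linarith)

lemma IsQuasiconvexHamiltonian.sInf_range_add {G : ℝ → ℝ} {p₀ : ℝ}
    (hG : IsQuasiconvexHamiltonian G p₀) (β : ℝ) :
    sInf (range fun p => G p + β) = G p₀ + β :=
  IsLeast.csInf_eq ⟨⟨p₀, rfl⟩, by rintro _ ⟨p, rfl⟩; exact add_le_add_left (hG.le p) β⟩

section
variable {Ω : Type*} [MeasurableSpace Ω]

/-- A stationary corrector at level `lam` whose slope stays above the minimum point `p₀`. -/
structure IsUpperCorrector (τ : ℝ → Ω → Ω) (a V : Ω → ℝ) (G : ℝ → ℝ) (β p₀ κ η δ lam : ℝ)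
    (f : Ω → ℝ) : Prop where
  meas : Measurable f
  ge : ∀ ω, p₀ ≤ f ω
  level : ∀ ω, G (f ω) ≤ lam
  corr : ∀ ω, IsCorrector (fun x => a (τ x ω)) (fun x => V (τ x ω)) G β p₀ κ η δ lam
    fun x => f (τ x ω)

variable {τ : ℝ → Ω → Ω} {a V : Ω → ℝ} {G : ℝ → ℝ} {β p₀ κ η δ lam : ℝ}

lemma exists_isUpperCorrector (hτ : Measurable fun p : ℝ × Ω => τ p.1 p.2)
    (hτ_zero : ∀ ω, τ 0 ω = ω)
    (hτ_add : ∀ x y : ℝ, ∀ ω, τ (x + y) ω = τ x (τ y ω))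
    (ham : Measurable a) (hVm : Measurable V)
    (hE : ∀ ω, IsEnvironment (fun x => a (τ x ω)) (fun x => V (τ x ω)) κ)
    (hG : IsQuasiconvexHamiltonian G p₀) (hκ : 0 < κ) (hβ : 0 ≤ β) (hη : 0 < η) (hδ : 0 < δ)
    (hδ1 : δ ≤ 1) (hlam : G p₀ + β ≤ lam) :
    ∃ f, IsUpperCorrector τ a V G β p₀ κ η δ lam f := by
  have haI : ∀ ω, a ω ∈ Icc (0:ℝ) 1 := fun ω => by simpa [hτ_zero] using (hE ω).a_mem 0
  have hVI : ∀ ω, V ω ∈ Icc (0:ℝ) 1 := fun ω => by simpa [hτ_zero] using (hE ω).V_mem 0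
  obtain ⟨f, hfm, hf0, hfl, hfd⟩ := exists_corrector hτ hτ_zero hτ_add (G := G)
    (a := a) (r := fun ω => lam - β * V ω) (p₀ := p₀) (κ := κ) (L := β * κ + 1) (η := η)
    (δ := δ) (lam := lam) hκ (by positivity) hη hδ hδ1 ham (by fun_prop) haI
    (fun ω x y => (hE ω).a_lip x y)
    (fun ω => ⟨by nlinarith [(hVI ω).2], by nlinarith [(hVI ω).1]⟩)
    (fun ω x y => by
      have h1 := (hE ω).V_lip x y
      rw [show lam - β * V (τ x ω) - (lam - β * V (τ y ω)) = -(β * (V (τ x ω) - V (τ y ω))) by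
        ring, abs_neg, abs_mul, abs_of_nonneg hβ]
      nlinarith [abs_nonneg (x - y)])
    hG.mono hG.exists_lip_Icc (hG.exists_ge lam)
  refine ⟨f, hfm, hf0, fun ω => ?_, fun ω x => ?_⟩
  · nlinarith [hf0 ω, hfl ω]
  · obtain ⟨d, hd, he, hb⟩ := hfd ω x
    exact ⟨d, hd, by rw [abs_of_nonneg (sub_nonneg.2 (hf0 _))]; exact he, hb⟩

namespace IsUpperCorrector
variable {f : Ω → ℝ} (hf : IsUpperCorrector τ a V G β p₀ κ η δ lam f)
include hf

lemma abs_le {R : ℝ} (hR : ∀ p, G p ≤ lam → |p| ≤ R) (ω : Ω) : |f ω| ≤ R := hR _ (hf.level ω)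

lemma add_le (hτ_zero : ∀ ω, τ 0 ω = ω) (haI : ∀ ω, a ω ∈ Icc (0:ℝ) 1)
    (hG : IsQuasiconvexHamiltonian G p₀) (hη : 0 < η)
    (hδ : 0 < δ) (hδ1 : δ ≤ 1) {lam' s Δ : ℝ} {g : Ω → ℝ}
    (hg : IsUpperCorrector τ a V G β p₀ κ η δ lam' g)
    (hΔ : ∀ p, G p ≤ lam → G (p + s) ≤ G p + Δ) (hlam : lam + Δ + η * s ≤ lam') (ω : Ω) :
    f ω + s ≤ g ω := by
  choose df hdf hef _ using hf.corr ω
  choose dg hdg heg _ using hg.corr ω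
  obtain ⟨B, hB⟩ := hG.exists_abs_le lam
  have := le_of_contracting (f₁ := fun x => f (τ x ω) + s) (f₂ := fun x => g (τ x ω)) (d₁ := df)
    (d₂ := dg) (k := η / 2) (B := B + s - p₀) (x₀ := 0) (by positivity)
    (fun x _ => (hdf x).add_const s) (fun x _ => hdg x)
    (fun x _ => by linarith [(_root_.abs_le.1 (hf.abs_le hB (τ x ω))).2, hg.ge (τ x ω)])
    (fun x _ hx => by
      have h1 := hef x
      have h2 := heg x
      rw [abs_of_nonneg (sub_nonneg.2 (hf.ge _))] at h1
      rw [abs_of_nonneg (sub_nonneg.2 (hg.ge _))] at h2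
      have h3 := hΔ _ (hf.level (τ x ω))
      have h4 := hG.mono (hg.ge (τ x ω)) ((hg.ge _).trans hx.le) hx.le
      have h5 := haI (τ x ω)
      have h6 : (a (τ x ω) + δ) * (df x - dg x) ≤ -η * (f (τ x ω) + s - g (τ x ω)) := by
        nlinarith
      have h7 : 0 < a (τ x ω) + δ := by linarith [h5.1]
      have h8 : 0 < f (τ x ω) + s - g (τ x ω) := by linarith
      by_contra! h9
      have h10 : a (τ x ω) + δ ≤ 2 := by linarith [h5.2]
      nlinarith [mul_pos hη h8, mul_lt_mul_of_pos_left h9 h7])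
  simpa [hτ_zero] using this

lemma le (hτ_zero : ∀ ω, τ 0 ω = ω) (haI : ∀ ω, a ω ∈ Icc (0:ℝ) 1)
    (hVI : ∀ ω, V ω ∈ Icc (0:ℝ) 1) (hβ : 0 ≤ β)
    (hG : IsQuasiconvexHamiltonian G p₀) (hη : 0 < η)
    (hδ : 0 < δ) (hδ1 : δ ≤ 1) {θ : ℝ} (hlam : G θ + η * (θ - p₀) ≤ lam - β)
    (ω : Ω) : θ ≤ f ω := by
  choose df hdf hef _ using hf.corr ω
  have := le_of_contracting (f₁ := fun _ => θ) (f₂ := fun x => f (τ x ω)) (d₁ := fun _ => 0)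
    (d₂ := df) (k := η / 2) (B := θ - p₀) (x₀ := 0) (by positivity)
    (fun x _ => hasDerivAt_const x θ) (fun x _ => hdf x)
    (fun x _ => by linarith [hf.ge (τ x ω)])
    (fun x _ hx => by
      have h1 := hef x
      rw [abs_of_nonneg (sub_nonneg.2 (hf.ge _))] at h1
      have h4 := hG.mono (hf.ge (τ x ω)) ((hf.ge _).trans hx.le) hx.le
      have h5 := haI (τ x ω)
      have h6 : η * (θ - f (τ x ω)) ≤ (a (τ x ω) + δ) * df x := by
        nlinarith [(hVI (τ x ω)).2]
      have h7 : 0 < a (τ x ω) + δ := by linarith [h5.1]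
      have h8 : 0 < θ - f (τ x ω) := by linarith
      by_contra! h9
      have h10 : a (τ x ω) + δ ≤ 2 := by linarith [h5.2]
      nlinarith [mul_pos hη h8, mul_lt_mul_of_pos_left h9 h7])
  simpa [hτ_zero] using this

end IsUpperCorrector
end

/-- Abstract properties of the mean slopes `M n lam` of upper correctors at level `lam`, with
damping parameters `η n`. -/
structure IsSlopeFamily (G : ℝ → ℝ) (p₀ β : ℝ) (η : ℕ → ℝ) (M : ℕ → ℝ → ℝ) : Prop where
  ge : ∀ n lam, G p₀ + β ≤ lam → p₀ ≤ M n lam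
  level : ∀ n lam, G p₀ + β ≤ lam → G (M n lam) ≤ lam
  add_le : ∀ n lam lam' s Δ, G p₀ + β ≤ lam → G p₀ + β ≤ lam' →
    (∀ p, G p ≤ lam → G (p + s) ≤ G p + Δ) → lam + Δ + η n * s ≤ lam' → M n lam + s ≤ M n lam'
  le : ∀ n lam θ, G p₀ + β ≤ lam → G θ + η n * (θ - p₀) ≤ lam - β → θ ≤ M n lam

section
variable {Ω : Type*} [MeasurableSpace Ω] {P : Measure Ω} [IsProbabilityMeasure P]
variable {τ : ℝ → Ω → Ω} {a V : Ω → ℝ} {G : ℝ → ℝ} {β p₀ κ : ℝ} {η δ : ℕ → ℝ}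

lemma isSlopeFamily_integral (hτ_zero : ∀ ω, τ 0 ω = ω) (haI : ∀ ω, a ω ∈ Icc (0:ℝ) 1)
    (hVI : ∀ ω, V ω ∈ Icc (0:ℝ) 1) (hβ : 0 ≤ β)
    (hG : IsQuasiconvexHamiltonian G p₀) (hη : ∀ n, 0 < η n)
    (hδ : ∀ n, 0 < δ n) (hδ1 : ∀ n, δ n ≤ 1) {f : ℕ → ℝ → Ω → ℝ}
    (hf : ∀ n lam, G p₀ + β ≤ lam →
      IsUpperCorrector τ a V G β p₀ κ (η n) (δ n) lam (f n lam)) :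
    IsSlopeFamily G p₀ β η fun n lam => ∫ ω, f n lam ω ∂P := by
  have hi : ∀ n lam, G p₀ + β ≤ lam → Integrable (f n lam) P := fun n lam hl => by
    obtain ⟨B, hB⟩ := hG.exists_abs_le lam
    exact integrable_of_abs_le (hf n lam hl).meas ((hf n lam hl).abs_le hB)
  have hc : ∀ n lam c, G p₀ + β ≤ lam → (∀ ω, c ≤ f n lam ω) → c ≤ ∫ ω, f n lam ω ∂P :=
    fun n lam c hl h => by
      simpa using integral_mono (integrable_const c) (hi n lam hl) h
  refine ⟨fun n lam hl => hc n lam _ hl (hf n lam hl).ge, fun n lam hl => ?_,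
    fun n lam lam' s Δ hl hl' hΔ h => ?_, fun n lam θ hl h => hc n lam _ hl
      ((hf n lam hl).le hτ_zero haI hVI hβ hG (hη n) (hδ n) (hδ1 n) h)⟩
  · obtain ⟨ω, hω⟩ := exists_integral_le (hi n lam hl)
    exact (hG.mono (hc n lam _ hl (hf n lam hl).ge) ((hf n lam hl).ge ω) hω).trans
      ((hf n lam hl).level ω)
  · have := integral_mono ((hi n lam hl).add (integrable_const s)) (hi n lam' hl')
      ((hf n lam hl).add_le hτ_zero haI hG (hη n) (hδ n) (hδ1 n) (hf n lam' hl') hΔ h)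
    simp only [Pi.add_apply] at this
    rw [integral_add (hi n lam hl) (integrable_const s)] at this
    simpa using this

end

/-- The slope `θ` eventually lies between the mean lower and upper corrector slopes at level
`lam`; the lower slopes are encoded by the reflected family `N`. -/
def IsFlatSlope (M N : ℕ → ℝ → ℝ) (lam θ : ℝ) : Prop :=
  ∀ᶠ n in Filter.atTop, -N n lam ≤ θ ∧ θ ≤ M n lam

/-- The effective Hamiltonian: the lowest level at which `θ` is a flat slope. -/
def effectiveHamiltonian (M N : ℕ → ℝ → ℝ) (lam₀ θ : ℝ) : ℝ :=
  sInf {lam | lam₀ ≤ lam ∧ IsFlatSlope M N lam θ}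

section
variable {G : ℝ → ℝ} {p₀ β : ℝ} {η : ℕ → ℝ} {M N : ℕ → ℝ → ℝ}
variable (hG : IsQuasiconvexHamiltonian G p₀) (hM : IsSlopeFamily G p₀ β η M)
  (hN : IsSlopeFamily (fun p => G (-p)) (-p₀) β η N) (hη : Filter.Tendsto η Filter.atTop (nhds 0))
include hM hN

lemma IsFlatSlope.mono {lam lam' θ : ℝ} (hlam : G p₀ + β ≤ lam) (h : lam ≤ lam')
    (hθ : IsFlatSlope M N lam θ) : IsFlatSlope M N lam' θ := by
  filter_upwards [hθ] with n hn
  have h1 := hM.add_le n lam lam' 0 0 hlam (hlam.trans h) (fun p _ => by simp) (by simpa)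
  have h2 := hN.add_le n lam lam' 0 0 (by simpa) (by simpa using hlam.trans h)
    (fun p _ => by simp) (by simpa)
  constructor <;> linarith [hn.1, hn.2]

include hG in
lemma IsFlatSlope.le {lam θ : ℝ} (hlam : G p₀ + β ≤ lam) (hθ : IsFlatSlope M N lam θ) :
    G θ ≤ lam := by
  obtain ⟨n, h1, h2⟩ := hθ.exists
  rcases le_total p₀ θ with h | h
  · exact (hG.mono h (h.trans h2) h2).trans (hM.level n lam hlam)
  · have h3 : -N n lam ≤ p₀ := by linarith
    exact (hG.anti (h1.trans h) h h1).trans (hN.level n lam (by simpa))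

include hη in
lemma isFlatSlope_of_lt {lam θ : ℝ} (hG : IsQuasiconvexHamiltonian G p₀) (h : G θ + β < lam) :
    IsFlatSlope M N lam θ := by
  have hlam : G p₀ + β ≤ lam := by linarith [hG.le θ]
  have h1 : Filter.Tendsto (fun n => η n * (θ - p₀)) Filter.atTop (nhds 0) := by
    simpa using hη.mul_const (θ - p₀)
  have h2 : Filter.Tendsto (fun n => η n * (-θ - -p₀)) Filter.atTop (nhds 0) := by
    simpa using hη.mul_const (-θ - -p₀)
  have hpos : 0 < lam - β - G θ := by linarith
  filter_upwards [h1.eventually_lt_const hpos, h2.eventually_lt_const hpos] with n hn hn'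
  have h3 := hM.le n lam θ hlam (by linarith)
  have h4 := hN.le n lam (-θ) (by simpa) (by simp only [neg_neg] at *; linarith)
  exact ⟨by linarith, h3⟩

omit hM hN in
lemma IsFlatSlope.of_mem_Icc {lam θ₁ θ₂ θ : ℝ} (h₁ : IsFlatSlope M N lam θ₁)
    (h₂ : IsFlatSlope M N lam θ₂) (h : θ ∈ Icc θ₁ θ₂) : IsFlatSlope M N lam θ := by
  filter_upwards [h₁, h₂] with n hn hn'
  exact ⟨hn.1.trans h.1, h.2.trans hn'.2⟩

include hη in
lemma IsFlatSlope.add {lam lam' θ s Δ : ℝ} (hlam : G p₀ + β ≤ lam) (hlam' : G p₀ + β ≤ lam')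
    (hΔ : ∀ p, G p ≤ lam → G (p + s) ≤ G p + Δ) (h : lam + Δ < lam')
    (hθ : IsFlatSlope M N lam θ) : IsFlatSlope M N lam' (θ + s) := by
  have h1 : Filter.Tendsto (fun n => η n * s) Filter.atTop (nhds 0) := by
    simpa using hη.mul_const s
  have hpos : 0 < lam' - lam - Δ := by linarith
  filter_upwards [h1.eventually_lt_const hpos, h1.eventually_const_lt (neg_lt_zero.2 hpos), hθ]
    with n hn hn' hθn
  have h3 := hM.add_le n lam lam' s Δ hlam hlam' hΔ (by linarith)
  have h4 := hN.add_le n lam lam' (-s) Δ (by simpa) (by simpa)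
    (fun p hp => by have := hΔ _ hp; rwa [show -(p + -s) = -p + s by ring]) (by linarith)
  constructor <;> linarith [hθn.1, hθn.2]

omit hM hN in
lemma bddBelow_flat_levels (θ : ℝ) :
    BddBelow {lam | G p₀ + β ≤ lam ∧ IsFlatSlope M N lam θ} := ⟨_, fun _ h => h.1⟩

include hη hG

lemma nonempty_flat_levels (θ : ℝ) : {lam | G p₀ + β ≤ lam ∧ IsFlatSlope M N lam θ}.Nonempty :=
  ⟨G θ + β + 1, by linarith [hG.le θ], isFlatSlope_of_lt hM hN hη hG (by linarith)⟩

lemma min_le_effectiveHamiltonian (θ : ℝ) : G p₀ + β ≤ effectiveHamiltonian M N (G p₀ + β) θ :=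
  le_csInf (nonempty_flat_levels hG hM hN hη θ) fun _ h => h.1

lemma le_effectiveHamiltonian (θ : ℝ) : G θ ≤ effectiveHamiltonian M N (G p₀ + β) θ :=
  le_csInf (nonempty_flat_levels hG hM hN hη θ) fun _ h => h.2.le hG hM hN h.1

lemma effectiveHamiltonian_le (θ : ℝ) : effectiveHamiltonian M N (G p₀ + β) θ ≤ G θ + β :=
  le_of_forall_pos_le_add fun e he => csInf_le (bddBelow_flat_levels θ)
    ⟨by linarith [hG.le θ], isFlatSlope_of_lt hM hN hη hG (by linarith)⟩

lemma effectiveHamiltonian_min : effectiveHamiltonian M N (G p₀ + β) p₀ = G p₀ + β :=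
  le_antisymm (effectiveHamiltonian_le hG hM hN hη p₀) (min_le_effectiveHamiltonian hG hM hN hη p₀)

lemma isFlatSlope_of_effectiveHamiltonian_lt {lam θ : ℝ}
    (h : effectiveHamiltonian M N (G p₀ + β) θ < lam) : IsFlatSlope M N lam θ := by
  obtain ⟨l, ⟨hl0, hl⟩, hlt⟩ := exists_lt_of_csInf_lt (nonempty_flat_levels hG hM hN hη θ) h
  exact hl.mono hM hN hl0 hlt.le

omit hM hN hη hG in
lemma not_isFlatSlope_of_lt_effectiveHamiltonian {lam θ : ℝ} (hlam : G p₀ + β ≤ lam)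
    (h : lam < effectiveHamiltonian M N (G p₀ + β) θ) : ¬ IsFlatSlope M N lam θ :=
  fun hf => absurd (csInf_le (bddBelow_flat_levels θ) ⟨hlam, hf⟩) (not_le.2 h)

lemma convex_sublevel_effectiveHamiltonian (c : ℝ) :
    Convex ℝ {p | effectiveHamiltonian M N (G p₀ + β) p ≤ c} := by
  refine convex_iff_ordConnected.2 ⟨fun p hp q hq r hr => ?_⟩
  refine le_of_forall_pos_le_add fun e he => csInf_le (bddBelow_flat_levels r) ⟨?_, ?_⟩
  · linarith [min_le_effectiveHamiltonian hG hM hN hη p,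
      show effectiveHamiltonian M N (G p₀ + β) p ≤ c from hp]
  · exact (isFlatSlope_of_effectiveHamiltonian_lt hG hM hN hη
      (lt_of_le_of_lt hp (by linarith))).of_mem_Icc
      (isFlatSlope_of_effectiveHamiltonian_lt hG hM hN hη (lt_of_le_of_lt hq (by linarith))) hr

lemma effectiveHamiltonian_add_le {θ s Δ : ℝ} (hΔ0 : 0 ≤ Δ)
    (hΔ : ∀ p, G p ≤ effectiveHamiltonian M N (G p₀ + β) θ + 1 → G (p + s) ≤ G p + Δ) :
    effectiveHamiltonian M N (G p₀ + β) (θ + s) ≤ effectiveHamiltonian M N (G p₀ + β) θ + Δ := by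
  refine le_of_forall_pos_le_add fun e he => ?_
  have h0 := min_le_effectiveHamiltonian hG hM hN hη θ
  have hm : 0 < min (e / 2) 1 := by positivity
  have hm1 := min_le_left (e / 2) 1
  refine csInf_le (bddBelow_flat_levels _) ⟨by linarith, ?_⟩
  exact IsFlatSlope.add hM hN hη (lam := effectiveHamiltonian M N (G p₀ + β) θ + min (e / 2) 1)
    (by linarith) (by linarith)
    (fun p hp => hΔ p (hp.trans (by linarith [min_le_right (e / 2) 1]))) (by linarith)
    (isFlatSlope_of_effectiveHamiltonian_lt hG hM hN hη (by linarith))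

lemma memG_effectiveHamiltonian {α₀ α₁ γ : ℝ} (hα₀ : 0 < α₀) (hα₁ : 0 < α₁) (hγ : 1 < γ)
    (hβ : 0 ≤ β) (hGG : MemG α₀ α₁ γ G) :
    ∃ α₂, 0 < α₂ ∧ MemG α₀ α₂ γ (effectiveHamiltonian M N (G p₀ + β)) := by
  set K := 2 * α₁ + β + 1 + 1 / α₀ with hK
  have hα₀' : 0 < 1 / α₀ := by positivity
  set C := K / α₀ + 1 with hC
  have hC1 : 1 ≤ C := by rw [hC, hK]; linarith [show 0 ≤ K / α₀ by positivity]
  have hbd : ∀ q p, G p ≤ effectiveHamiltonian M N (G p₀ + β) q + 1 → |p| ≤ C * (|q| + 1) :=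
      fun q p hp => by
    have h1 := (effectiveHamiltonian_le hG hM hN hη q).trans
      (add_le_add_left (hGG.1 q).2 β)
    have h2 := (hGG.1 p).1
    have h3 : |q| ^ γ ≤ (|q| + 1) ^ γ := by gcongr; linarith
    have h4 : (1:ℝ) ≤ (|q| + 1) ^ γ := one_le_rpow (by linarith [abs_nonneg q]) (by linarith)
    have h5 : α₀ * |p| ^ γ ≤ K * (|q| + 1) ^ γ := by
      rw [hK]; nlinarith
    have h6 : |p| ^ γ ≤ (C * (|q| + 1)) ^ γ := by
      rw [mul_rpow (by positivity) (by positivity)]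
      have h7 : C ≤ C ^ γ := self_le_rpow_of_one_le hC1 hγ.le
      have h8 : |p| ^ γ ≤ K / α₀ * (|q| + 1) ^ γ := by
        rw [div_mul_eq_mul_div, le_div_iff₀ hα₀]; linarith
      nlinarith
    exact (rpow_le_rpow_iff (abs_nonneg p) (by positivity) (by linarith)).1 h6
  set α₂ := max (α₁ * (2 * C + 1) ^ (γ - 1)) (α₁ + β) with hα₂
  have hα₂0 : 0 < α₂ := lt_of_lt_of_le (by positivity) (le_max_right _ _)
  have hle : ∀ q q', effectiveHamiltonian M N (G p₀ + β) q' ≤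
      effectiveHamiltonian M N (G p₀ + β) q +
      α₂ * (|q| + |q'| + 1) ^ (γ - 1) * |q - q'| := fun q q' => by
    have h := effectiveHamiltonian_add_le hG hM hN hη (θ := q) (s := q' - q)
      (Δ := α₂ * (|q| + |q'| + 1) ^ (γ - 1) * |q - q'|) (by positivity) fun p hp => by
        have h1 := hbd q p hp
        have h2 := (le_abs_self _).trans (hGG.2 (p + (q' - q)) p)
        rw [add_sub_cancel_left, abs_sub_comm] at h2
        have h3 : |p + (q' - q)| ≤ |p| + (|q'| + |q|) :=
          (abs_add_le _ _).trans (add_le_add_right (abs_sub _ _) _)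
        have h4 : |p + (q' - q)| + |p| + 1 ≤ (2 * C + 1) * (|q| + |q'| + 1) := by
          nlinarith [abs_nonneg q, abs_nonneg q']
        have h5 : (|p + (q' - q)| + |p| + 1) ^ (γ - 1) ≤
            (2 * C + 1) ^ (γ - 1) * (|q| + |q'| + 1) ^ (γ - 1) := by
          rw [← mul_rpow (by positivity) (by positivity)]
          exact rpow_le_rpow (by positivity) h4 (by linarith)
        have h6 : α₁ * (|p + (q' - q)| + |p| + 1) ^ (γ - 1) ≤ α₂ * (|q| + |q'| + 1) ^ (γ - 1) :=
          calc _ ≤ α₁ * ((2 * C + 1) ^ (γ - 1) * (|q| + |q'| + 1) ^ (γ - 1)) := by gcongr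
            _ = α₁ * (2 * C + 1) ^ (γ - 1) * (|q| + |q'| + 1) ^ (γ - 1) := by ring
            _ ≤ _ := by gcongr; exact le_max_left _ _
        have h7 := mul_le_mul_of_nonneg_right h6 (abs_nonneg (q - q'))
        linarith
    rwa [add_sub_cancel] at h
  refine ⟨α₂, hα₂0, fun p => ⟨(hGG.1 p).1.trans (le_effectiveHamiltonian hG hM hN hη p), ?_⟩,
    fun p q => abs_le.2 ⟨?_, ?_⟩⟩
  · have h1 := effectiveHamiltonian_le hG hM hN hη p
    have h2 := (hGG.1 p).2
    have h3 : (α₁ + β) * (|p| ^ γ + 1) ≤ α₂ * (|p| ^ γ + 1) := by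
      gcongr; exact le_max_right _ _
    nlinarith [show 0 ≤ |p| ^ γ by positivity]
  · linarith [hle p q]
  · have := hle q p
    rw [add_comm |q|, abs_sub_comm] at this
    linarith

end

lemma eventually_div_lt {v : ℝ → ℝ} {A B C : ℝ} (h : ∀ t, 0 ≤ t → v t ≤ C + A * t) (hAB : A < B) :
    ∀ᶠ t in Filter.atTop, v t / t < B := by
  filter_upwards [Filter.eventually_gt_atTop (max 0 (C / (B - A)))] with t ht
  have h0 : 0 < t := lt_of_le_of_lt (le_max_left _ _) ht
  have h1 := (div_lt_iff₀ (sub_pos.2 hAB)).1 (lt_of_le_of_lt (le_max_right _ _) ht)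
  rw [div_lt_iff₀ h0]
  nlinarith [h t h0.le]

lemma eventually_lt_div {v : ℝ → ℝ} {A B C : ℝ} (h : ∀ t, 0 ≤ t → A * t - C ≤ v t) (hAB : B < A) :
    ∀ᶠ t in Filter.atTop, B < v t / t := by
  have := eventually_div_lt (v := fun t => -v t) (A := -A) (B := -B) (C := C)
    (fun t ht => by linarith [h t ht]) (neg_lt_neg hAB)
  filter_upwards [this] with t ht
  rw [neg_div] at ht
  linarith

/-- A corrector along one realization, together with its level bound and its mean slope. -/
structure IsPathCorrector (a V G : ℝ → ℝ) (β p₀ κ η δ lam m : ℝ) (f : ℝ → ℝ) : Prop where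
  corr : IsCorrector a V G β p₀ κ η δ lam f
  level : ∀ x, G (f x) ≤ lam
  mean : HasMean f m
  mean_neg : HasMean (fun x => f (-x)) m

/-- The hill condition along one realization. -/
def HasHills (a V : ℝ → ℝ) : Prop :=
  ∀ k j : ℕ, ∃ ℓ₁ ℓ₂ δ₀ : ℝ, ℓ₁ < ℓ₂ ∧ 0 < δ₀ ∧ (∫ x in ℓ₁..ℓ₂, 1 / max (a x) δ₀) = (j:ℝ) + 1 ∧
    ∀ x ∈ Icc ℓ₁ ℓ₂, 1 - 1 / ((k:ℝ) + 2) ≤ V x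

section
variable {a V G : ℝ → ℝ} {β p₀ κ θ K : ℝ} {η δ : ℕ → ℝ} {M N : ℕ → ℝ → ℝ} {L : Set ℝ}
  {u : ℝ → ℝ → ℝ} {f₁ f₂ : ℕ → ℝ → ℝ → ℝ}

/-- Convergence of `u t 0 / t` along one realization that carries correctors for a dense set `L`
of levels. -/
lemma IsLinearDatumSol.tendsto_div (hu : IsLinearDatumSol a (fun x p => G p + β * V x) θ K u)
    (hG : IsQuasiconvexHamiltonian G p₀) (hE : IsEnvironment a V κ) (hκ : 0 < κ) (hβ : 0 ≤ β)
    (hη0 : ∀ n, 0 < η n) (hη : Filter.Tendsto η Filter.atTop (nhds 0))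
    (hδ0 : ∀ n, 0 < δ n) (hδ1 : ∀ n, δ n ≤ 1)
    (hδ : ∀ B, Filter.Tendsto (fun n => δ n * derivBound κ (β * κ + 1) (η n) B) Filter.atTop
      (nhds 0))
    (hM : IsSlopeFamily G p₀ β η M) (hN : IsSlopeFamily (fun p => G (-p)) (-p₀) β η N)
    (hL₀ : G p₀ + β ∈ L) (hL : ∀ l ∈ L, G p₀ + β ≤ l)
    (hLd : ∀ x y, G p₀ + β ≤ x → x < y → ∃ l ∈ L, x < l ∧ l < y)
    (hf₂ : ∀ n, ∀ l ∈ L, IsPathCorrector a V G β p₀ κ (η n) (δ n) l (M n l) (f₂ n l))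
    (hf₁ : ∀ n, ∀ l ∈ L, IsPathCorrector a V G β p₀ κ (η n) (δ n) l (-N n l) (f₁ n l))
    (hp₂ : ∀ n, ∀ l ∈ L, ∀ x, p₀ ≤ f₂ n l x) (hp₁ : ∀ n, ∀ l ∈ L, ∀ x, f₁ n l x ≤ p₀)
    (hill : HasHills a V) :
    Filter.Tendsto (fun t => u t 0 / t) Filter.atTop
      (nhds (effectiveHamiltonian M N (G p₀ + β) θ)) := by
  set H := effectiveHamiltonian M N (G p₀ + β) θ with hH
  have herr : ∀ B R e, 0 < e → ∀ᶠ n in Filter.atTop,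
      δ n * derivBound κ (β * κ + 1) (η n) B + η n * (2 * R) < e := fun B R e he => by
    have := (hδ B).add (hη.mul_const (2 * R))
    rw [zero_mul, add_zero] at this
    exact this.eventually_lt_const he
  have hupper : ∀ l ∈ L, H < l → ∀ c, l < c → ∀ᶠ t in Filter.atTop, u t 0 / t < c := by
    intro l hl hHl c hc
    obtain ⟨R, hR⟩ := hG.exists_abs_le l
    obtain ⟨n, hn, hn1, hn2⟩ := ((((hδ (l - G p₀)).eventually_lt_const
      (show 0 < (c - l) / 2 by linarith))).and
      (isFlatSlope_of_effectiveHamiltonian_lt hG hM hN hη hHl)).exists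
    obtain ⟨C, hC⟩ := hu.le_level hG hE hκ hβ (hη0 n) (hδ0 n) (hδ1 n) (hL l hl) (hf₁ n l hl).corr
      (hf₂ n l hl).corr (hp₁ n l hl) (hp₂ n l hl) (fun x => hR _ ((hf₁ n l hl).level x))
      (fun x => hR _ ((hf₂ n l hl).level x)) (hf₁ n l hl).mean_neg (hf₂ n l hl).mean hn1 hn2
      (σ := (c - l) / 4) (by linarith)
    exact eventually_div_lt hC (by linarith)
  have hlower : ∀ l ∈ L, (∃ᶠ n in Filter.atTop, ¬ (-N n l ≤ θ ∧ θ ≤ M n l)) →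
      ∀ c, c < l → ∀ᶠ t in Filter.atTop, c < u t 0 / t := by
    intro l hl hfr c hc
    obtain ⟨R, hR⟩ := hG.exists_abs_le l
    have hp₀R : |p₀| ≤ R := hR p₀ (by linarith [hL l hl])
    obtain ⟨n, hn, hn'⟩ := (hfr.and_eventually
      (herr (l - G p₀) R ((l - c) / 2) (by linarith))).exists
    have key : ∀ (f : ℝ → ℝ) m, IsPathCorrector a V G β p₀ κ (η n) (δ n) l m f →
        (∀ x, G (f x) ≤ G (f x + (θ - m))) → ∀ᶠ t in Filter.atTop, c < u t 0 / t := by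
      intro f m hf hm
      obtain ⟨C, hC⟩ := hu.ge_level hG hE (hη0 n).le (hδ0 n).le hf.corr hp₀R
        (fun x => hR _ (hf.level x)) hf.mean hf.mean_neg hm (σ := (l - c) / 4) (by linarith)
      exact eventually_lt_div hC (by linarith)
    rcases not_and_or.1 hn with h | h
    · refine key _ _ (hf₁ n l hl) fun x => ?_
      have h1 := hp₁ n l hl x
      have h2 := not_le.1 h
      exact hG.anti (mem_Iic.2 (by linarith)) h1 (by linarith)
    · refine key _ _ (hf₂ n l hl) fun x => ?_
      have h1 := hp₂ n l hl x
      have h2 := not_le.1 h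
      exact hG.mono h1 (mem_Ici.2 (by linarith)) (by linarith)
  have hbase : ∀ c, c < G p₀ + β → ∀ᶠ t in Filter.atTop, c < u t 0 / t := by
    intro c hc
    by_cases hfr : ∃ᶠ n in Filter.atTop, ¬ (-N n (G p₀ + β) ≤ θ ∧ θ ≤ M n (G p₀ + β))
    · exact hlower _ hL₀ hfr c hc
    rw [Filter.not_frequently] at hfr
    simp only [not_not] at hfr
    set e := (G p₀ + β - c) / 4 with he
    have he0 : 0 < e := by rw [he]; linarith
    obtain ⟨R, hR⟩ := hG.exists_abs_le (G p₀ + β)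
    obtain ⟨n, hn, hn1, hn2⟩ := ((herr (G p₀ + β - G p₀) R e he0).and hfr).exists
    obtain ⟨k, hk⟩ := exists_nat_gt (β / e)
    obtain ⟨j, hj⟩ := exists_nat_gt (2 * R / e)
    obtain ⟨ℓ₁, ℓ₂, δ₀, hℓ, hδ₀, hint, hV⟩ := hill k j
    have hk' : β * (1 / ((k:ℝ) + 2)) ≤ e := by
      rw [mul_one_div, div_le_iff₀ (by positivity)]
      have := (div_lt_iff₀ he0).1 hk
      nlinarith
    have hj' := (div_lt_iff₀ he0).1 hj
    obtain ⟨C, hC⟩ := hu.ge_hill hG hE hκ hβ (hη0 n).le (hδ0 n).le (hf₁ n _ hL₀).corr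
      (hf₂ n _ hL₀).corr (hp₁ n _ hL₀) (hp₂ n _ hL₀) (fun x => hR _ ((hf₁ n _ hL₀).level x))
      (fun x => hR _ ((hf₂ n _ hL₀).level x)) (hf₁ n _ hL₀).mean (hf₂ n _ hL₀).mean_neg hn1 hn2
      hℓ hδ₀ he0 (by rw [hint]; nlinarith) hV (lam' := G p₀ + β - 2 * e) (by linarith)
      (by nlinarith) he0
    exact eventually_lt_div hC (by linarith)
  have hH0 := min_le_effectiveHamiltonian hG hM hN hη θ
  refine tendsto_order.2 ⟨fun c hc => ?_, fun c hc => ?_⟩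
  · rcases lt_or_ge c (G p₀ + β) with h | h
    · exact hbase c h
    obtain ⟨l, hl, hcl, hlH⟩ := hLd c _ h hc
    exact hlower l hl (Filter.not_eventually.1
      (not_isFlatSlope_of_lt_effectiveHamiltonian (hL l hl) hlH)) c hcl
  · obtain ⟨l, hl, hHl, hlc⟩ := hLd _ c hH0 hc
    exact hupper l hl hHl c hlc

end

lemma isLinearDatumSol_of_lipschitz {a V G : ℝ → ℝ} {β θ : ℝ} {u : ℝ → ℝ → ℝ} {K : NNReal}
    (hK : LipschitzOnWith K (fun p : ℝ × ℝ => u p.1 p.2) (Ici 0 ×ˢ univ))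
    (hu : IsParabolicViscSol a V G β u) (h0 : ∀ x, u 0 x = θ * x) :
    IsLinearDatumSol a (fun x p => G p + β * V x) θ K u := by
  have hd : ∀ t x, 0 ≤ t → |u t x - θ * x| ≤ K * t := fun t x ht => by
    have := hK.dist_le_mul (t, x) ⟨ht, trivial⟩ (0, x) ⟨self_mem_Ici, trivial⟩
    simpa [Real.dist_eq, Prod.dist_eq, h0, abs_of_nonneg ht, max_eq_left ht] using this
  refine ⟨hu.1, h0, fun t x ht => by linarith [(abs_le.1 (hd t x ht)).2],
    fun t x ht => by linarith [(abs_le.1 (hd t x ht)).1], ?_, ?_⟩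
  · intro t x ht φ hφ hm
    rw [← add_assoc]
    exact hu.2.1 t x ht φ hφ hm
  · intro t x ht φ hφ hm
    rw [← add_assoc]
    exact hu.2.2 t x ht φ hφ hm

lemma range_eq_Ici_and_preimage_eq_Icc {H : ℝ → ℝ} {p₀ m : ℝ} (hc : Continuous H)
    (htop : Filter.Tendsto H Filter.atTop Filter.atTop)
    (hbot : Filter.Tendsto H Filter.atBot Filter.atTop)
    (hqc : ∀ c : ℝ, Convex ℝ {p : ℝ | H p ≤ c}) (hp₀ : H p₀ = m) (hm : ∀ p, m ≤ H p) :
    range H = Ici m ∧ ∃ θm θp : ℝ, θm ≤ θp ∧ H ⁻¹' {m} = Icc θm θp := by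
  constructor
  · refine Subset.antisymm (by rintro _ ⟨p, rfl⟩; exact hm p) fun y hy => ?_
    obtain ⟨q, hq⟩ := (htop.eventually_ge_atTop y).exists
    exact mem_range_of_exists_le_of_exists_ge hc ⟨p₀, hp₀.trans_le hy⟩ ⟨q, hq⟩
  · have hS : H ⁻¹' {m} = {p | H p ≤ m} := by
      ext p; simpa using ⟨fun h => h.le, fun h => le_antisymm h (hm p)⟩
    have hcpt : IsCompact (H ⁻¹' {m}) := by
      obtain ⟨A, hA⟩ := Filter.eventually_atTop.1 (htop.eventually_gt_atTop m)
      obtain ⟨B, hB⟩ := Filter.eventually_atBot.1 (hbot.eventually_gt_atTop m)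
      refine isCompact_Icc.of_isClosed_subset (s := Icc B A) (isClosed_singleton.preimage hc)
        fun p hp => ⟨?_, ?_⟩
      · by_contra! h
        exact (hB p h.le).ne' hp
      · by_contra! h
        exact (hA p h.le).ne' hp
    have hconn : IsConnected (H ⁻¹' {m}) :=
      ⟨⟨p₀, hp₀⟩, by rw [hS]; exact (hqc m).isPreconnected⟩
    have h := eq_Icc_of_connected_compact hconn hcpt
    refine ⟨_, _, ?_, h⟩
    have hp : p₀ ∈ H ⁻¹' {m} := hp₀
    rw [h] at hp
    exact hp.1.trans hp.2

section
variable {Ω : Type*} [MeasurableSpace Ω] {P : Measure Ω} [IsProbabilityMeasure P]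
variable {τ : ℝ → Ω → Ω}

lemma hasMean_flow (hτ : Measurable fun p : ℝ × Ω => τ p.1 p.2)
    (hτ_add : ∀ x y : ℝ, ∀ ω, τ (x + y) ω = τ x (τ y ω))
    (hτ_mp : ∀ x : ℝ, MeasurePreserving (τ x) P P)
    (hτ_erg : ∀ g : Ω → ℝ, Measurable g →
      (∀ x : ℝ, ∀ᵐ ω ∂P, g (τ x ω) = g ω) → ∃ c : ℝ, ∀ᵐ ω ∂P, g ω = c)
    {f : Ω → ℝ} {B : ℝ} (hf : Measurable f) (hB : ∀ ω, |f ω| ≤ B) :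
    ∀ᵐ ω ∂P, HasMean (fun x => f (τ x ω)) (∫ ω, f ω ∂P) ∧
      HasMean (fun x => f (τ (-x) ω)) (∫ ω, f ω ∂P) := by
  have h1 := eventually_abs_integral_flow_sub_le hτ hτ_add hτ_mp hτ_erg hf hB
  have h2 := eventually_abs_integral_flow_sub_le (τ := fun x => τ (-x))
    (hτ.comp (measurable_fst.neg.prodMk measurable_snd))
    (fun x y ω => by rw [neg_add, hτ_add]) (fun x => hτ_mp (-x))
    (fun g hg h => hτ_erg g hg fun x => by simpa using h (-x)) hf hB
  filter_upwards [h1, h2] with ω h1 h2 using ⟨h1, h2⟩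

variable {a V : Ω → ℝ} {G : ℝ → ℝ} {β p₀ κ η δ lam : ℝ} {f : Ω → ℝ}

lemma IsUpperCorrector.isPathCorrector
    (hf : IsUpperCorrector τ a V G β p₀ κ η δ lam f) {ω : Ω} {m : ℝ}
    (hm : HasMean (fun x => f (τ x ω)) m ∧ HasMean (fun x => f (τ (-x) ω)) m) :
    IsPathCorrector (fun x => a (τ x ω)) (fun x => V (τ x ω)) G β p₀ κ η δ lam m
      fun x => f (τ x ω) :=
  ⟨hf.corr ω, fun _ => hf.level _, hm.1, hm.2⟩

lemma IsUpperCorrector.isPathCorrector_reflect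
    (hf : IsUpperCorrector (fun x => τ (-x)) a V (fun p => G (-p)) β (-p₀) κ η δ lam f)
    {ω : Ω} {m : ℝ}
    (hm : HasMean (fun x => f (τ x ω)) m ∧ HasMean (fun x => f (τ (-x) ω)) m) :
    IsPathCorrector (fun x => a (τ x ω)) (fun x => V (τ x ω)) G β p₀ κ η δ lam (-m)
      fun x => -f (τ x ω) :=
  ⟨by simpa using (hf.corr ω).reflect, fun _ => hf.level _, hm.1.neg, hm.2.neg⟩

end

lemma tendsto_pow_mul_derivBound {η : ℕ → ℝ} (hη0 : ∀ n, 0 < η n)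
    (hη : Filter.Tendsto η Filter.atTop (nhds 0)) (κ L B : ℝ) :
    Filter.Tendsto (fun n => η n ^ 3 * derivBound κ L (η n) B) Filter.atTop (nhds 0) := by
  have h : ∀ n, η n ^ 3 * derivBound κ L (η n) B =
      2 * (L + 1) * η n ^ 2 + B * (4 * κ) ^ 2 * η n := fun n => by
    have := (hη0 n).ne'
    unfold derivBound
    field_simp
  simp_rw [h]
  simpa using ((hη.pow 2).const_mul (2 * (L + 1))).add (hη.const_mul (B * (4 * κ) ^ 2))

theorem stochastic_homogenization_quasiconvex
    {Ω : Type*} [MeasurableSpace Ω] (P : Measure Ω) [IsProbabilityMeasure P]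
    (τ : ℝ → Ω → Ω)
    (hτ_meas : Measurable (fun p : ℝ × Ω => τ p.1 p.2))
    (hτ_zero : ∀ ω, τ 0 ω = ω)
    (hτ_add : ∀ x y : ℝ, ∀ ω, τ (x + y) ω = τ x (τ y ω))
    (hτ_mp : ∀ x : ℝ, MeasurePreserving (τ x) P P)
    (hτ_erg : ∀ g : Ω → ℝ, Measurable g →
      (∀ x : ℝ, ∀ᵐ ω ∂P, g (τ x ω) = g ω) → ∃ c : ℝ, ∀ᵐ ω ∂P, g ω = c)
    (a V : ℝ → Ω → ℝ) (κ : ℝ) (hκ : 0 < κ)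
    (ha_meas : Measurable (fun p : ℝ × Ω => a p.1 p.2))
    (hV_meas : Measurable (fun p : ℝ × Ω => V p.1 p.2))
    (ha_range : ∀ x ω, a x ω ∈ Set.Icc (0 : ℝ) 1)
    (hV_range : ∀ x ω, V x ω ∈ Set.Icc (0 : ℝ) 1)
    (ha_lip : ∀ ω, LipschitzWith (Real.toNNReal κ) (fun x => Real.sqrt (a x ω)))
    (hV_lip : ∀ ω, LipschitzWith (Real.toNNReal κ) (fun x => V x ω))
    (ha_stat : ∀ x ω, a x ω = a 0 (τ x ω))
    (hV_stat : ∀ x ω, V x ω = V 0 (τ x ω))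
    -- the scaled hill condition (S)
    (hS : ∀ h ∈ Set.Ioo (0 : ℝ) 1, ∀ y : ℝ, 0 < y →
      ∃ Ωhy : Set Ω, MeasurableSet Ωhy ∧ P Ωhy = 1 ∧
        ∀ ω ∈ Ωhy, ∃ ℓ₁ ℓ₂ δ : ℝ, ℓ₁ < ℓ₂ ∧ 0 < δ ∧
          (∫ x in ℓ₁..ℓ₂, 1 / max (a x ω) δ) = y ∧
          ∀ x ∈ Set.Icc ℓ₁ ℓ₂, h ≤ V x ω)
    (β : ℝ) (hβ : 0 ≤ β)
    (G : ℝ → ℝ) (hG : MemGclass G)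
    (hG_qc : ∀ c : ℝ, Convex ℝ {p : ℝ | G p ≤ c}) :
    ∃ Heff : ℝ → ℝ, ∃ Ωhat : Set Ω, MeasurableSet Ωhat ∧ P Ωhat = 1 ∧
      -- (a) properties of the effective Hamiltonian
      MemGclass Heff ∧ Continuous Heff ∧
      Filter.Tendsto Heff Filter.atTop Filter.atTop ∧
      Filter.Tendsto Heff Filter.atBot Filter.atTop ∧
      (∀ c : ℝ, Convex ℝ {p : ℝ | Heff p ≤ c}) ∧
      Set.range Heff = Set.Ici (sInf (Set.range fun p => G p + β)) ∧
      (∃ θm θp : ℝ, θm ≤ θp ∧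
        Heff ⁻¹' {sInf (Set.range fun p => G p + β)} = Set.Icc θm θp) ∧
      -- (b) convergence of u_θ(t,0)/t to Heff(θ)
      (∀ ω ∈ Ωhat, ∀ θ : ℝ, ∀ uθ : ℝ → ℝ → ℝ,
        (∃ K : NNReal, LipschitzOnWith K (fun p : ℝ × ℝ => uθ p.1 p.2)
          (Set.Ici 0 ×ˢ Set.univ)) →
        IsParabolicViscSol (fun x => a x ω) (fun x => V x ω) G β uθ →
        (∀ x : ℝ, uθ 0 x = θ * x) →
        Filter.Tendsto (fun t => uθ t 0 / t) Filter.atTop (nhds (Heff θ))) := by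
  have hκ' : ((Real.toNNReal κ : NNReal) : ℝ) = κ := Real.coe_toNNReal _ hκ.le
  obtain ⟨α₀, α₁, γ, hα₀, hα₁, hγ, hGG⟩ := hG
  obtain ⟨p₀, hQ⟩ := hGG.exists_isQuasiconvexHamiltonian hα₀ hα₁ hγ hG_qc
  rw [hQ.sInf_range_add β]
  have hE : ∀ ω, IsEnvironment (fun x => a 0 (τ x ω)) (fun x => V 0 (τ x ω)) κ := fun ω => by
    simp_rw [← ha_stat, ← hV_stat]
    refine ⟨fun x => ha_range x ω, fun x => hV_range x ω, fun x y => ?_, fun x y => ?_⟩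
    · simpa only [Real.dist_eq, hκ'] using (ha_lip ω).dist_le_mul x y
    · simpa only [Real.dist_eq, hκ'] using (hV_lip ω).dist_le_mul x y
  have ham : Measurable (a 0) := ha_meas.comp measurable_prodMk_left
  have hVm : Measurable (V 0) := hV_meas.comp measurable_prodMk_left
  set η : ℕ → ℝ := fun n => 1 / ((n : ℝ) + 1) with hη_def
  have hη0 : ∀ n, 0 < η n := fun n => by positivity
  have hη1 : ∀ n, η n ≤ 1 := fun n => by
    rw [hη_def]; exact (div_le_one (by positivity)).2 (by linarith [n.cast_nonneg (α := ℝ)])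
  have hη : Filter.Tendsto η Filter.atTop (nhds 0) := tendsto_one_div_add_atTop_nhds_zero_nat
  have hδ0 : ∀ n, 0 < η n ^ 3 := fun n => pow_pos (hη0 n) 3
  have hδ1 : ∀ n, η n ^ 3 ≤ 1 := fun n => pow_le_one₀ (hη0 n).le (hη1 n)
  have hτ'_meas : Measurable fun p : ℝ × Ω => τ (-p.1) p.2 :=
    hτ_meas.comp (measurable_fst.neg.prodMk measurable_snd)
  have hτ'_zero : ∀ ω, τ (-0) ω = ω := by simpa using hτ_zero
  have hup : ∀ n lam, ∃ f : Ω → ℝ, G p₀ + β ≤ lam →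
      IsUpperCorrector τ (a 0) (V 0) G β p₀ κ (η n) (η n ^ 3) lam f := fun n lam => by
    by_cases h : G p₀ + β ≤ lam
    · obtain ⟨f, hf⟩ := exists_isUpperCorrector hτ_meas hτ_zero hτ_add ham hVm hE hQ hκ hβ
        (hη0 n) (hδ0 n) (hδ1 n) h
      exact ⟨f, fun _ => hf⟩
    · exact ⟨0, fun h' => absurd h' h⟩
  have hdown : ∀ n lam, ∃ f : Ω → ℝ, G p₀ + β ≤ lam →
      IsUpperCorrector (fun x => τ (-x)) (a 0) (V 0) (fun p => G (-p)) β (-p₀) κ (η n) (η n ^ 3)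
        lam f := fun n lam => by
    by_cases h : G p₀ + β ≤ lam
    · obtain ⟨f, hf⟩ := exists_isUpperCorrector (τ := fun x => τ (-x)) hτ'_meas hτ'_zero
        (fun x y ω => by rw [neg_add, hτ_add]) ham hVm (fun ω => (hE ω).reflect) hQ.reflect hκ hβ
        (hη0 n) (hδ0 n) (hδ1 n) (lam := lam) (by simpa using h)
      exact ⟨f, fun _ => hf⟩
    · exact ⟨0, fun h' => absurd h' h⟩
  choose f₂ hf₂ using hup
  choose f₁ hf₁ using hdown
  set M : ℕ → ℝ → ℝ := fun n lam => ∫ ω, f₂ n lam ω ∂P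
  set N : ℕ → ℝ → ℝ := fun n lam => ∫ ω, f₁ n lam ω ∂P
  have hM : IsSlopeFamily G p₀ β η M := isSlopeFamily_integral hτ_zero (ha_range 0) (hV_range 0)
    hβ hQ hη0 hδ0 hδ1 hf₂
  have hN : IsSlopeFamily (fun p => G (-p)) (-p₀) β η N :=
    isSlopeFamily_integral (τ := fun x => τ (-x)) hτ'_zero (ha_range 0) (hV_range 0)
      hβ hQ.reflect hη0 hδ0 hδ1 fun n lam h => hf₁ n lam (by simpa using h)
  have hmean₂ : ∀ᵐ ω ∂P, ∀ n : ℕ, ∀ q : ℚ, 0 ≤ q →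
      HasMean (fun x => f₂ n (G p₀ + β + q) (τ x ω)) (M n (G p₀ + β + q)) ∧
      HasMean (fun x => f₂ n (G p₀ + β + q) (τ (-x) ω)) (M n (G p₀ + β + q)) := by
    refine ae_all_iff.2 fun n => ae_all_iff.2 fun q => ?_
    by_cases hq : 0 ≤ q
    · have hf := hf₂ n (G p₀ + β + q) (by simpa)
      obtain ⟨B, hB⟩ := hQ.exists_abs_le (G p₀ + β + q)
      filter_upwards [hasMean_flow hτ_meas hτ_add hτ_mp hτ_erg hf.meas (hf.abs_le hB)] with ω h _
        using h
    · exact Filter.Eventually.of_forall fun ω h => absurd h hq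
  have hmean₁ : ∀ᵐ ω ∂P, ∀ n : ℕ, ∀ q : ℚ, 0 ≤ q →
      HasMean (fun x => f₁ n (G p₀ + β + q) (τ x ω)) (N n (G p₀ + β + q)) ∧
      HasMean (fun x => f₁ n (G p₀ + β + q) (τ (-x) ω)) (N n (G p₀ + β + q)) := by
    refine ae_all_iff.2 fun n => ae_all_iff.2 fun q => ?_
    by_cases hq : 0 ≤ q
    · have hf := hf₁ n (G p₀ + β + q) (by simpa)
      obtain ⟨B, hB⟩ := hQ.reflect.exists_abs_le (G p₀ + β + q)
      filter_upwards [hasMean_flow hτ_meas hτ_add hτ_mp hτ_erg hf.meas (hf.abs_le hB)] with ω h _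
        using h
    · exact Filter.Eventually.of_forall fun ω h => absurd h hq
  have hhill : ∀ᵐ ω ∂P, HasHills (fun x => a x ω) (fun x => V x ω) := by
    refine ae_all_iff.2 fun k => ae_all_iff.2 fun j => ?_
    obtain ⟨S, hSm, hS1, hSω⟩ := hS (1 - 1 / ((k : ℝ) + 2))
      ⟨sub_pos.2 ((div_lt_one (by positivity)).2 (by linarith [k.cast_nonneg (α := ℝ)])),
        by linarith [show 0 < 1 / ((k : ℝ) + 2) by positivity]⟩ ((j : ℝ) + 1) (by positivity)
    have : S ∈ ae P := (mem_ae_iff_prob_eq_one hSm).2 hS1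
    filter_upwards [this] with ω hω using hSω ω hω
  obtain ⟨Ωhat, hΩ, hΩm, hsub⟩ := (hmean₂.and (hmean₁.and hhill)).exists_measurable_mem
  rw [mem_ae_iff_prob_eq_one hΩm] at hΩ
  obtain ⟨α₂, hα₂, hH⟩ := memG_effectiveHamiltonian hQ hM hN hη hα₀ hα₁ hγ hβ hGG
  have hHc := hH.continuous hγ
  have htop := tendsto_atTop_of_rpow_le hα₀ hγ (fun p => (hH.1 p).1)
    Filter.tendsto_abs_atTop_atTop
  have hbot := tendsto_atTop_of_rpow_le hα₀ hγ (fun p => (hH.1 p).1)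
    Filter.tendsto_abs_atBot_atTop
  have hqc := convex_sublevel_effectiveHamiltonian hQ hM hN hη
  obtain ⟨hrange, hpre⟩ := range_eq_Ici_and_preimage_eq_Icc hHc htop hbot hqc
    (effectiveHamiltonian_min hQ hM hN hη) (min_le_effectiveHamiltonian hQ hM hN hη)
  refine ⟨_, Ωhat, hΩm, hΩ, ⟨α₀, α₂, γ, hα₀, hα₂, hγ, hH⟩, hHc, htop, hbot, hqc, hrange, hpre, ?_⟩
  rintro ω hω θ u ⟨K, hK⟩ hu hu0
  obtain ⟨hω₂, hω₁, hill⟩ := hsub ω hω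
  have hsol := isLinearDatumSol_of_lipschitz hK hu hu0
  simp_rw [ha_stat _ ω, hV_stat _ ω] at hsol hill
  have hL : ∀ l ∈ {l | ∃ q : ℚ, 0 ≤ q ∧ l = G p₀ + β + q}, G p₀ + β ≤ l := by
    rintro _ ⟨q, hq, rfl⟩; simpa
  refine hsol.tendsto_div hQ (hE ω) hκ hβ hη0 hη hδ0 hδ1
    (fun B => tendsto_pow_mul_derivBound hη0 hη κ _ B) hM hN
    (L := {l | ∃ q : ℚ, 0 ≤ q ∧ l = G p₀ + β + q}) ⟨0, le_rfl, by simp⟩ hL ?_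
    (f₂ := fun n l x => f₂ n l (τ x ω)) (f₁ := fun n l x => -f₁ n l (τ x ω)) ?_ ?_
    (fun n l hl x => (hf₂ n l (hL l hl)).ge _)
    (fun n l hl x => neg_le.1 ((hf₁ n l (hL l hl)).ge _)) hill
  · intro x y hx hxy
    obtain ⟨q, hq1, hq2⟩ := exists_rat_btwn (sub_lt_sub_right hxy (G p₀ + β))
    exact ⟨_, ⟨q, by exact_mod_cast (sub_nonneg.2 hx).trans hq1.le, rfl⟩, by linarith, by linarith⟩
  · intro n l hl
    have hl' := hL l hl
    obtain ⟨q, hq, rfl⟩ := hl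
    exact (hf₂ n _ hl').isPathCorrector (hω₂ n q hq)
  · intro n l hl
    have hl' := hL l hl
    obtain ⟨q, hq, rfl⟩ := hl
    exact (hf₁ n _ hl').isPathCorrector_reflect (hω₁ n q hq)
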